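/- arXiv:2310.12896 — 7 statements merged into one kernel-verified Lean document; each statement's English description precedes it below -/
import Mathlib

section
/- Protasov's Theorem: The segment TI bisects angle BTC; that is, ∠BTI = ∠ITC. -/
open EuclideanGeometry Real RealInnerProductSpace Affine

/-- The Euclidean plane. -/
abbrev Plane := EuclideanSpace ℝ (Fin 2)

lemma gram_expand (m u v a k BD CD p q g : ℝ)
    (hBD : BD = u^2 + m) (hCD : CD = v^2 + m)
    (hp : p = (m + BD - k*u^2)/2)
    (hq : q = (m + CD - k*v^2)/2)
    (hg : g = (BD + CD - a^2)/2) :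
    m*(BD*CD-g*g)-p*(p*CD-g*q)+q*(p*g-BD*q) = -((1-k)/2)^2*a^2*u^2*v^2
      + m*((u^2*v^2-((u^2+v^2-a^2)/2)^2) - ((1-k)/2)^2*(u^2-v^2)^2
      + (1-k)*(((u^2+v^2-a^2)/2)*(u^2+v^2)-2*u^2*v^2)) := by
  subst hp hq hg hBD hCD
  ring

set_option maxHeartbeats 2000000 in
lemma gram_root (x y z t k R : ℝ) (hx : 0 < x) (hy : 0 < y) (hz : 0 < z) (ht : 0 < t) (ht1 : t ≤ 1)
    (hk : 0 < k) (hk1 : k < 1) (hR : R = x * y * z / (x + y + z)) (BD CD p q g : ℝ)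
    (hBD : BD = (y + (1-t)*x)^2 + t^2*R) (hCD : CD = (z + (1-t)*x)^2 + t^2*R)
    (hp : p = (t^2*R + BD - k*(y + (1-t)*x)^2)/2)
    (hq : q = (t^2*R + CD - k*(z + (1-t)*x)^2)/2)
    (hg : g = (BD + CD - (y+z)^2)/2)
    (hQ : t^2*R*(BD*CD-g*g)-p*(p*CD-g*q)+q*(p*g-BD*q) = 0) :
    k*((y+z)*(y*z+(1-t)^2*x*(y+z+x))+4*t*(1-t)*x*y*z)
      = (y+z)*(y*z+(1-t)^2*x*(y+z+x)) := by
  have hs : 0 < x + y + z := by positivity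
  have hw : 0 ≤ 1 - t := by linarith
  have h : (k*((y+z)*(y*z+(1-t)^2*x*(y+z+x))+4*t*(1-t)*x*y*z)
      - (y+z)*(y*z+(1-t)^2*x*(y+z+x))) *
      (k*((y+z)*((x+y+z)*y*z+x*(y+z+(1-t)*x)^2)-4*t*x*y*z*(y+z+(1-t)*x))
        -(y+z)*((x+y+z)*y*z+x*(y+z+(1-t)*x)^2)) =
      -(4*(x+y+z)*(t^2*R*(BD*CD-g*g)-p*(p*CD-g*q)+q*(p*g-BD*q))) := by
    have hm : (x+y+z)*(t^2*R) = t^2*(x*y*z) := by rw [hR]; field_simp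
    rw [gram_expand _ _ _ (y+z) k _ _ _ _ _ hBD hCD hp hq hg]
    linear_combination (4*(((y + (1-t)*x)^2*(z + (1-t)*x)^2
      -(((y + (1-t)*x)^2+(z + (1-t)*x)^2-(y+z)^2)/2)^2) - ((1-k)/2)^2*((y + (1-t)*x)^2-(z + (1-t)*x)^2)^2
      + (1-k)*((((y + (1-t)*x)^2+(z + (1-t)*x)^2-(y+z)^2)/2)*((y + (1-t)*x)^2+(z + (1-t)*x)^2)-2*(y + (1-t)*x)^2*(z + (1-t)*x)^2)))*hm
  rw [hQ, mul_zero, neg_zero] at h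
  rcases mul_eq_zero.1 h with h | h
  · linarith
  · exfalso
    have h1 : 0 < (y+z)*((x+y+z)*y*z+x*(y+z+(1-t)*x)^2) := by positivity
    have h2 : 0 < k * (4*t*x*y*z*(y+z+(1-t)*x)) := by positivity
    have h3 : 0 < (1-k) * ((y+z)*((x+y+z)*y*z+x*(y+z+(1-t)*x)^2)) := mul_pos (by linarith) h1
    linarith

lemma key (b1 b2 c1 c2 i1 i2 d1 d2 t1 t2 x y z t k R : ℝ)
    (hx : 0 < x) (hy : 0 < y) (hz : 0 < z) (ht : 0 < t) (ht1 : t ≤ 1)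
    (hk : 0 < k) (hk1 : k < 1) (hR : R = x * y * z / (x + y + z))
    (hb : b1^2+b2^2 = (x+y)^2) (hc : c1^2+c2^2 = (x+z)^2)
    (hbc : (b1-c1)^2+(b2-c2)^2 = (y+z)^2)
    (hi1 : i1 = ((x+z)*b1+(x+y)*c1)/(2*(x+y+z)))
    (hi2 : i2 = ((x+z)*b2+(x+y)*c2)/(2*(x+y+z)))
    (hd1 : d1 = t * i1) (hd2 : d2 = t * i2)
    (hTD : (t1-d1)^2+(t2-d2)^2 = t^2*R)
    (hTB : (b1-t1)^2+(b2-t2)^2 = k*((b1-d1)^2+(b2-d2)^2-t^2*R))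
    (hTC : (c1-t1)^2+(c2-t2)^2 = k*((c1-d1)^2+(c2-d2)^2-t^2*R)) :
    (b1-t1)^2+(b2-t2)^2 = k*(y+(1-t)*x)^2 ∧ (c1-t1)^2+(c2-t2)^2 = k*(z+(1-t)*x)^2 ∧
    (z+(1-t)*x)*((b1-t1)*(i1-t1)+(b2-t2)*(i2-t2)) =
    (y+(1-t)*x)*((c1-t1)*(i1-t1)+(c2-t2)*(i2-t2)) := by
  have hs : 0 < x + y + z := by positivity
  have hg : b1*c1+b2*c2 = ((x+y)^2+(x+z)^2-(y+z)^2)/2 := by linarith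
  have gen : ∀ m n : ℝ, (m*b1+n*c1)^2+(m*b2+n*c2)^2 = 
     m^2*(x+y)^2+n^2*(x+z)^2+m*n*((x+y)^2+(x+z)^2-(y+z)^2) := by
    intro m n
    linear_combination m^2*hb+n^2*hc+2*m*n*hg
  have hII : i1^2+i2^2 = x^2+R := by
    rw [show i1^2+i2^2 = ((x+z)/(2*(x+y+z))*b1+(x+y)/(2*(x+y+z))*c1)^2
      +((x+z)/(2*(x+y+z))*b2+(x+y)/(2*(x+y+z))*c2)^2 from by rw [hi1, hi2]; ring, gen, hR]
    field_simp
    ring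
  have hBi : b1*i1+b2*i2 = x*(x+y) := by
    have : b1*i1+b2*i2 = ((x+z)*(b1^2+b2^2)+(x+y)*(b1*c1+b2*c2))/(2*(x+y+z)) := by
      rw [hi1, hi2]; ring
    rw [this, hb, hg]; field_simp; ring
  have hCi : c1*i1+c2*i2 = x*(x+z) := by
    have : c1*i1+c2*i2 = ((x+z)*(b1*c1+b2*c2)+(x+y)*(c1^2+c2^2))/(2*(x+y+z)) := by
      rw [hi1, hi2]; ring
    rw [this, hc, hg]; field_simp; ring
  have hBD : (b1-d1)^2+(b2-d2)^2 = (y+(1-t)*x)^2+t^2*R := by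
    rw [hd1, hd2]; linear_combination hb - 2*t*hBi + t^2*hII
  have hCD : (c1-d1)^2+(c2-d2)^2 = (z+(1-t)*x)^2+t^2*R := by
    rw [hd1, hd2]; linear_combination hc - 2*t*hCi + t^2*hII
  have hTB' : (b1-t1)^2+(b2-t2)^2 = k*(y+(1-t)*x)^2 := by rw [hTB, hBD]; ring
  have hTC' : (c1-t1)^2+(c2-t2)^2 = k*(z+(1-t)*x)^2 := by rw [hTC, hCD]; ring
  refine ⟨hTB', hTC', ?_⟩
  have hL := gram_root x y z t k R hx hy hz ht ht1 hk hk1 hR _ _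
    ((t1-d1)*(b1-d1)+(t2-d2)*(b2-d2)) ((t1-d1)*(c1-d1)+(t2-d2)*(c2-d2))
    ((b1-d1)*(c1-d1)+(b2-d2)*(c2-d2)) hBD hCD (by linarith) (by linarith) (by linarith)
    (by rw [← hTD]; ring)
  have hBI : (b1-i1)^2+(b2-i2)^2 = y^2+R := by linear_combination hb - 2*hBi + hII
  have hCI : (c1-i1)^2+(c2-i2)^2 = z^2+R := by linear_combination hc - 2*hCi + hII
  have hN : 0 < 2*(x+y+z)*(1-t)+(y+z)*t := by
    have : 0 ≤ 1 - t := by linarith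
    positivity
  have e1 : 2*(x+y+z)*i1 = (x+z)*b1+(x+y)*c1 := by rw [hi1]; field_simp
  have e2 : 2*(x+y+z)*i2 = (x+z)*b2+(x+y)*c2 := by rw [hi2]; field_simp
  obtain ⟨J, hJ⟩ : ∃ J, J = (i1-t1)^2+(i2-t2)^2 := ⟨_, rfl⟩
  have hRs : R*(x+y+z) = x*y*z := by rw [hR]; field_simp
  have hDI : (d1-i1)^2+(d2-i2)^2 = (1-t)^2*(x^2+R) := by
    rw [hd1, hd2]; linear_combination (1-t)^2*hII
  have hNJ : (2*(x+y+z)*(1-t)+(y+z)*t)*J = (y+z)*(t^2*R-(1-t)^2*(x^2+R))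
     + (1-t)*((x+z)*(k*(y+(1-t)*x)^2-(y^2+R))+(x+y)*(k*(z+(1-t)*x)^2-(z^2+R))) := by
    rw [← hTD, ← hTB', ← hTC', ← hBI, ← hCI, ← hDI, hJ, hd1, hd2]
    linear_combination (1-t)*(2*(i1-t1))*e1+ (1-t)*(2*(i2-t2))*e2
  have hL0 : k*(y+(1-t)*x)*(z+(1-t)*x) - J + R - y*z-(1-t)*x*(y+z) = 0 := by
    have : (2*(x+y+z)*(1-t)+(y+z)*t)*(k*(y+(1-t)*x)*(z+(1-t)*x) - J + R - y*z-(1-t)*x*(y+z)) = 0 := by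
      linear_combination hL - hNJ + 4*(1-t)*hRs
    exact (mul_eq_zero.1 this).resolve_left hN.ne'
  linear_combination (y-z)/2*hL0 + (z+(1-t)*x)/2*(hTB'-hBI) - (y+(1-t)*x)/2*(hTC'-hCI) + (y-z)/2*hJ


lemma hull3 (A B C X : Plane) (h : X ∈ convexHull ℝ ({A, B, C} : Set Plane)) :
    ∃ α β γ : ℝ, 0 ≤ α ∧ 0 ≤ β ∧ 0 ≤ γ ∧ α + β + γ = 1 ∧
      ∀ i, X i = α * A i + β * B i + γ * C i := by
  rw [convexHull_insert (by simp), convexHull_pair] at h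
  simp only [convexJoin_singleton_left, Set.mem_iUnion] at h
  obtain ⟨y, hy, hX⟩ := h
  obtain ⟨p, q, hp, hq, hpq, rfl⟩ := hy
  obtain ⟨m, n, hm, hn, hmn, rfl⟩ := hX
  refine ⟨m, n*p, n*q, hm, by positivity, by positivity, by rw [← hmn]; linear_combination n*hpq, ?_⟩
  intro i
  simp
  ring

lemma dist_sq' (P Q : Plane) : dist P Q ^ 2 = (P 0 - Q 0)^2 + (P 1 - Q 1)^2 := by
  rw [EuclideanSpace.dist_eq, Real.sq_sqrt (by positivity)]
  simp [Fin.sum_univ_two, Real.dist_eq, sq_abs]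

lemma infd (P A B : Plane) (hAB : A ≠ B) :
    Metric.infDist P (affineSpan ℝ ({A, B} : Set Plane) : Set Plane) * dist A B =
      |(B 0 - A 0) * (P 1 - A 1) - (B 1 - A 1) * (P 0 - A 0)| := by
  have hd : 0 < dist A B := dist_pos.2 hAB
  have hd2 := dist_sq' A B
  have hd2' : 0 < dist A B ^ 2 := by positivity
  obtain ⟨l, hl⟩ : ∃ l, l = ((B 0 - A 0) * (P 0 - A 0) + (B 1 - A 1) * (P 1 - A 1)) / dist A B ^ 2 := ⟨_, rfl⟩
  have key : ∀ m : ℝ, (dist P (AffineMap.lineMap A B m) * dist A B)^2 = 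
      ((B 0 - A 0) * (P 1 - A 1) - (B 1 - A 1) * (P 0 - A 0))^2 + (dist A B ^ 2)^2 * (l - m)^2 := by
    intro m
    have e : dist A B ^ 2 * l = (B 0 - A 0) * (P 0 - A 0) + (B 1 - A 1) * (P 1 - A 1) := by
      rw [hl]; field_simp
    have : (dist A B ^ 2)^2 * (l - m)^2 = (dist A B ^ 2 * l - m * dist A B ^ 2)^2 := by ring
    rw [this, e, mul_pow, dist_sq', hd2]
    simp only [AffineMap.lineMap_apply, vsub_eq_sub, vadd_eq_add, PiLp.add_apply, PiLp.smul_apply, PiLp.sub_apply, smul_eq_mul]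
    ring
  have hf : dist P (AffineMap.lineMap A B l) * dist A B = 
      |(B 0 - A 0) * (P 1 - A 1) - (B 1 - A 1) * (P 0 - A 0)| := by
    rw [← abs_of_nonneg (show 0 ≤ dist P (AffineMap.lineMap A B l) * dist A B by positivity)]
    rw [← sq_eq_sq_iff_abs_eq_abs, key]; ring
  rw [← hf]
  congr 1
  apply le_antisymm
  · exact Metric.infDist_le_dist_of_mem (AffineMap.lineMap_mem_affineSpan_pair l A B)
  · rw [Metric.le_infDist ⟨A, left_mem_affineSpan_pair ℝ A B⟩]
    intro y hy
    obtain ⟨m, rfl⟩ := (mem_affineSpan_pair_iff_exists_lineMap_eq).1 hy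
    refine le_of_mul_le_mul_right ?_ hd
    rw [hf]
    apply abs_le_of_sq_le_sq _ (by positivity)
    rw [key]
    nlinarith [mul_nonneg (sq_nonneg (dist A B ^ 2)) (sq_nonneg (l-m))]

lemma sphere_bc (A B C D : Plane) (ρ : ℝ) (hρ : 0 < ρ) (hBC : B ≠ C)
    (h : Metric.sphere D ρ ⊆ convexHull ℝ ({A, B, C} : Set Plane)) 
    (S : ℝ) (hS : S = (B 0 - A 0) * (C 1 - A 1) - (B 1 - A 1) * (C 0 - A 0)) (σ : ℝ) (hσ : σ^2 = 1)
    (hσS : 0 ≤ σ * S) :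
    ρ * dist B C ≤ σ * ((C 0 - B 0) * (D 1 - B 1) - (C 1 - B 1) * (D 0 - B 0)) := by
  have hd : 0 < dist B C := dist_pos.2 hBC
  have hd2 := dist_sq' B C
  have hm : (!₂[D 0 + σ * ρ / dist B C * (C 1 - B 1), D 1 - σ * ρ / dist B C * (C 0 - B 0)] : Plane) ∈ Metric.sphere D ρ := by
    rw [Metric.mem_sphere]
    rw [← sq_eq_sq₀ dist_nonneg hρ.le, dist_sq']
    simp
    field_simp
    rw [hd2, hσ]; ring
  obtain ⟨α, β, γ, hα, hβ, hγ, hs, hX⟩ := hull3 _ _ _ _ (h hm)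
  have h0 := hX 0
  have h1 := hX 1
  simp at h0 h1
  have e : 0 ≤ α * (σ * S) := by positivity
  have e2 : ρ * dist B C = σ ^ 2 * ρ / dist B C * dist B C ^ 2 := by rw [hσ]; field_simp
  have hα' : α = 1 - β - γ := by linarith
  rw [hS] at e
  rw [e2, hd2]
  have h0' : D 0 = α * A 0 + β * B 0 + γ * C 0 - σ * ρ / dist B C * (C 1 - B 1) := by linarith
  have h1' : D 1 = α * A 1 + β * B 1 + γ * C 1 + σ * ρ / dist B C * (C 0 - B 0) := by linarith
  rw [h0', h1']
  rw [← sub_nonneg]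
  refine e.trans (le_of_eq ?_)
  rw [hα']
  ring

lemma tangent_pt (B O D T : Plane) (R ρ : ℝ) (hR : 0 < R) (hρ : 0 < ρ) (hB : dist B O = R)
    (hext : dist O D = R + ρ) (hT : dist T O = R) (hw : Wbtw ℝ O T D) :
    (B 0 - T 0)^2 + (B 1 - T 1)^2 = R/(R+ρ) * ((B 0 - D 0)^2 + (B 1 - D 1)^2 - ρ^2) := by
  obtain ⟨m, ⟨hm0, hm1⟩, rfl⟩ := hw
  have hmR : m = R/(R+ρ) := by
    rw [dist_lineMap_left, Real.norm_of_nonneg hm0, hext] at hT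
    field_simp; exact hT
  have h1 : (O 0 - D 0)^2 + (O 1 - D 1)^2 = (R+ρ)^2 := by rw [← dist_sq', hext]
  have h2 : (B 0 - O 0)^2 + (B 1 - O 1)^2 = R^2 := by rw [← dist_sq', hB]
  have h3 : m * (R+ρ) = R := by rw [hmR]; field_simp
  rw [← hmR]
  simp only [AffineMap.lineMap_apply, vsub_eq_sub, vadd_eq_add, PiLp.add_apply, PiLp.smul_apply, PiLp.sub_apply, smul_eq_mul]
  have h4 : m*(m-1)*(R+ρ)^2 + (1-m)*R^2 + m*ρ^2 = 0 := by
    have : ρ = (R+ρ) - R := by ring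
    rw [hmR]; field_simp; ring
  linear_combination m*(m-1)*h1 + (1-m)*h2 + h4

theorem protasov_theorem
    (A B C I Oω D T : Plane) (r Rω ρ : ℝ)
    (hABC : AffineIndependent ℝ ![A, B, C])
    (hr : 0 < r)
    (hIin : I ∈ interior (convexHull ℝ ({A, B, C} : Set Plane)))
    (hIab : Metric.infDist I (affineSpan ℝ ({A, B} : Set Plane) : Set Plane) = r)
    (hIbc : Metric.infDist I (affineSpan ℝ ({B, C} : Set Plane) : Set Plane) = r)
    (hIca : Metric.infDist I (affineSpan ℝ ({C, A} : Set Plane) : Set Plane) = r)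
    (hRω : 0 < Rω) (hρ : 0 < ρ)
    (hBω : dist B Oω = Rω) (hCω : dist C Oω = Rω)
    (hγin : Metric.sphere D ρ ⊆ convexHull ℝ ({A, B, C} : Set Plane))
    (hγAB : Metric.infDist D (affineSpan ℝ ({A, B} : Set Plane) : Set Plane) = ρ)
    (hγAC : Metric.infDist D (affineSpan ℝ ({A, C} : Set Plane) : Set Plane) = ρ)
    (hext : dist Oω D = Rω + ρ)
    (hTω : dist T Oω = Rω) (hTγ : dist T D = ρ)
    (hTseg : Wbtw ℝ Oω T D)
    (hTin : T ∈ interior (convexHull ℝ ({A, B, C} : Set Plane)))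
 :
    ∠ B T I = ∠ I T C := by
  have hAB : A ≠ B := hABC.injective.ne (show (0 : Fin 3) ≠ 1 by decide)
  have hBC : B ≠ C := hABC.injective.ne (show (1 : Fin 3) ≠ 2 by decide)
  have hCA : C ≠ A := hABC.injective.ne (show (2 : Fin 3) ≠ 0 by decide)
  have hc0 : 0 < dist A B := dist_pos.2 hAB
  have ha0 : 0 < dist B C := dist_pos.2 hBC
  have hb0 : 0 < dist C A := dist_pos.2 hCA
  have tri1 : dist B C ≤ dist A B + dist C A := by
    have := dist_triangle B A C; rw [dist_comm B A, dist_comm A C] at this; exact this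
  have tri2 : dist C A ≤ dist B C + dist A B := by
    have := dist_triangle C B A; rw [dist_comm C B, dist_comm B A] at this; exact this
  have tri3 : dist A B ≤ dist C A + dist B C := by
    have := dist_triangle A C B; rw [dist_comm A C, dist_comm C B] at this; exact this
  have f1 := infd I A B hAB
  have f2 := infd I B C hBC
  have f3 := infd I C A hCA
  have f4 := infd D A B hAB
  have f5 := infd D A C hCA.symm
  rw [dist_comm A C] at f5
  have dc := dist_sq' A B
  have da := dist_sq' B C
  have db := dist_sq' C A
  rw [hIab] at f1
  rw [hIbc] at f2
  rw [hIca] at f3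
  rw [hγAB] at f4
  rw [hγAC] at f5
  have hDin : D ∈ convexHull ℝ ({A, B, C} : Set Plane) := by
    have hv : ‖(EuclideanSpace.single 0 ρ : Plane)‖ = ρ := by simp [abs_of_pos hρ]
    have h1 : D + EuclideanSpace.single 0 ρ ∈ Metric.sphere D ρ := by
      simp [mem_sphere_iff_norm, abs_of_pos hρ]
    have h2 : D - EuclideanSpace.single 0 ρ ∈ Metric.sphere D ρ := by
      simp [mem_sphere_iff_norm, abs_of_pos hρ]
    have := (convex_convexHull ℝ ({A, B, C} : Set Plane)) (hγin h1) (hγin h2)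
      (a := 1/2) (b := 1/2) (by norm_num) (by norm_num) (by norm_num)
    convert this using 1
    rw [← smul_add, add_add_sub_cancel, ← two_smul ℝ D, smul_smul]
    norm_num
  obtain ⟨α, β, γ, hα, hβ, hγ, hsum, hI⟩ := hull3 _ _ _ _ (interior_subset hIin)
  obtain ⟨α', β', γ', hα', hβ', hγ', hsum', hD⟩ := hull3 _ _ _ _ hDin
  obtain ⟨S, hS⟩ : ∃ S, S = (B 0 - A 0) * (C 1 - A 1) - (B 1 - A 1) * (C 0 - A 0) := ⟨_, rfl⟩
  have hα1 : α = 1 - β - γ := by linarith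
  have hα1' : α' = 1 - β' - γ' := by linarith
  have g1 : r * dist A B = γ * |S| := by
    rw [f1, ← abs_of_nonneg hγ, ← abs_mul, hS, hI 0, hI 1, hα1]; congr 1; ring
  have g2 : r * dist B C = α * |S| := by
    rw [f2, ← abs_of_nonneg hα, ← abs_mul, hS, hI 0, hI 1, hα1]; congr 1; ring
  have g3 : r * dist C A = β * |S| := by
    rw [f3, ← abs_of_nonneg hβ, ← abs_mul, hS, hI 0, hI 1, hα1]; congr 1; ring
  have g4 : ρ * dist A B = γ' * |S| := by
    rw [f4, ← abs_of_nonneg hγ', ← abs_mul, hS, hD 0, hD 1, hα1']; congr 1; ring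
  have g5 : ρ * dist C A = β' * |S| := by
    rw [f5, ← abs_of_nonneg hβ', ← abs_mul, hS, hD 0, hD 1, hα1', ← abs_neg]
    congr 1; ring
  have g6 : ρ * dist B C ≤ α' * |S| := by
    obtain ⟨σ, hσ, hσS⟩ : ∃ σ : ℝ, σ^2 = 1 ∧ σ * S = |S| := by
      rcases abs_cases S with h | h
      · exact ⟨1, by norm_num, by rw [h.1]; ring⟩
      · exact ⟨-1, by norm_num, by rw [h.1]; ring⟩
    refine (sphere_bc A B C D ρ hρ hBC hγin S hS σ hσ (by rw [hσS]; positivity)).trans (le_of_eq ?_)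
    rw [← hσS, hS, hD 0, hD 1, hα1']; ring
  have hSpos : |S| = r * (dist B C + dist C A + dist A B) := by
    linear_combination (-|S|) * hsum - g1 - g2 - g3
  have hρr : ρ ≤ r := by
    have h1 : ρ * (dist B C + dist C A + dist A B) ≤ r * (dist B C + dist C A + dist A B) := by
      rw [← hSpos]
      have : |S| = α' * |S| + β' * |S| + γ' * |S| := by linear_combination (-|S|) * hsum'
      linarith
    exact le_of_mul_le_mul_right h1 (by positivity)
  have heron : 4 * |S|^2 = 4 * dist A B^2 * dist C A^2 - (dist A B^2 + dist C A^2 - dist B C^2)^2 := by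
    rw [sq_abs, hS, dc, da, db]; ring
  obtain ⟨x, hx⟩ : ∃ x, x = (dist C A + dist A B - dist B C)/2 := ⟨_, rfl⟩
  obtain ⟨y, hy⟩ : ∃ y, y = (dist B C + dist A B - dist C A)/2 := ⟨_, rfl⟩
  obtain ⟨z, hz⟩ : ∃ z, z = (dist B C + dist C A - dist A B)/2 := ⟨_, rfl⟩
  have ea : dist B C = y + z := by rw [hy, hz]; ring
  have eb : dist C A = x + z := by rw [hx, hz]; ring
  have ec : dist A B = x + y := by rw [hx, hy]; ring
  have x0 : 0 ≤ x := by linarith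
  have y0 : 0 ≤ y := by linarith
  have z0 : 0 ≤ z := by linarith
  rw [ea] at ha0 da hSpos heron
  rw [eb] at hb0 db hSpos heron g3 g5
  rw [ec] at hc0 dc hSpos heron g1 g4
  have hs : 0 < x + y + z := by linarith
  have hr2 : r^2 * (x+y+z) = x*y*z := by
    rw [hSpos] at heron
    have : (16 * (x+y+z)) * (r^2 * (x+y+z)) = (16 * (x+y+z)) * (x*y*z) := by linear_combination heron
    exact mul_left_cancel₀ (by positivity) this
  have hxyz : 0 < x*y*z := by rw [← hr2]; positivity
  have xp : 0 < x := lt_of_le_of_ne x0 (by rintro rfl; simp at hxyz)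
  have yp : 0 < y := lt_of_le_of_ne y0 (by rintro rfl; simp at hxyz)
  have zp : 0 < z := lt_of_le_of_ne z0 (by rintro rfl; simp at hxyz)
  have hβe : β = (x+z)/(2*(x+y+z)) := by
    rw [hSpos] at g3
    field_simp
    exact mul_left_cancel₀ hr.ne' (by linear_combination -g3)
  have hγe : γ = (x+y)/(2*(x+y+z)) := by
    rw [hSpos] at g1
    field_simp
    exact mul_left_cancel₀ hr.ne' (by linear_combination -g1)
  have hβe' : β' = ρ/r*β := by
    rw [hβe]; rw [hSpos] at g5
    field_simp
    linear_combination -g5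
  have hγe' : γ' = ρ/r*γ := by
    rw [hγe]; rw [hSpos] at g4
    field_simp
    linear_combination -g4
  have hR : r^2 = x*y*z/(x+y+z) := by field_simp; exact hr2
  have htr : (ρ/r)^2*r^2 = ρ^2 := by field_simp
  obtain ⟨k1, k2, k3⟩ := key (B 0 - A 0) (B 1 - A 1) (C 0 - A 0) (C 1 - A 1) (I 0 - A 0) (I 1 - A 1)
    (D 0 - A 0) (D 1 - A 1) (T 0 - A 0) (T 1 - A 1) x y z (ρ/r) (Rω/(Rω+ρ)) (r^2) xp yp zp
    (by positivity) (by rw [div_le_one hr]; exact hρr) (by positivity)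
    (by rw [div_lt_one (by positivity)]; linarith) hR (by linarith) (by linarith) (by linarith)
    (by rw [hI 0, hα1, hβe, hγe]; field_simp; ring)
    (by rw [hI 1, hα1, hβe, hγe]; field_simp; ring)
    (by rw [hI 0, hD 0, hα1, hα1', hβe', hγe']; ring)
    (by rw [hI 1, hD 1, hα1, hα1', hβe', hγe']; ring)
    (by rw [htr, ← hTγ, dist_sq']; ring)
    (by
      have := tangent_pt B Oω D T Rω ρ hRω hρ hBω hext hTω hTseg
      rw [htr]; simpa only [sub_sub_sub_cancel_right] using this)
    (by
      have := tangent_pt C Oω D T Rω ρ hRω hρ hCω hext hTω hTseg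
      rw [htr]; simpa only [sub_sub_sub_cancel_right] using this)
  simp only [sub_sub_sub_cancel_right] at k1 k2 k3
  have hw : 0 ≤ 1 - ρ/r := by rw [sub_nonneg, div_le_one hr]; exact hρr
  have up : 0 < y + (1-ρ/r)*x := by positivity
  have vp : 0 < z + (1-ρ/r)*x := by positivity
  have kp : 0 < Rω/(Rω+ρ) := by positivity
  generalize y + (1-ρ/r)*x = u at *
  generalize z + (1-ρ/r)*x = v at *
  generalize Rω/(Rω+ρ) = k at *
  have nB : ‖B - T‖ = √k * u := by
    rw [← dist_eq_norm, ← sq_eq_sq₀ dist_nonneg (by positivity), dist_sq', k1, mul_pow, Real.sq_sqrt kp.le]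
  have nC : ‖C - T‖ = √k * v := by
    rw [← dist_eq_norm, ← sq_eq_sq₀ dist_nonneg (by positivity), dist_sq', k2, mul_pow, Real.sq_sqrt kp.le]
  have sk : 0 < √k := Real.sqrt_pos.2 kp
  rw [EuclideanGeometry.angle_comm I T C]
  unfold EuclideanGeometry.angle InnerProductGeometry.angle
  simp only [vsub_eq_sub]
  rw [nB, nC]
  congr 1
  have iB : ⟪B - T, I - T⟫ = (B 0 - T 0)*(I 0 - T 0)+(B 1 - T 1)*(I 1 - T 1) := by
    simp [PiLp.inner_apply, Fin.sum_univ_two]; ring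
  have iC : ⟪C - T, I - T⟫ = (C 0 - T 0)*(I 0 - T 0)+(C 1 - T 1)*(I 1 - T 1) := by
    simp [PiLp.inner_apply, Fin.sum_univ_two]; ring
  rw [iB, iC]
  by_cases hIT : ‖I - T‖ = 0
  · rw [hIT]; simp
  · rw [div_eq_div_iff (by positivity) (by positivity)]
    linear_combination (√k * ‖I - T‖) * k3
end

section
/- Then BU/CV = BT/CT; equivalently, dist(B,U)·dist(C,T) = dist(C,V)·dist(B,T). -/
open EuclideanGeometry Real RealInnerProductSpace Affine

theorem dist_sq_coord (P Q : Plane) : dist P Q ^ 2 = (P 0 - Q 0) ^ 2 + (P 1 - Q 1) ^ 2 := by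
  rw [EuclideanSpace.dist_sq_eq, Fin.sum_univ_two, Real.dist_eq, Real.dist_eq, sq_abs, sq_abs]

theorem key_s1 (O₁ O₂ T B U : Plane) (r₁ r₂ : ℝ)
    (hr₁ : 0 < r₁) (hr₂ : 0 < r₂)
    (hext : dist O₁ O₂ = r₁ + r₂)
    (hT₁ : dist T O₁ = r₁)
    (hTseg : Wbtw ℝ O₁ T O₂)
    (hB : dist B O₂ = r₂)
    (hU : dist U O₁ = r₁)
    (htanU : ⟪U - O₁, B - U⟫ = (0:ℝ)) :
    (r₁ + r₂) * dist B T ^ 2 = r₂ * dist B U ^ 2 := by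
  obtain ⟨t, ⟨ht0, ht1⟩, rfl⟩ := hTseg
  have hs : t * (r₁ + r₂) = r₁ := by
    rw [dist_lineMap_left, Real.norm_of_nonneg ht0, hext] at hT₁
    exact hT₁
  have e1 := dist_sq_coord O₁ O₂
  have e2 := dist_sq_coord B O₂
  have e3 := dist_sq_coord U O₁
  rw [hext] at e1
  rw [hB] at e2
  rw [hU] at e3
  have e4 : (U 0 - O₁ 0) * (B 0 - U 0) + (U 1 - O₁ 1) * (B 1 - U 1) = 0 := by
    simp [PiLp.inner_apply, Fin.sum_univ_two] at htanU
    linarith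
  have hBU : dist B U ^ 2 = (B 0 - O₁ 0) ^ 2 + (B 1 - O₁ 1) ^ 2 - r₁ ^ 2 := by
    rw [dist_sq_coord, e3]; linear_combination (-2) * e4
  have hBT : dist B (AffineMap.lineMap O₁ O₂ t) ^ 2 =
      (1 - t) * ((B 0 - O₁ 0) ^ 2 + (B 1 - O₁ 1) ^ 2) + t * r₂ ^ 2 - t * (r₁ + r₂) ^ 2
        + t ^ 2 * (r₁ + r₂) ^ 2 := by
    rw [dist_sq_coord, e1, e2]
    simp [AffineMap.lineMap_apply]
    ring
  rw [hBU, hBT]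
  generalize (B 0 - O₁ 0) ^ 2 + (B 1 - O₁ 1) ^ 2 = X
  linear_combination (-X + r₂ ^ 2 - (r₁ + r₂) ^ 2 + (r₁ + r₂) * (t * (r₁ + r₂) + r₁)) * hs

/-- Circles `Γ` (center `O₁`, radius `r₁`) and `Ω` (center `O₂`, radius `r₂`) are
externally tangent at `T`.  `B`, `C` lie on `Ω`, distinct from `T` and outside `Γ`;
`BU` and `CV` are tangent to `Γ` at `U` and `V`.  Then `BU/CV = BT/CT`, i.e.
`BU·CT = CV·BT`. -/
theorem tangent_length_ratio
    (O₁ O₂ T B C U V : Plane) (r₁ r₂ : ℝ)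
    (hr₁ : 0 < r₁) (hr₂ : 0 < r₂)
    (hext : dist O₁ O₂ = r₁ + r₂)
    (hT₁ : dist T O₁ = r₁) (hT₂ : dist T O₂ = r₂)
    (hTseg : Wbtw ℝ O₁ T O₂)
    (hB : dist B O₂ = r₂) (hC : dist C O₂ = r₂)
    (hBT : B ≠ T) (hCT : C ≠ T)
    (hBout : r₁ < dist B O₁) (hCout : r₁ < dist C O₁)
    (hU : dist U O₁ = r₁) (hV : dist V O₁ = r₁)
    (hBU : B ≠ U) (hCV : C ≠ V)
    (htanU : ⟪U - O₁, B - U⟫ = (0:ℝ))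
    (htanV : ⟪V - O₁, C - V⟫ = (0:ℝ)) :
    dist B U * dist C T = dist C V * dist B T := by
  have h1 := key_s1 O₁ O₂ T B U r₁ r₂ hr₁ hr₂ hext hT₁ hTseg hB hU htanU
  have h2 := key_s1 O₁ O₂ T C V r₁ r₂ hr₁ hr₂ hext hT₁ hTseg hC hV htanV
  have h3 : (dist B U * dist C T) ^ 2 = (dist C V * dist B T) ^ 2 := by
    apply mul_left_cancel₀ hr₂.ne'
    linear_combination (-dist C T ^ 2) * h1 + dist B T ^ 2 * h2
  exact (sq_eq_sq₀ (by positivity) (by positivity)).1 h3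
end

section
/- Then BF/CE = BZ/CZ; equivalently, dist(B,F)·dist(C,Z) = dist(C,E)·dist(B,Z). -/
open EuclideanGeometry Real RealInnerProductSpace Affine

lemma core0 (b1 b2 c1 c2 R κ x y : ℝ) (hb : b1^2+b2^2=1) (hc : c1^2+c2^2=1)
   (hb2 : 0 < b2) (hc2 : 0 < c2) (hκ : 1 < κ^2)
   (h1 : ((b1+c1)*(κ-b1)+(b2+c2)*b2)*(y-2*R*b2*b2)
      + ((b1+c1)*b2-(b2+c2)*(κ-b1))*(x-2*R*b2*b1)=0)
   (h2 : ((b1+c1)*(κ+c1)-(b2+c2)*c2)*(y-2*R*c2*c2)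
      + (-(b1+c1)*c2-(b2+c2)*(κ+c1))*(x-2*R*c2*c1)=0) :
   (b1+c1)*y-(b2+c2)*x=0 := by
  have hne : κ*(b2+c2)+c1*b2-b1*c2 ≠ 0 := by
    intro h
    have : (κ*(b2+c2))^2 = (b1*c2-c1*b2)^2 := by
      have : κ*(b2+c2) = b1*c2-c1*b2 := by linarith
      rw [this]
    have e1 : (b1*c2-c1*b2)^2 ≤ (b2+c2)^2 := by
      have hb1 : -1 ≤ b1 ∧ b1 ≤ 1 := by constructor <;> nlinarith
      have hc1 : -1 ≤ c1 ∧ c1 ≤ 1 := by constructor <;> nlinarith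
      apply sq_le_sq'
      · nlinarith
      · nlinarith
    have e2 : 0 < (b2+c2)^2 := by positivity
    nlinarith
  have : (κ*(b2+c2)+c1*b2-b1*c2) * ((b1+c1)*y-(b2+c2)*x) = 0 := by
    linear_combination c2*h1+b2*h2 + 2*R*b2*c2*(b2+c2)*(hb-hc)
  exact (mul_eq_zero.mp this).resolve_left hne

lemma aux1 (b1 b2 c1 c2 κ : ℝ) (hb : b1^2+b2^2=1) (hc : c1^2+c2^2=1) :
   (-2*(κ-b1)*b2 + (b1*c2+b2*c1)*((κ-b1)^2+b2^2)) * ((b1+c1)^2+(b2+c2)^2)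
    = (2*κ*(b1+c1) - ((b1+c1)^2+(b2+c2)^2)) * ((b2+c2)*(κ-b1)-(b1+c1)*b2) := by
  have hb' : b1^2 = 1 - b2^2 := by linarith
  have hc' : c1^2 = 1 - c2^2 := by linarith
  clear hb hc
  grind

lemma aux2 (b1 b2 c1 c2 κ : ℝ) (hb : b1^2+b2^2=1) (hc : c1^2+c2^2=1) :
   (-((κ-b1)^2-b2^2) + (b2*c2-b1*c1)*((κ-b1)^2+b2^2)) * ((b1+c1)^2+(b2+c2)^2)
    = -(2*κ*(b1+c1) - ((b1+c1)^2+(b2+c2)^2)) * ((b1+c1)*(κ-b1)+(b2+c2)*b2) := by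
  have hb' : b1^2 = 1 - b2^2 := by linarith
  have hc' : c1^2 = 1 - c2^2 := by linarith
  clear hb hc
  grind

lemma half (b1 b2 c1 c2 R κ x y u v : ℝ) (hb : b1^2+b2^2=1) (hc : c1^2+c2^2=1)
   (hb2 : b2 ≠ 0) (hR : R ≠ 0) (hw : b2 + c2 ≠ 0)
   (e1 : -(2*R*b2*b1) = R*(κ^2-1)*u - κ*(2*R*b2)*v)
   (e2 : -R*(κ^2-1) - 2*R*b2*b2 = R*(κ^2-1)*v + κ*(2*R*b2)*u)
   (hN : ¬ (u + (b1*c2+b2*c1) = 0 ∧ v + (b2*c2-b1*c1) = 0))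
   (hf : (u + (b1*c2+b2*c1))*(x-2*R*b2*b1) + (v + (b2*c2-b1*c1))*(y-2*R*b2*b2) = 0) :
   ((b1+c1)*(κ-b1)+(b2+c2)*b2)*(y-2*R*b2*b2)
      + ((b1+c1)*b2-(b2+c2)*(κ-b1))*(x-2*R*b2*b1)=0 := by
  have hP : R*((κ+b1)^2+b2^2) ≠ 0 := by
    have : 0 < b2^2 := by positivity
    have : 0 < (κ+b1)^2+b2^2 := by positivity
    exact mul_ne_zero hR this.ne'
  have hK : (κ-b1)^2+b2^2 ≠ 0 := by
    have : 0 < b2^2 := by positivity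
    positivity
  have hW : (b1+c1)^2+(b2+c2)^2 ≠ 0 := by
    have : 0 < (b2+c2)^2 := by positivity
    positivity
  have g1 : u*(κ-b1) - v*b2 = -b2 := by
    apply mul_left_cancel₀ hP
    have hb' : b1^2 = 1 - b2^2 := by linarith
    clear hf hN hw hP hK hW
    grind
  have g2 : u*b2+v*(κ-b1) = -(κ-b1) := by
    apply mul_left_cancel₀ hP
    have hb' : b1^2 = 1 - b2^2 := by linarith
    clear hf hN hw hP hK hW g1
    grind
  have u1 : u*((κ-b1)^2+b2^2) = -2*(κ-b1)*b2 := by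
    linear_combination (κ-b1)*g1+b2*g2
  have v1 : v*((κ-b1)^2+b2^2) = -((κ-b1)^2-b2^2) := by
    linear_combination (κ-b1)*g2-b2*g1
  have a1 := aux1 b1 b2 c1 c2 κ hb hc
  have a2 := aux2 b1 b2 c1 c2 κ hb hc
  rw [← u1, ← add_mul] at a1
  rw [← v1, ← add_mul] at a2
  have hM : 2*κ*(b1+c1) - ((b1+c1)^2+(b2+c2)^2) ≠ 0 := by
    intro h
    rw [h] at a1 a2
    apply hN
    constructor
    · simpa [hK, hW] using a1
    · simpa [hK, hW] using a2
  apply mul_left_cancel₀ hM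
  linear_combination (-(((κ-b1)^2+b2^2)*((b1+c1)^2+(b2+c2)^2)))*hf + (x-2*R*b2*b1)*a1+(y-2*R*b2*b2)*a2


lemma core1 (bx bY cx cY lb lc R κ ρ x y u1 v1 u2 v2 u3 v3 : ℝ)
   (hlb : 0 < lb) (hlc : 0 < lc) (hR : 0 < R) (hκ : 1 < κ^2) (hρ : ρ = R*(κ^2-1))
   (hB : lb^2 = bx^2+bY^2) (hB' : lb^2 = 2*R*bY)
   (hC : lc^2 = cx^2+cY^2) (hC' : lc^2 = 2*R*cY)
   (e1 : -bx = ρ*u1 - κ*lb*v1) (e2 : -ρ-bY = ρ*v1+κ*lb*u1)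
   (e3 : -cx = ρ*u2 + κ*lc*v2) (e4 : -ρ-cY = ρ*v2-κ*lc*u2)
   (h3 : u3^2+v3^2=1) (h3' : u3*(cx-bx)+v3*(cY-bY)=0) (h3n : u3*bx+v3*bY<0)
   (hBC : ¬ (bx = cx ∧ bY = cY))
   (hN1 : ¬ (u1 = u3 ∧ v1 = v3)) (hN2 : ¬ (u2 = u3 ∧ v2 = v3))
   (f1 : (u1-u3)*(x-bx)+(v1-v3)*(y-bY)=0)
   (f2 : (u2-u3)*(x-cx)+(v2-v3)*(y-cY)=0) :
   (lc*bx+lb*cx)*y-(lc*bY+lb*cY)*x=0 := by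
  obtain ⟨b1, rfl⟩ : ∃ b1, bx = lb*b1 := ⟨bx/lb, by field_simp⟩
  obtain ⟨b2, rfl⟩ : ∃ b1, bY = lb*b1 := ⟨bY/lb, by field_simp⟩
  obtain ⟨c1, rfl⟩ : ∃ b1, cx = lc*b1 := ⟨cx/lc, by field_simp⟩
  obtain ⟨c2, rfl⟩ : ∃ b1, cY = lc*b1 := ⟨cY/lc, by field_simp⟩
  have hb : b1^2+b2^2=1 := by
    apply mul_left_cancel₀ (pow_pos hlb 2).ne'
    linear_combination -hB
  have hc : c1^2+c2^2=1 := by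
    apply mul_left_cancel₀ (pow_pos hlc 2).ne'
    linear_combination -hC
  have hlb' : lb = 2*R*b2 := by
    apply mul_left_cancel₀ hlb.ne'
    linear_combination hB'
  have hlc' : lc = 2*R*c2 := by
    apply mul_left_cancel₀ hlc.ne'
    linear_combination hC'
  have hb2 : 0 < b2 := by
    by_contra h
    nlinarith
  have hc2 : 0 < c2 := by
    by_contra h
    nlinarith
  clear hB hB' hC hC'
  subst hρ
  subst hlb' hlc'
  -- n3 = -ν
  set p := b1*c2+b2*c1 with hp
  set q := b2*c2-b1*c1 with hq
  have hν : p^2+q^2 = 1 := by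
    have : p^2+q^2 = (b1^2+b2^2)*(c1^2+c2^2) := by rw [hp, hq]; ring
    rw [this, hb, hc]; ring
  have hνB : p*(2*R*b2*b1)+q*(2*R*b2*b2) = 2*R*b2*c2 := by
    rw [hp, hq]; linear_combination (2*R*b2*c2)*hb
  have hνC : p*(2*R*c2*c1)+q*(2*R*c2*c2) = 2*R*b2*c2 := by
    rw [hp, hq]; linear_combination (2*R*b2*c2)*hc
  have hcr : u3*q-v3*p = 0 := by
    by_contra hne
    apply hBC
    have hd : p*(2*R*c2*c1-2*R*b2*b1)+q*(2*R*c2*c2-2*R*b2*b2)=0 := by linarith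
    constructor
    · apply mul_left_cancel₀ hne
      linear_combination v3*hd - q*h3'
    · apply mul_left_cancel₀ hne
      linear_combination p*h3' - u3*hd
  have hs : (u3*p+v3*q)^2 = 1 := by
    linear_combination (u3^2+v3^2)*hν + h3 - (u3*q-v3*p)*hcr
  have hu3 : u3 = (u3*p+v3*q)*p := by linear_combination -u3*hν + q*hcr
  have hv3 : v3 = (u3*p+v3*q)*q := by linear_combination -v3*hν - p*hcr
  have hneg : u3*p+v3*q = -1 := by
    have h0 : u3*(2*R*b2*b1)+v3*(2*R*b2*b2) = (u3*p+v3*q)*(2*R*b2*c2) := by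
      linear_combination (2*R*b2*b1)*hu3 + (2*R*b2*b2)*hv3 + (u3*p+v3*q)*hνB
    rw [h0] at h3n
    have h5 : 0 < 2*R*b2*c2 := by positivity
    have h6 : (u3*p+v3*q-1)*(u3*p+v3*q+1) = 0 := by linear_combination hs
    rcases mul_eq_zero.mp h6 with h | h
    · have h7 : u3*p+v3*q = 1 := by linarith
      rw [h7] at h3n; linarith
    · linarith
  rw [hneg] at hu3 hv3
  have hu3' : u3 = -p := by linarith
  have hv3' : v3 = -q := by linarith
  subst hu3' hv3'
  have H1 := half b1 b2 c1 c2 R κ x y u1 v1 hb hc hb2.ne' hR.ne' (by positivity)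
    (by linarith) (by linarith) (by
      rintro ⟨h, h'⟩
      exact hN1 ⟨by linarith, by linarith⟩) (by rw [← hp, ← hq]; linear_combination f1)
  have H2 := half (-c1) (-c2) (-b1) (-b2) R κ x y u2 v2 (by linarith) (by linarith) (by simpa using hc2.ne') hR.ne' 
    (by have : 0 < b2+c2 := by positivity
        intro h; linarith)
    (by linarith) (by linarith) (by
      rintro ⟨h, h'⟩
      exact hN2 ⟨by rw [hp]; linarith, by rw [hq]; linarith⟩) (by rw [hp, hq] at f2; linear_combination f2)
  have := core0 b1 b2 c1 c2 R κ x y hb hc hb2 hc2 hκ H1 (by linear_combination -H2)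
  linear_combination (4*R^2*b2*c2)*this

lemma core2 (nx ny bx bY cx cY lb lc R κ ρ x y u1 v1 u2 v2 u3 v3 : ℝ)
   (hn : nx^2+ny^2=1)
   (hlb : 0 < lb) (hlc : 0 < lc) (hR : 0 < R) (hκ : 1 < κ^2) (hρ : ρ = R*(κ^2-1))
   (hB : lb^2 = bx^2+bY^2) (hB' : lb^2 = 2*R*(bx*nx+bY*ny))
   (hC : lc^2 = cx^2+cY^2) (hC' : lc^2 = 2*R*(cx*nx+cY*ny))
   (e1 : -ρ*nx-bx = ρ*u1 - κ*lb*v1) (e2 : -ρ*ny-bY = ρ*v1+κ*lb*u1)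
   (e3 : -ρ*nx-cx = ρ*u2 + κ*lc*v2) (e4 : -ρ*ny-cY = ρ*v2-κ*lc*u2)
   (h3 : u3^2+v3^2=1) (h3' : u3*(cx-bx)+v3*(cY-bY)=0) (h3n : u3*bx+v3*bY<0)
   (hBC : ¬ (bx = cx ∧ bY = cY))
   (hN1 : ¬ (u1 = u3 ∧ v1 = v3)) (hN2 : ¬ (u2 = u3 ∧ v2 = v3))
   (f1 : (u1-u3)*(x-bx)+(v1-v3)*(y-bY)=0)
   (f2 : (u2-u3)*(x-cx)+(v2-v3)*(y-cY)=0) :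
   (lc*bx+lb*cx)*y-(lc*bY+lb*cY)*x=0 := by
  have key : ∀ a b c d : ℝ, a*ny-b*nx = c*ny-d*nx → a*nx+b*ny = c*nx+d*ny → a = c ∧ b = d := by
    intro a b c d h h'
    constructor
    · linear_combination ny*h+nx*h' - (a-c)*hn
    · linear_combination -nx*h+ny*h' - (b-d)*hn
  have := core1 (bx*ny-bY*nx) (bx*nx+bY*ny) (cx*ny-cY*nx) (cx*nx+cY*ny) lb lc R κ ρ
    (x*ny-y*nx) (x*nx+y*ny) (u1*ny-v1*nx) (u1*nx+v1*ny) (u2*ny-v2*nx) (u2*nx+v2*ny)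
    (u3*ny-v3*nx) (u3*nx+v3*ny) hlb hlc hR hκ hρ
    (by linear_combination hB - (bx^2+bY^2)*hn) hB'
    (by linear_combination hC - (cx^2+cY^2)*hn) hC'
    (by linear_combination ny*e1-nx*e2) (by linear_combination nx*e1+ny*e2+ρ*hn)
    (by linear_combination ny*e3-nx*e4) (by linear_combination nx*e3+ny*e4+ρ*hn)
    (by linear_combination h3 + (u3^2+v3^2)*hn)
    (by linear_combination h3' + (u3*(cx-bx)+v3*(cY-bY))*hn)
    (by
      have : (u3*ny-v3*nx)*(bx*ny-bY*nx)+(u3*nx+v3*ny)*(bx*nx+bY*ny) = u3*bx+v3*bY := by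
        linear_combination (u3*bx+v3*bY)*hn
      rw [this]; exact h3n)
    (fun h => hBC (key _ _ _ _ h.1 h.2))
    (fun h => hN1 (key _ _ _ _ h.1 h.2))
    (fun h => hN2 (key _ _ _ _ h.1 h.2))
    (by linear_combination f1 + ((u1-u3)*(x-bx)+(v1-v3)*(y-bY))*hn)
    (by linear_combination f2 + ((u2-u3)*(x-cx)+(v2-v3)*(y-cY))*hn)
  linear_combination this - ((lc*bx+lb*cx)*y-(lc*bY+lb*cY)*x)*hn


/-- Tangent length: with origin `T`, `D = -ρ n`. -/
lemma tang (nx ny bx bY ax ay lb L R ρ κ s σ : ℝ)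
   (hn : nx^2+ny^2=1) (hL : 0 < L) (hlb : 0 < lb) (hR : 0 < R) (hκ : 0 < κ)
   (hρ : ρ = R*(κ^2-1)) (hσ : σ^2 = 1)
   (hL2 : L^2 = (bx-ax)^2+(bY-ay)^2)
   (hB : lb^2 = bx^2+bY^2) (hB' : lb^2 = 2*R*(bx*nx+bY*ny))
   (hD : (bx-ax)*(-ρ*ny-ay)-(bY-ay)*(-ρ*nx-ax) = σ*ρ*L)
   (hs : s ≤ 1)
   (hF : (-ρ*nx-(ax+s*(bx-ax)))^2+(-ρ*ny-(ay+s*(bY-ay)))^2 = ρ^2) :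
   (1-s)*L = κ*lb ∧
   -ρ*nx-bx = ρ*(-σ*(bY-ay)/L) - (1-s)*(bx-ax) ∧
   -ρ*ny-bY = ρ*(σ*(bx-ax)/L) - (1-s)*(bY-ay) := by
  obtain ⟨u, hu⟩ : ∃ u, u = -σ*(bY-ay)/L := ⟨_, rfl⟩
  obtain ⟨v, hv⟩ : ∃ u, u = σ*(bx-ax)/L := ⟨_, rfl⟩
  have hu' : bY-ay = -σ*L*u := by
    rw [hu]; field_simp; linear_combination -(bY-ay)*hσ
  have hv' : bx-ax = σ*L*v := by
    rw [hv]; field_simp; linear_combination -(bx-ax)*hσ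
  have huv : u^2+v^2=1 := by
    apply mul_left_cancel₀ (pow_pos hL 2).ne'
    rw [hu', hv'] at hL2
    linear_combination -hL2 - L^2*(u^2+v^2)*hσ
  rw [← hu, ← hv]
  obtain ⟨g1, hg1⟩ : ∃ g, g = -ρ*nx-(ax+s*(bx-ax)) := ⟨_, rfl⟩
  obtain ⟨g2, hg2⟩ : ∃ g, g = -ρ*ny-(ay+s*(bY-ay)) := ⟨_, rfl⟩
  rw [← hg1, ← hg2] at hF
  have hdot : u*g1+v*g2=ρ := by
    have h : (σ*L)*(u*g1+v*g2) = (σ*L)*ρ := by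
      have : (bx-ax)*g2-(bY-ay)*g1 = σ*ρ*L := by
        rw [hg1, hg2]; linear_combination hD
      rw [hu', hv'] at this
      linear_combination this
    have hσ0 : σ ≠ 0 := by rintro rfl; norm_num at hσ
    exact mul_left_cancel₀ (mul_ne_zero hσ0 hL.ne') h
  have hz : (g1-ρ*u)^2+(g2-ρ*v)^2=0 := by
    linear_combination hF - 2*ρ*hdot + ρ^2*huv
  have hz1 : g1 = ρ*u := by
    have h0 : (g1-ρ*u)^2 = 0 := by linarith [sq_nonneg (g1-ρ*u), sq_nonneg (g2-ρ*v)]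
    have := pow_eq_zero_iff (two_ne_zero) |>.mp h0
    linarith
  have hz2 : g2 = ρ*v := by
    have h0 : (g2-ρ*v)^2 = 0 := by linarith [sq_nonneg (g1-ρ*u), sq_nonneg (g2-ρ*v)]
    have := pow_eq_zero_iff (two_ne_zero) |>.mp h0
    linarith
  have k1 : -ρ*nx-bx = ρ*u - (1-s)*(bx-ax) := by linear_combination hz1 - hg1
  have k2 : -ρ*ny-bY = ρ*v - (1-s)*(bY-ay) := by linear_combination hz2 - hg2
  refine ⟨?_, k1, k2⟩
  have hsq : ((1-s)*L)^2 = (κ*lb)^2 := by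
    have hd : (-ρ*nx-bx)^2+(-ρ*ny-bY)^2 = ρ^2 + ((1-s)*L)^2 := by
      rw [k1, k2, hu', hv']
      linear_combination ρ^2*huv + (1-s)^2*L^2*σ^2*huv + (1-s)^2*L^2*hσ
    have hd2 : R*((-ρ*nx-bx)^2+(-ρ*ny-bY)^2) = R*(ρ^2 + lb^2) + ρ*lb^2 := by
      linear_combination R*ρ^2*hn - R*hB - ρ*hB'
    apply mul_left_cancel₀ hR.ne'
    rw [hd] at hd2
    linear_combination hd2 + lb^2*hρ
  have h1 : 0 ≤ (1-s)*L := mul_nonneg (by linarith) hL.le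
  have h2 : 0 ≤ κ*lb := by positivity
  exact (pow_left_inj₀ h1 h2 two_ne_zero).mp hsq

lemma main3 (ax ay bx bY cx cY ix iy nx ny LA LB LC lb lc R ρ r s s' σ : ℝ)
   (hn : nx^2+ny^2=1) (hσ : σ^2=1)
   (hLA : 0 < LA) (hLB : 0 < LB) (hLC : 0 < LC) (hlb : 0 < lb) (hlc : 0 < lc)
   (hR : 0 < R) (hρ : 0 < ρ)
   (hLA2 : LA^2 = (cx-bx)^2+(cY-bY)^2)
   (hLB2 : LB^2 = (ax-cx)^2+(ay-cY)^2)
   (hLC2 : LC^2 = (bx-ax)^2+(bY-ay)^2)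
   (hS : (bx-ax)*(cY-ay)-(bY-ay)*(cx-ax) ≠ 0)
   (hIab : (bx-ax)*(iy-ay)-(bY-ay)*(ix-ax) = σ*r*LC)
   (hIbc : (cx-bx)*(iy-bY)-(cY-bY)*(ix-bx) = σ*r*LA)
   (hIca : (ax-cx)*(iy-cY)-(ay-cY)*(ix-cx) = σ*r*LB)
   (hDab : (bx-ax)*(-ρ*ny-ay)-(bY-ay)*(-ρ*nx-ax) = σ*ρ*LC)
   (hDca : (ax-cx)*(-ρ*ny-cY)-(ay-cY)*(-ρ*nx-cx) = σ*ρ*LB)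
   (hT : 0 ≤ σ*((cx-bx)*(0-bY)-(cY-bY)*(0-bx)))
   (hB : lb^2 = bx^2+bY^2) (hB' : lb^2 = 2*R*(bx*nx+bY*ny))
   (hC : lc^2 = cx^2+cY^2) (hC' : lc^2 = 2*R*(cx*nx+cY*ny))
   (hs : s ≤ 1) (hs' : s' ≤ 1)
   (hF : (-ρ*nx-(ax+s*(bx-ax)))^2+(-ρ*ny-(ay+s*(bY-ay)))^2 = ρ^2)
   (hE : (-ρ*nx-(ax+s'*(cx-ax)))^2+(-ρ*ny-(ay+s'*(cY-ay)))^2 = ρ^2) :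
   ((1-s)*LC)*lc = ((1-s')*LB)*lb ∧ bx*cY-bY*cx ≠ 0 ∧
   (lc*bx+lb*cx)*iy-(lc*bY+lb*cY)*ix=0 := by
  have hσ0 : σ ≠ 0 := by rintro rfl; norm_num at hσ
  obtain ⟨κ, hκ⟩ : ∃ κ, κ = √((R+ρ)/R) := ⟨_, rfl⟩
  have hκ0 : 0 < κ := by rw [hκ]; positivity
  have hκ2 : κ^2 = (R+ρ)/R := by rw [hκ]; exact Real.sq_sqrt (by positivity)
  have hρR : ρ = R*(κ^2-1) := by rw [hκ2]; field_simp; ring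
  have hκ1 : 1 < κ^2 := by
    rw [hκ2, lt_div_iff₀ hR]; linarith
  obtain ⟨t1, t2, t3⟩ := tang nx ny bx bY ax ay lb LC R ρ κ s σ hn hLC hlb hR hκ0 hρR hσ hLC2 hB hB'
    hDab hs hF
  obtain ⟨t4, t5, t6⟩ := tang nx ny cx cY ax ay lc LB R ρ κ s' (-σ) hn hLB hlc hR hκ0 hρR
    (by linarith) (by linarith) hC hC' (by linear_combination -hDca) hs' hE
  have hBC : ¬ (bx = cx ∧ bY = cY) := by
    rintro ⟨rfl, rfl⟩
    apply hS; ring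
  have hcr : bx*cY-bY*cx ≠ 0 := by
    intro h
    have hl : (cx*bx+cY*bY)*lb^2 = (cx*bx+cY*bY)^2 := by
      -- C = μ B, μ = C.B / lb^2
      have h1 : lb^2*cx = (cx*bx+cY*bY)*bx := by
        rw [hB]; linear_combination -bY*h
      have h2 : lb^2*cY = (cx*bx+cY*bY)*bY := by
        rw [hB]; linear_combination bx*h
      have h3 : lb^2*lc^2 = (cx*bx+cY*bY)*lb^2 := by
        rw [hC']
        linear_combination (2*R)*(nx*h1+ny*h2) - (cx*bx+cY*bY)*hB'
      have h4 : lb^2*lc^2 = (cx*bx+cY*bY)^2 := by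
        rw [hB, hC]; linear_combination (bx*cY-bY*cx)*h
      linarith
    have h0 : cx*bx+cY*bY ≠ 0 := by
      intro h0
      have h4 : lb^2*lc^2 = (cx*bx+cY*bY)^2 := by
        rw [hB, hC]; linear_combination (bx*cY-bY*cx)*h
      rw [h0] at h4
      have : 0 < lb^2*lc^2 := by positivity
      rw [h4] at this; norm_num at this
    have h5 : lb^2 = cx*bx+cY*bY := by
      apply mul_left_cancel₀ h0
      linear_combination hl
    have hl0 := (pow_pos hlb 2).ne'
    apply hBC
    constructor
    · apply mul_left_cancel₀ hl0
      linear_combination bx*h5 - cx*hB + bY*h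
    · apply mul_left_cancel₀ hl0
      linear_combination bY*h5 - cY*hB - bx*h
  refine ⟨by rw [t1, t4]; ring, hcr, ?_⟩
  have hTp : 0 < σ*((cx-bx)*(0-bY)-(cY-bY)*(0-bx)) := by
    apply lt_of_le_of_ne hT
    intro h
    apply hcr
    rcases mul_eq_zero.mp h.symm with h | h
    · exact absurd h hσ0
    · linear_combination h
  apply core2 nx ny bx bY cx cY lb lc R (σ*κ) ρ ix iy (-σ*(bY-ay)/LC) (σ*(bx-ax)/LC)
    (-σ*(ay-cY)/LB) (σ*(ax-cx)/LB) (-σ*(cY-bY)/LA) (σ*(cx-bx)/LA) hn hlb hlc hR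
    (by rw [mul_pow, hσ, one_mul]; exact hκ1) (by rw [mul_pow, hσ, one_mul]; exact hρR) hB hB' hC hC'
  · rw [t2, mul_assoc σ κ lb, ← t1]; field_simp; linear_combination (1-s)*LC*(bx-ax)*hσ
  · rw [t3, mul_assoc σ κ lb, ← t1]; field_simp; linear_combination (1-s)*LC*(bY-ay)*hσ
  · rw [t5, mul_assoc σ κ lc, ← t4]; field_simp; linear_combination (1-s')*LB*(cx-ax)*hσ
  · rw [t6, mul_assoc σ κ lc, ← t4]; field_simp; linear_combination (1-s')*LB*(cY-ay)*hσ
  · field_simp; rw [hLA2, hσ]; ring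
  · field_simp; ring
  · have : -σ * (cY - bY) / LA * bx + σ * (cx - bx) / LA * bY = -(σ*((cx-bx)*(0-bY)-(cY-bY)*(0-bx))/LA) := by
      field_simp; ring
    rw [this]
    have := div_pos hTp hLA
    linarith
  · exact hBC
  · rintro ⟨h1, h2⟩
    rw [div_eq_div_iff hLC.ne' hLA.ne'] at h1 h2
    have k1 : (bY-ay)*LA = (cY-bY)*LC := by
      apply mul_left_cancel₀ hσ0; linear_combination -h1
    have k2 : (bx-ax)*LA = (cx-bx)*LC := by
      apply mul_left_cancel₀ hσ0; linear_combination h2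
    apply hS
    apply mul_left_cancel₀ hLC.ne'
    linear_combination (bY-ay)*k2-(bx-ax)*k1
  · rintro ⟨h1, h2⟩
    rw [div_eq_div_iff hLB.ne' hLA.ne'] at h1 h2
    have k1 : (ay-cY)*LA = (cY-bY)*LB := by
      apply mul_left_cancel₀ hσ0; linear_combination -h1
    have k2 : (ax-cx)*LA = (cx-bx)*LB := by
      apply mul_left_cancel₀ hσ0; linear_combination h2
    apply hS
    apply mul_left_cancel₀ hLB.ne'
    linear_combination (ax-cx)*k1-(ay-cY)*k2
  · have a1 : -σ*(bY-ay)/LC*(ix-bx) + σ*(bx-ax)/LC*(iy-bY) = r := by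
      field_simp; linear_combination σ*hIab + r*LC*hσ
    have a2 : -σ*(cY-bY)/LA*(ix-bx) + σ*(cx-bx)/LA*(iy-bY) = r := by
      field_simp; linear_combination σ*hIbc + r*LA*hσ
    linear_combination a1 - a2
  · have a1 : -σ*(ay-cY)/LB*(ix-cx) + σ*(ax-cx)/LB*(iy-cY) = r := by
      field_simp; linear_combination σ*hIca + r*LB*hσ
    have a2 : -σ*(cY-bY)/LA*(ix-cx) + σ*(cx-bx)/LA*(iy-cY) = r := by
      field_simp; linear_combination σ*hIbc + r*LA*hσ
    linear_combination a1 - a2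


noncomputable def crP (P Q X : Plane) : ℝ := (Q 0 - P 0)*(X 1 - P 1)-(Q 1 - P 1)*(X 0 - P 0)

lemma dist_sqP (X Y : Plane) : dist X Y ^2 = (X 0 - Y 0)^2+(X 1 - Y 1)^2 := by
  rw [EuclideanSpace.dist_eq, Real.sq_sqrt (by positivity)]
  simp [Fin.sum_univ_two, Real.dist_eq, sq_abs]

lemma lineP {P Q X : Plane} (h : X ∈ affineSpan ℝ ({P, Q} : Set Plane)) :
    ∃ t : ℝ, X 0 = P 0 + t*(Q 0 - P 0) ∧ X 1 = P 1 + t*(Q 1 - P 1) := by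
  obtain ⟨t, rfl⟩ := mem_affineSpan_pair_iff_exists_lineMap_eq.mp h
  refine ⟨t, ?_, ?_⟩ <;> simp [AffineMap.lineMap_apply] <;> ring

lemma hullP {A B C X : Plane} (P Q : Plane) (σ : ℝ) (hX : X ∈ convexHull ℝ ({A, B, C} : Set Plane))
    (hA : 0 ≤ σ * crP P Q A) (hB : 0 ≤ σ * crP P Q B) (hC : 0 ≤ σ * crP P Q C) :
    0 ≤ σ * crP P Q X := by
  have hconv : Convex ℝ {X : Plane | 0 ≤ σ * crP P Q X} := by
    intro x hx y hy a b ha hb hab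
    simp only [Set.mem_ofPred_eq] at *
    have : σ * crP P Q (a • x + b • y) = a * (σ * crP P Q x) + b * (σ * crP P Q y) := by
      have hb' : b = 1 - a := by linarith
      subst hb'
      simp [crP]; ring
    rw [this]; positivity
  have : convexHull ℝ ({A, B, C} : Set Plane) ⊆ {X : Plane | 0 ≤ σ * crP P Q X} := by
    apply convexHull_min _ hconv
    rintro x (rfl | rfl | rfl) <;> assumption
  exact this hX

lemma infDistP {P Q X : Plane} {d : ℝ} (hPQ : 0 < dist P Q)
    (h : Metric.infDist X (affineSpan ℝ ({P, Q} : Set Plane) : Set Plane) = d) :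
    |crP P Q X| = d * dist P Q := by
  have hL := dist_sqP P Q
  set L := dist P Q
  have hl : |crP P Q X| / L ≤ d := by
    rw [← h, Metric.le_infDist ⟨P, left_mem_affineSpan_pair ℝ P Q⟩]
    intro Y hY
    obtain ⟨t, h0, h1⟩ := lineP hY
    rw [div_le_iff₀ hPQ]
    apply abs_le_of_sq_le_sq _ (by positivity)
    rw [mul_pow, dist_sqP, hL, crP, h0, h1]
    have e : ∀ x y a b : ℝ, (a*y-b*x)^2 ≤ ((x-t*a)^2+(y-t*b)^2)*(a^2+b^2) := by
      intro x y a b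
      nlinarith [sq_nonneg ((x-t*a)*a+(y-t*b)*b)]
    have := e (X 0 - P 0) (X 1 - P 1) (Q 0 - P 0) (Q 1 - P 1)
    linarith
  have hu : d ≤ |crP P Q X| / L := by
    rw [← h]
    set t : ℝ := ((X 0 - P 0)*(Q 0 - P 0)+(X 1 - P 1)*(Q 1 - P 1))/L^2 with ht
    refine (Metric.infDist_le_dist_of_mem (y := AffineMap.lineMap P Q t)
      (AffineMap.lineMap_mem_affineSpan_pair t P Q)).trans ?_
    rw [le_div_iff₀ hPQ]
    apply le_of_sq_le_sq _ (abs_nonneg _)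
    have htL : t * L^2 = (X 0 - P 0)*(Q 0 - P 0)+(X 1 - P 1)*(Q 1 - P 1) := by
      rw [ht]; field_simp
    have e0 : (AffineMap.lineMap P Q t : Plane) 0 = P 0 + t*(Q 0 - P 0) := by
      simp [AffineMap.lineMap_apply]; ring
    have e1 : (AffineMap.lineMap P Q t : Plane) 1 = P 1 + t*(Q 1 - P 1) := by
      simp [AffineMap.lineMap_apply]; ring
    rw [mul_pow, sq_abs, dist_sqP, e0, e1, crP]
    rw [hL] at htL ⊢
    apply le_of_eq
    have e : ∀ x y a b : ℝ, t*(a^2+b^2) = x*a+y*b → ((x-t*a)^2+(y-t*b)^2)*(a^2+b^2) = (a*y-b*x)^2 := by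
      intro x y a b h
      linear_combination (t*(a^2+b^2) - (x*a+y*b))*h
    have := e (X 0 - P 0) (X 1 - P 1) (Q 0 - P 0) (Q 1 - P 1) (by linarith)
    linear_combination this
  have : |crP P Q X| / L = d := le_antisymm hl hu
  rw [← this]; field_simp

lemma crP_ne {A B C : Plane} (h : AffineIndependent ℝ ![A, B, C]) : crP A B C ≠ 0 := by
  intro h0
  rw [affineIndependent_iff_not_collinear_set] at h
  apply h
  by_cases hAB : A = B
  · subst hAB
    simpa using collinear_pair ℝ A C
  · have hp : 0 < dist A B ^2 := by
      have := dist_pos.mpr hAB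
      positivity
    have hL := dist_sqP A B
    set t : ℝ := ((C 0 - A 0)*(B 0 - A 0)+(C 1 - A 1)*(B 1 - A 1))/dist A B^2 with ht
    have htL : t * dist A B^2 = (C 0 - A 0)*(B 0 - A 0)+(C 1 - A 1)*(B 1 - A 1) := by
      rw [ht]; exact div_mul_cancel₀ _ hp.ne'
    have hC : C ∈ affineSpan ℝ ({A, B} : Set Plane) := by
      rw [mem_affineSpan_pair_iff_exists_lineMap_eq]
      refine ⟨t, ?_⟩
      rw [crP] at h0
      rw [hL] at htL hp
      have e0 : (AffineMap.lineMap A B t : Plane) 0 = A 0 + t*(B 0 - A 0) := by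
        simp [AffineMap.lineMap_apply]; ring
      have e1 : (AffineMap.lineMap A B t : Plane) 1 = A 1 + t*(B 1 - A 1) := by
        simp [AffineMap.lineMap_apply]; ring
      ext i
      fin_cases i
      · show (AffineMap.lineMap A B t : Plane) 0 = C 0
        rw [e0]
        apply mul_left_cancel₀ hp.ne'
        linear_combination (B 0 - A 0)*htL + (B 1 - A 1)*h0
      · show (AffineMap.lineMap A B t : Plane) 1 = C 1
        rw [e1]
        apply mul_left_cancel₀ hp.ne'
        linear_combination (B 1 - A 1)*htL - (B 0 - A 0)*h0
    have := collinear_insert_of_mem_affineSpan_pair hC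
    have e : ({C, A, B} : Set Plane) = {A, B, C} := by
      ext x; simp; tauto
    rwa [e] at this


lemma int_ne {A B C : Plane} {σ : ℝ} (hσ : 0 < σ * crP A B C) {T : Plane}
    (hT : T ∈ interior (convexHull ℝ ({A, B, C} : Set Plane))) : T ≠ B := by
  rintro rfl
  have h1 : Filter.Tendsto (fun δ : ℝ => T + δ • (T - A)) (nhdsWithin 0 (Set.Ioi 0)) (nhds T) := by
    have : Continuous (fun δ : ℝ => T + δ • (T - A)) := by fun_prop
    have h := this.tendsto 0
    simp only [zero_smul, add_zero] at h
    exact h.mono_left nhdsWithin_le_nhds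
  have h2 := h1.eventually (mem_interior_iff_mem_nhds.mp hT)
  obtain ⟨δ, hδ, hδ0⟩ := (h2.and self_mem_nhdsWithin).exists
  have hδ0 : 0 < δ := hδ0
  have := hullP T C σ hδ (by have : crP T C A = crP A T C := by (simp [crP]; ring)
                             rw [this]; exact hσ.le)
    (by simp [crP]) (by apply le_of_eq; simp only [crP]; ring)
  have e : crP T C (T + δ • (T - A)) = -δ * crP A T C := by simp [crP]; ring
  rw [e] at this
  nlinarith

set_option maxHeartbeats 2000000 in
theorem touch_ratio_eq_bisector_ratio
    (A B C I Oω D T : Plane) (r Rω ρ : ℝ)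
    (hABC : AffineIndependent ℝ ![A, B, C])
    (hr : 0 < r)
    (hIin : I ∈ interior (convexHull ℝ ({A, B, C} : Set Plane)))
    (hIab : Metric.infDist I (affineSpan ℝ ({A, B} : Set Plane) : Set Plane) = r)
    (hIbc : Metric.infDist I (affineSpan ℝ ({B, C} : Set Plane) : Set Plane) = r)
    (hIca : Metric.infDist I (affineSpan ℝ ({C, A} : Set Plane) : Set Plane) = r)
    (hRω : 0 < Rω) (hρ : 0 < ρ)
    (hBω : dist B Oω = Rω) (hCω : dist C Oω = Rω)
    (hγin : Metric.sphere D ρ ⊆ convexHull ℝ ({A, B, C} : Set Plane))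
    (hγAB : Metric.infDist D (affineSpan ℝ ({A, B} : Set Plane) : Set Plane) = ρ)
    (hγAC : Metric.infDist D (affineSpan ℝ ({A, C} : Set Plane) : Set Plane) = ρ)
    (hext : dist Oω D = Rω + ρ)
    (hTω : dist T Oω = Rω) (hTγ : dist T D = ρ)
    (hTseg : Wbtw ℝ Oω T D)
    (hTin : T ∈ interior (convexHull ℝ ({A, B, C} : Set Plane)))
    (F E Z : Plane)
    (hF : F ∈ affineSpan ℝ ({A, B} : Set Plane)) (hFγ : dist D F = ρ)
    (hE : E ∈ affineSpan ℝ ({A, C} : Set Plane)) (hEγ : dist D E = ρ)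
    (hZ₁ : Z ∈ affineSpan ℝ ({T, I} : Set Plane))
    (hZ₂ : Z ∈ affineSpan ℝ ({B, C} : Set Plane)) :
    dist B F * dist C Z = dist C E * dist B Z := by
  have hS := crP_ne hABC
  obtain ⟨σ, hσ2, hσ⟩ : ∃ σ : ℝ, σ^2 = 1 ∧ 0 < σ * crP A B C := by
    rcases lt_or_gt_of_ne hS with h | h
    · exact ⟨-1, by norm_num, by linarith⟩
    · exact ⟨1, by norm_num, by linarith⟩
  have hBCA : crP B C A = crP A B C := by simp only [crP]; ring
  have hCAB : crP C A B = crP A B C := by simp only [crP]; ring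
  have z1 : ∀ P Q : Plane, crP P Q P = 0 := by intro P Q; simp only [crP]; ring
  have z2 : ∀ P Q : Plane, crP P Q Q = 0 := by intro P Q; simp only [crP]; ring
  have HAB : ∀ X ∈ convexHull ℝ ({A, B, C} : Set Plane), 0 ≤ σ * crP A B X := fun X hX =>
    hullP A B σ hX (by simp [z1]) (by simp [z2]) hσ.le
  have HBC : ∀ X ∈ convexHull ℝ ({A, B, C} : Set Plane), 0 ≤ σ * crP B C X := fun X hX =>
    hullP B C σ hX (by rw [hBCA]; exact hσ.le) (by simp [z1]) (by simp [z2])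
  have HCA : ∀ X ∈ convexHull ℝ ({A, B, C} : Set Plane), 0 ≤ σ * crP C A X := fun X hX =>
    hullP C A σ hX (by simp [z2]) (by rw [hCAB]; exact hσ.le) (by simp [z1])
  have hLC : 0 < dist A B := by
    rw [dist_pos]; rintro rfl; apply hS; simp only [crP]; ring
  have hLA : 0 < dist B C := by
    rw [dist_pos]; rintro rfl; apply hS; simp only [crP]; ring
  have hLB : 0 < dist C A := by
    rw [dist_pos]; rintro rfl; apply hS; simp only [crP]; ring
  have sgn : ∀ x d : ℝ, |x| = d → 0 ≤ σ * x → x = σ * d := by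
    intro x d h h'
    have e : |x| = σ * x := by
      rw [← abs_of_nonneg h', abs_mul]
      have : |σ| = 1 := by rwa [← sq_eq_sq₀ (abs_nonneg _) zero_le_one, sq_abs, one_pow]
      rw [this, one_mul]
    rw [← h, e]; linear_combination -x*hσ2
  have hDin : D ∈ convexHull ℝ ({A, B, C} : Set Plane) := by
    have h1 : convexHull ℝ (Metric.sphere D ρ) ⊆ convexHull ℝ ({A, B, C} : Set Plane) :=
      convexHull_min hγin (convex_convexHull ℝ _)
    rw [convexHull_sphere_eq_closedBall D hρ.le] at h1
    exact h1 (Metric.mem_closedBall_self hρ.le)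
  have hIin' := interior_subset hIin
  have hTin' := interior_subset hTin
  have jAB := sgn _ _ (infDistP hLC hIab) (HAB _ hIin')
  have jBC := sgn _ _ (infDistP hLA hIbc) (HBC _ hIin')
  have jCA := sgn _ _ (infDistP hLB hIca) (HCA _ hIin')
  have kAB := sgn _ _ (infDistP hLC hγAB) (HAB _ hDin)
  rw [Set.pair_comm A C] at hγAC
  have kCA := sgn _ _ (infDistP hLB hγAC) (HCA _ hDin)
  have kT := HBC _ hTin'
  have hTB : T ≠ B := int_ne hσ hTin
  have hTC : T ≠ C := by
    have e : ({A, B, C} : Set Plane) = {A, C, B} := by rw [Set.pair_comm B C]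
    rw [e] at hTin
    refine int_ne (σ := -σ) ?_ hTin
    have : crP A C B = - crP A B C := by simp only [crP]; ring
    rw [this]; linarith
  have hlb : 0 < dist B T := dist_pos.mpr hTB.symm
  have hlc : 0 < dist C T := dist_pos.mpr hTC.symm
  obtain ⟨s, hF0, hF1⟩ := lineP hF
  obtain ⟨s', hE0, hE1⟩ := lineP hE
  obtain ⟨m, hm0, hm1⟩ := lineP hZ₁
  obtain ⟨t, ht0, ht1⟩ := lineP hZ₂
  have hs : s ≤ 1 := by
    have h1 := HBC F (hγin (by rw [Metric.mem_sphere, dist_comm]; exact hFγ))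
    have h2 : crP B C F = (1-s) * crP A B C := by simp only [crP]; rw [hF0, hF1]; ring
    rw [h2] at h1
    by_contra h
    nlinarith
  have hs' : s' ≤ 1 := by
    have h1 := HBC E (hγin (by rw [Metric.mem_sphere, dist_comm]; exact hEγ))
    have h2 : crP B C E = (1-s') * crP A B C := by simp only [crP]; rw [hE0, hE1]; ring
    rw [h2] at h1
    by_contra h
    nlinarith
  -- direction
  obtain ⟨w, ⟨hw0, hw1⟩, hw⟩ := hTseg
  have hT0 : T 0 = Oω 0 + w*(D 0 - Oω 0) := by
    rw [← hw]; simp [AffineMap.lineMap_apply]; ring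
  have hT1 : T 1 = Oω 1 + w*(D 1 - Oω 1) := by
    rw [← hw]; simp [AffineMap.lineMap_apply]; ring
  have qT := dist_sqP T Oω
  have qD := dist_sqP Oω D
  rw [hTω] at qT
  rw [hext] at qD
  have hwR : w*(Rω+ρ) = Rω := by
    have h1 : (w*(Rω+ρ))^2 = Rω^2 := by
      rw [mul_pow, qD, qT, hT0, hT1]; ring
    exact (pow_left_inj₀ (by positivity) hRω.le two_ne_zero).mp h1
  obtain ⟨nx, hnx⟩ : ∃ nx, nx = (Oω 0 - T 0)/Rω := ⟨_, rfl⟩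
  obtain ⟨ny, hny⟩ : ∃ ny, ny = (Oω 1 - T 1)/Rω := ⟨_, rfl⟩
  have hO0 : Oω 0 = T 0 + Rω*nx := by rw [hnx]; field_simp; ring
  have hO1 : Oω 1 = T 1 + Rω*ny := by rw [hny]; field_simp; ring
  have hn : nx^2+ny^2=1 := by
    apply mul_left_cancel₀ (pow_pos hRω 2).ne'
    rw [hO0, hO1] at qT
    linear_combination -qT
  have hD0 : D 0 = T 0 + -ρ*nx := by
    have : Rω * (D 0 - T 0) = Rω * (-ρ*nx) := by
      linear_combination (-(Rω+ρ))*hT0 - (D 0 - Oω 0)*hwR - ρ*hO0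
    have := mul_left_cancel₀ hRω.ne' this
    linarith
  have hD1 : D 1 = T 1 + -ρ*ny := by
    have : Rω * (D 1 - T 1) = Rω * (-ρ*ny) := by
      linear_combination (-(Rω+ρ))*hT1 - (D 1 - Oω 1)*hwR - ρ*hO1
    have := mul_left_cancel₀ hRω.ne' this
    linarith
  have qB := dist_sqP B Oω
  have qC := dist_sqP C Oω
  rw [hBω, hO0, hO1] at qB
  rw [hCω, hO0, hO1] at qC
  have pB := dist_sqP B T
  have pC := dist_sqP C T
  have qF := dist_sqP D F
  have qE := dist_sqP D E
  rw [hFγ, hF0, hF1, hD0, hD1] at qF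
  rw [hEγ, hE0, hE1, hD0, hD1] at qE
  simp only [crP] at jAB jBC jCA kAB kCA kT hS
  rw [hD0, hD1] at kAB kCA
  obtain ⟨m1, m2, m3⟩ := main3 (A 0 - T 0) (A 1 - T 1) (B 0 - T 0) (B 1 - T 1) (C 0 - T 0) (C 1 - T 1)
    (I 0 - T 0) (I 1 - T 1) nx ny (dist B C) (dist C A) (dist A B) (dist B T) (dist C T) Rω ρ r s s' σ
    hn hσ2 hLA hLB hLC hlb hlc hRω hρ
    (by rw [dist_sqP]; ring) (by rw [dist_sqP]; ring) (by rw [dist_sqP]; ring)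
    (by intro h; apply hS; linear_combination h)
    (by linear_combination jAB) (by linear_combination jBC) (by linear_combination jCA)
    (by linear_combination kAB) (by linear_combination kCA)
    (by convert kT using 2; ring)
    pB (by linear_combination pB - qB - Rω^2*hn) pC (by linear_combination pC - qC - Rω^2*hn)
    hs hs' (by linear_combination -qF) (by linear_combination -qE)
  set lb := dist B T
  set lc := dist C T
  have hBF : dist B F = (1-s) * dist A B := by
    have h := dist_sqP B F
    refine (pow_left_inj₀ dist_nonneg (mul_nonneg (by linarith) dist_nonneg) two_ne_zero).mp ?_
    rw [h, mul_pow, dist_sqP, hF0, hF1]; ring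
  have hCE : dist C E = (1-s') * dist C A := by
    have h := dist_sqP C E
    refine (pow_left_inj₀ dist_nonneg (mul_nonneg (by linarith) dist_nonneg) two_ne_zero).mp ?_
    rw [h, mul_pow, dist_sqP, hE0, hE1]; ring
  have hBZ : dist B Z = |t| * dist B C := by
    have h := dist_sqP B Z
    refine (pow_left_inj₀ dist_nonneg (by positivity) two_ne_zero).mp ?_
    rw [h, mul_pow, sq_abs, dist_sqP, ht0, ht1]; ring
  have hCZ : dist C Z = |1-t| * dist B C := by
    have h := dist_sqP C Z
    refine (pow_left_inj₀ dist_nonneg (by positivity) two_ne_zero).mp ?_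
    rw [h, mul_pow, sq_abs, dist_sqP, ht0, ht1]; ring
  have hrat : (1-t)*lb = t*lc := by
    apply mul_left_cancel₀ m2
    have y0 : B 0 + t*(C 0 - B 0) - T 0 = m*(I 0 - T 0) := by linarith
    have y1 : B 1 + t*(C 1 - B 1) - T 1 = m*(I 1 - T 1) := by linarith
    linear_combination (-m)*m3 + (lc*(B 1 - T 1)+lb*(C 1 - T 1))*y0 - (lc*(B 0 - T 0)+lb*(C 0 - T 0))*y1
  have habs : |1-t| * lb = |t| * lc := by
    rw [← abs_of_pos hlb, ← abs_of_pos hlc, ← abs_mul, ← abs_mul, hrat]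
  rw [hBF, hCE, hBZ, hCZ]
  apply mul_left_cancel₀ hlb.ne'
  linear_combination (1-s)*dist A B*dist B C*habs + |t| * dist B C*m1
end

section
/- The Catalytic Lemma: The four points E, T, I and C lie on a common circle (they are concyclic). -/
open EuclideanGeometry Real RealInnerProductSpace Affine

lemma cl_aux (y r p a2 : ℝ) (hr : 0 < r) (ha2 : 0 < a2) (h1 : 0 ≤ y*a2 - p*r)
    (h : (y*a2-p*r)^2 = r^2*(p^2+a2^2)) : 0 < y ∧ a2*(y^2-r^2) = 2*p*r*y := by
  have h2 : a2*(y^2-r^2) = 2*p*r*y := by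
    have : a2 * (a2*(y^2-r^2) - 2*p*r*y) = 0 := by linear_combination h
    rcases mul_eq_zero.1 this with h | h <;> linarith
  refine ⟨?_, h2⟩
  have h3 : (r*p)^2 < (y*a2-p*r)^2 := by
    rw [h]; have : 0 < r^2*a2^2 := by positivity
    nlinarith
  have h4 := abs_lt_of_sq_lt_sq' h3 h1
  have : 0 < y * a2 := by linarith [h4.1]
  exact pos_of_mul_pos_left this ha2.le

lemma cl_sq (f s ρ L : ℝ) (hf : 0 ≤ f) (hs : 0 ≤ s) (hρ : 0 < ρ) (r : ℝ) (hr : 0 < r)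
    (h1 : f^2 = ρ^2*L) (h2 : s^2 = r^2*L) : r*f = ρ*s := by
  have : (r*f)^2 = (ρ*s)^2 := by
    rw [mul_pow, mul_pow, h1, h2]; ring
  exact (pow_left_inj₀ (by positivity) (by positivity) two_ne_zero).1 this

lemma cl_final (y z r e : ℝ) (hy : 0 < y) (hz : 0 < z) (hr : 0 < r) (he : 0 < e)
    (ρ d1 d2 m t R T1 T2 E1 E2 : ℝ) (hRρ : 0 < R + ρ)
    (hρ : ρ = r - e*(y*z-r^2)/(r*(y+z))) (hd1 : d1 = (y-z)*e/(y+z))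
    (hd2 : d2 = r + e*(y*z+r^2)/(r*(y+z))) (hm : m = (z-y)/2)
    (ht : t = (y+z)*(e^2-r^2)/(4*r*e)) (hR : R = (y+z)*(e^2+r^2)/(4*r*e))
    (hT1 : (R+ρ)*T1 = ρ*m+R*d1) (hT2 : (R+ρ)*T2 = ρ*t+R*d2)
    (hext : (m-d1)^2+(t-d2)^2=(R+ρ)^2)
    (hE1 : E1 = z - (z+e)*(z^2-r^2)/(z^2+r^2)) (hE2 : E2 = (z+e)*(2*z*r)/(z^2+r^2)) :
    ∃ c1 c2 k, (E1-c1)^2+(E2-c2)^2=k ∧ (T1-c1)^2+(T2-c2)^2=k ∧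
      (0-c1)^2+(r-c2)^2=k ∧ (z-c1)^2+(0-c2)^2=k := by
  obtain ⟨c1, hc1⟩ : ∃ c1, c1 = z - (z+e)/2*((z^2-r^2)/(z^2+r^2))
    - (r^2-z*e)/(2*r)*(2*z*r/(z^2+r^2)) := ⟨_, rfl⟩
  obtain ⟨c2, hc2⟩ : ∃ c2, c2 = (z+e)/2*(2*z*r/(z^2+r^2))
    - (r^2-z*e)/(2*r)*((z^2-r^2)/(z^2+r^2)) := ⟨_, rfl⟩
  refine ⟨c1, c2, (z-c1)^2+(0-c2)^2, ?_, ?_, ?_, rfl⟩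
  · rw [hE1, hE2, hc1, hc2]; field_simp; ring
  · have key : R*((d1-c1)^2+(d2-c2)^2-((z-c1)^2+(0-c2)^2))
      + ρ*((m-c1)^2+(t-c2)^2-((z-c1)^2+(0-c2)^2)) = R*ρ*(R+ρ) := by
      rw [hR, hρ, hd1, hd2, hm, ht, hc1, hc2]; field_simp; ring
    have h1 : T1 = (ρ*m+R*d1)/(R+ρ) := by field_simp; linarith
    have h2 : T2 = (ρ*t+R*d2)/(R+ρ) := by field_simp; linarith
    have : (R+ρ) * ((T1-c1)^2+(T2-c2)^2 - ((z-c1)^2+(0-c2)^2)) = 0 := by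
      have e1 : (R+ρ)*((T1-c1)^2+(T2-c2)^2) = R*((d1-c1)^2+(d2-c2)^2)
        + ρ*((m-c1)^2+(t-c2)^2) - R*ρ*(R+ρ) := by
        have : R*ρ*(R+ρ) = R*ρ*((m-d1)^2+(t-d2)^2)/(R+ρ) := by rw [hext]; field_simp
        rw [this, h1, h2]; field_simp; ring
      linear_combination e1 + key
    rcases mul_eq_zero.1 this with h | h <;> linarith
  · rw [hc1, hc2]; field_simp; ring

set_option maxHeartbeats 2000000 in
lemma cl_core (y z r a1 a2 ρ d1 d2 t R T1 T2 E1 E2 m τ : ℝ)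
 (hS : 0<y+z) (ha2 : 0 < a2) (hr : 0 < r) (hρ : 0 < ρ) (hR : 0 < R)
 (hI1 : 0 ≤ y*a2 - (a1+y)*r) (hI2 : 0 ≤ z*a2-(z-a1)*r)
 (hIab : (y*a2-(a1+y)*r)^2 = r^2*((a1+y)^2+a2^2))
 (hIca : (z*a2-(z-a1)*r)^2 = r^2*((z-a1)^2+a2^2))
 (hD0 : ρ ≤ d2) (hD1 : 0 ≤ a2*(d1+y)-(a1+y)*d2) (hD2 : 0 ≤ a2*(z-d1)-(z-a1)*d2)
 (hDab : (a2*(d1+y)-(a1+y)*d2)^2=ρ^2*((a1+y)^2+a2^2))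
 (hDac : (a2*(z-d1)-(z-a1)*d2)^2=ρ^2*((z-a1)^2+a2^2))
 (hBω : (-y-m)^2+t^2=R^2) (hCω : (z-m)^2+t^2=R^2)
 (hext : (m-d1)^2+(t-d2)^2=(R+ρ)^2)
 (hT1 : (R+ρ)*T1=ρ*m+R*d1) (hT2 : (R+ρ)*T2=ρ*t+R*d2)
 (hE1 : E1 = z+τ*(a1-z)) (hE2 : E2=τ*a2) (hE : (d1-E1)^2+(d2-E2)^2=ρ^2) :
    ∃ c1 c2 k, (E1-c1)^2+(E2-c2)^2=k ∧ (T1-c1)^2+(T2-c2)^2=k ∧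
      (0-c1)^2+(r-c2)^2=k ∧ (z-c1)^2+(0-c2)^2=k := by
  obtain ⟨hy, hp⟩ := cl_aux y r (a1+y) a2 hr ha2 hI1 hIab
  obtain ⟨hz, hq⟩ := cl_aux z r (z-a1) a2 hr ha2 hI2 hIca
  have hA : a2*(y*z-r^2) = 2*r*y*z := by
    have : (y+z)*(a2*(y*z-r^2) - 2*r*y*z) = 0 := by linear_combination z*hp+y*hq
    rcases mul_eq_zero.1 this with h | h <;> linarith
  have hyz : 0 < y*z-r^2 := by
    have : 0 < a2*(y*z-r^2) := by rw [hA]; positivity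
    exact pos_of_mul_pos_right this ha2.le
  have g1 := cl_sq _ _ ρ _ hD1 hI1 hρ r hr hDab hIab
  have g2 := cl_sq _ _ ρ _ hD2 hI2 hρ r hr hDac hIca
  have ha2e : a2 = 2*r*y*z/(y*z-r^2) := by field_simp; linarith
  obtain ⟨e, he⟩ : ∃ e, e = (r-ρ)*(r*(y+z))/(y*z-r^2) := ⟨_, rfl⟩
  have hρe : ρ = r - e*(y*z-r^2)/(r*(y+z)) := by rw [he]; field_simp; ring
  have g3 : r*(a2-d2) = ρ*(a2-r) := by
    have : (y+z)*(r*(a2-d2) - ρ*(a2-r)) = 0 := by linear_combination g1+g2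
    rcases mul_eq_zero.1 this with h | h <;> linarith
  have hd2 : d2 = r + e*(y*z+r^2)/(r*(y+z)) := by
    have : d2 = a2 - ρ*(a2-r)/r := by field_simp; linarith
    rw [this, he, ha2e]; field_simp; ring
  have ha1 : a1 = a2*(y^2-r^2)/(2*r*y) - y := by field_simp; linarith
  have hd1 : d1 = (y-z)*e/(y+z) := by
    have : d1 = (ρ*(y*a2-(a1+y)*r)/r + (a1+y)*d2)/a2 - y := by
      field_simp; linear_combination g1
    rw [this, ha1, hd2, hρe, ha2e]; field_simp; ring
  have he0 : 0 ≤ e := by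
    have h : 0 ≤ d2 - ρ := by linarith
    have h' : d2 - ρ = e * (2*y*z/(r*(y+z))) := by rw [hd2, hρe]; field_simp; ring
    rw [h'] at h
    exact nonneg_of_mul_nonneg_left h (by positivity)
  have hm : m = (z-y)/2 := by
    have : (y+z)*(m - (z-y)/2) = 0 := by linear_combination (hBω-hCω)/2
    rcases mul_eq_zero.1 this with h | h <;> linarith
  have hRt : (R+t)*(R-t) = (y+z)^2/4 := by rw [hm] at hCω; linear_combination -hCω
  have hRt2 : |t| < R := by
    apply abs_lt_of_sq_lt_sq _ hR.le
    have h6 : R^2 - t^2 = (y+z)^2/4 := by linear_combination hRt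
    have h7 := pow_pos hS 2
    linarith
  have hw : 0 < R + t := by linarith [neg_abs_le t]
  have hq1 : e^2+(y+z)*e-y*z - (R+t)*(d2+ρ)+(R-t)*(d2-ρ) = 0 := by
    have : d1^2+d2^2-ρ^2-(z-y)*d1-z*y = e^2+(y+z)*e-y*z := by
      rw [hd1, hd2, hρe]; field_simp; ring
    rw [← this]; rw [hm] at hext hCω; linear_combination hext - hCω
  have hw0 : R + t = (y+z)*e/(2*r) := by
    have hs : d2+ρ = 2*r*(y+z+e)/(y+z) := by rw [hd2, hρe]; field_simp; ring
    have hd : d2-ρ = 2*e*y*z/(r*(y+z)) := by rw [hd2, hρe]; field_simp; ring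
    have hprod : ((R+t) - (y+z)*e/(2*r)) * (2*r*(y+z+e)/(y+z)*(R+t) + y*z) = 0 := by
      have : (R+t)*(R-t)*(2*e*y*z/(r*(y+z))) = (y+z)*e*y*z/(2*r) := by
        rw [hRt]; field_simp; ring
      rw [hs, hd] at hq1
      have h5 : (y+z)*e/(2*r) * (2*r*(y+z+e)/(y+z)) = e*(y+z+e) := by field_simp
      linear_combination -(R+t)*hq1 + this - (R+t)*h5
    have : 0 < 2*r*(y+z+e)/(y+z)*(R+t) + y*z := by positivity
    rcases mul_eq_zero.1 hprod with h | h <;> linarith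
  have hepos : 0 < e := by
    rcases he0.eq_or_lt with h | h
    · rw [← h] at hw0; simp at hw0; linarith
    · exact h
  have hRt' : R - t = (y+z)*r/(2*e) := by
    rw [hw0] at hRt; field_simp; field_simp at hRt; linarith
  have ht : t = (y+z)*(e^2-r^2)/(4*r*e) := by
    have : t = ((R+t) - (R-t))/2 := by ring
    rw [this, hw0, hRt']; field_simp; ring
  have hR' : R = (y+z)*(e^2+r^2)/(4*r*e) := by
    have : R = ((R+t) + (R-t))/2 := by ring
    rw [this, hw0, hRt']; field_simp; ring
  have ha1z : a1 = z - a2*(z^2-r^2)/(2*r*z) := by field_simp; linarith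
  obtain ⟨σ, hσ⟩ : ∃ σ, σ = τ*a2/(2*z*r) := ⟨_, rfl⟩
  have e1 : E1 = z - σ*(z^2-r^2) := by rw [hE1, ha1z, hσ]; field_simp; ring
  have e2 : E2 = σ*(2*z*r) := by rw [hE2, hσ]; field_simp
  have hσ' : σ = (z+e)/(z^2+r^2) := by
    have : (σ*(z^2+r^2) - (z+e))^2 = 0 := by
      have : (d1-E1)^2+(d2-E2)^2 - ρ^2 = (σ*(z^2+r^2) - (z+e))^2 := by
        rw [e1, e2, hd1, hd2, hρe]; field_simp; ring
      rw [← this, hE]; ring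
    have := pow_eq_zero_iff two_ne_zero |>.1 this
    field_simp; linarith
  exact cl_final y z r e hy hz hr hepos ρ d1 d2 m t R T1 T2 E1 E2 (by linarith) hρe hd1 hd2 hm ht hR'
    hT1 hT2 hext (by rw [e1, hσ']; ring) (by rw [e2, hσ']; ring)

lemma cl_dist_sq (p q : Plane) : dist p q ^ 2 = (p 0 - q 0)^2 + (p 1 - q 1)^2 := by
  rw [EuclideanSpace.dist_eq, Real.sq_sqrt (by positivity)]
  simp [Fin.sum_univ_two, Real.dist_eq, sq_abs]

lemma cl_line (P Q : Plane) (s : ℝ) (i : Fin 2) :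
    (AffineMap.lineMap P Q s : Plane) i = P i + s * (Q i - P i) := by
  simp [AffineMap.lineMap_apply]; ring

lemma cl_cross (S P Q : Plane) (d : ℝ)
    (h : Metric.infDist S (affineSpan ℝ ({P, Q} : Set Plane) : Set Plane) = d) :
    ((Q 0 - P 0)*(S 1 - P 1) - (Q 1 - P 1)*(S 0 - P 0))^2
      = d^2*((Q 0 - P 0)^2+(Q 1 - P 1)^2) := by
  by_cases h0 : (Q 0 - P 0)^2+(Q 1 - P 1)^2 = 0
  · have h1 : Q 0 - P 0 = 0 := by nlinarith [sq_nonneg (Q 0 - P 0), sq_nonneg (Q 1 - P 1)]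
    have h2 : Q 1 - P 1 = 0 := by nlinarith [sq_nonneg (Q 0 - P 0), sq_nonneg (Q 1 - P 1)]
    rw [h1, h2]; ring
  obtain ⟨N, hN⟩ : ∃ N, N = (Q 0 - P 0)^2+(Q 1 - P 1)^2 := ⟨_, rfl⟩
  rw [← hN] at h0 ⊢
  have hNpos : 0 < N := lt_of_le_of_ne (by rw [hN]; positivity) (Ne.symm h0)
  obtain ⟨s, hs⟩ : ∃ s, s = ((Q 0 - P 0)*(S 0 - P 0) + (Q 1 - P 1)*(S 1 - P 1))/N := ⟨_, rfl⟩
  have hs' : s * N = (Q 0 - P 0)*(S 0 - P 0) + (Q 1 - P 1)*(S 1 - P 1) := by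
    rw [hs]; field_simp
  have hd : ∀ x : ℝ, dist S (AffineMap.lineMap P Q x) ^ 2
      = dist S (AffineMap.lineMap P Q s) ^ 2 + (x - s)^2 * N := by
    intro x
    simp only [cl_dist_sq, cl_line]
    linear_combination (2*x-2*s)*hs' + (s^2-x^2) * hN
  have hF : d = dist S (AffineMap.lineMap P Q s) := by
    rw [← h]
    apply le_antisymm
    · exact Metric.infDist_le_dist_of_mem (AffineMap.lineMap_mem_affineSpan_pair s P Q)
    · refine (Metric.le_infDist ⟨P, left_mem_affineSpan_pair ℝ P Q⟩).2 ?_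
      intro y hy
      obtain ⟨x, rfl⟩ := (mem_affineSpan_pair_iff_exists_lineMap_eq).1 hy
      refine (sq_le_sq₀ dist_nonneg dist_nonneg).1 ?_
      rw [hd x]
      have : 0 ≤ (x-s)^2*N := by positivity
      linarith
  rw [hF, cl_dist_sq, cl_line, cl_line]
  rw [hN] at hs' ⊢
  linear_combination ((Q 0 - P 0)*(S 0 - P 0) + (Q 1 - P 1)*(S 1 - P 1)
    - s * ((Q 0 - P 0)^2+(Q 1 - P 1)^2)) * hs'

lemma cl_hull (A B C : Plane) (a b k : ℝ) (hA : 0 ≤ a * A 0 + b * A 1 + k)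
    (hB : 0 ≤ a * B 0 + b * B 1 + k) (hC : 0 ≤ a * C 0 + b * C 1 + k) (p : Plane)
    (hp : p ∈ convexHull ℝ ({A, B, C} : Set Plane)) : 0 ≤ a * p 0 + b * p 1 + k := by
  have hc : Convex ℝ {p : Plane | 0 ≤ a * p 0 + b * p 1 + k} := by
    intro x hx y hy s t hs ht hst
    simp only [Set.mem_ofPred_eq] at hx hy
    simp only [Set.mem_ofPred_eq, PiLp.add_apply, PiLp.smul_apply, smul_eq_mul]
    have := add_nonneg (mul_nonneg hs hx) (mul_nonneg ht hy)
    have e : a * (s * x 0 + t * y 0) + b * (s * x 1 + t * y 1) + k =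
      s * (a * x 0 + b * x 1 + k) + t * (a * y 0 + b * y 1 + k) := by
      linear_combination -k*hst
    rw [e]; exact this
  refine convexHull_min ?_ hc hp
  rintro x (rfl | rfl | rfl) <;> assumption

lemma cl_nondeg (A B C : Plane) (h : AffineIndependent ℝ ![A, B, C]) :
    0 < dist B C ∧ (C 0 - B 0)*(A 1 - B 1) - (C 1 - B 1)*(A 0 - B 0) ≠ 0 := by
  have hBC : B ≠ C := by
    intro e
    have := h.injective.ne (show (1 : Fin 3) ≠ 2 by decide)
    simp at this; exact this e
  have hpos : 0 < dist B C := dist_pos.2 hBC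
  refine ⟨hpos, fun hc => ?_⟩
  rw [affineIndependent_iff_not_collinear_set] at h
  apply h
  have h2 := pow_pos hpos 2
  rw [cl_dist_sq] at h2
  rw [collinear_iff_of_mem (p₀ := B) (by simp)]
  refine ⟨C - B, ?_⟩
  obtain ⟨N, hN⟩ : ∃ N, N = (B 0 - C 0)^2+(B 1 - C 1)^2 := ⟨_, rfl⟩
  rw [← hN] at h2
  rintro p (rfl | rfl | rfl)
  · refine ⟨((C 0 - B 0)*(p 0 - B 0) + (C 1 - B 1)*(p 1 - B 1))/N, ?_⟩
    ext i
    fin_cases i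
    · simp; field_simp; rw [hN]; linear_combination -(C 1 - B 1) * hc
    · simp; field_simp; rw [hN]; linear_combination (C 0 - B 0) * hc
  · exact ⟨0, by simp⟩
  · exact ⟨1, by simp⟩

lemma cl_coords (A B C I : Plane) (h : AffineIndependent ℝ ![A, B, C]) :
    ∃ X Y : Plane → ℝ,
      (∀ p q, dist p q ^ 2 = (X p - X q)^2 + (Y p - Y q)^2) ∧
      (∀ (S P Q : Plane) (d : ℝ),
        Metric.infDist S (affineSpan ℝ ({P, Q} : Set Plane) : Set Plane) = d →
        ((X Q - X P)*(Y S - Y P) - (Y Q - Y P)*(X S - X P))^2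
          = d^2*((X Q - X P)^2+(Y Q - Y P)^2)) ∧
      (∀ a b k : ℝ, 0 ≤ a * X A + b * Y A + k → 0 ≤ a * X B + b * Y B + k →
        0 ≤ a * X C + b * Y C + k → ∀ p ∈ convexHull ℝ ({A, B, C} : Set Plane),
        0 ≤ a * X p + b * Y p + k) ∧
      (∀ (P Q : Plane) (s : ℝ), X (AffineMap.lineMap P Q s) = X P + s * (X Q - X P) ∧
        Y (AffineMap.lineMap P Q s) = Y P + s * (Y Q - Y P)) ∧
      (∀ a b, ∃ p, X p = a ∧ Y p = b) ∧
      0 < Y A ∧ Y B = 0 ∧ Y C = 0 ∧ X I = 0 ∧ X B < X C := by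
  obtain ⟨hS, hc⟩ := cl_nondeg A B C h
  obtain ⟨S, hSe⟩ : ∃ S, S = dist B C := ⟨_, rfl⟩
  have hS2 := cl_dist_sq B C
  rw [← hSe] at hS hS2
  obtain ⟨u0, hu0⟩ : ∃ u, u = (C 0 - B 0)/S := ⟨_, rfl⟩
  obtain ⟨u1, hu1⟩ : ∃ u, u = (C 1 - B 1)/S := ⟨_, rfl⟩
  have k0 : C 0 - B 0 = S * u0 := by rw [hu0]; field_simp
  have k1 : C 1 - B 1 = S * u1 := by rw [hu1]; field_simp
  have hu : u0^2+u1^2 = 1 := by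
    rw [hu0, hu1]; field_simp; linear_combination -hS2
  obtain ⟨ε, hε, hεA⟩ : ∃ ε : ℝ, ε^2 = 1 ∧ 0 < ε * (u0 * (A 1 - B 1) - u1*(A 0 - B 0)) := by
    have : u0 * (A 1 - B 1) - u1*(A 0 - B 0) ≠ 0 := by
      intro e; apply hc; rw [k0, k1]; linear_combination S * e
    rcases this.lt_or_gt with h | h
    · exact ⟨-1, by norm_num, by linarith⟩
    · exact ⟨1, by norm_num, by linarith⟩
  refine ⟨fun p => u0 * (p 0 - I 0) + u1 * (p 1 - I 1),
    fun p => ε * (u0 * (p 1 - B 1) - u1 * (p 0 - B 0)), ?_, ?_, ?_, ?_, ?_, hεA, ?_, ?_, ?_, ?_⟩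
  · intro p q
    rw [cl_dist_sq]
    linear_combination -((p 0 - q 0)^2 + (p 1 - q 1)^2) * hu
      - (u0 * (p 1 - q 1) - u1 * (p 0 - q 0))^2 * hε
  · intro T P Q d hd
    have := cl_cross T P Q d hd
    have e1 : ∀ p q : Plane, (u0 * (p 0 - I 0) + u1 * (p 1 - I 1) - (u0 * (q 0 - I 0) + u1 * (q 1 - I 1)))^2 + (ε * (u0 * (p 1 - B 1) - u1 * (p 0 - B 0)) - ε * (u0 * (q 1 - B 1) - u1 * (q 0 - B 0)))^2 = (p 0 - q 0)^2 + (p 1 - q 1)^2 := by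
      intro p q
      linear_combination ((p 0 - q 0)^2 + (p 1 - q 1)^2) * hu
        + (u0 * (p 1 - q 1) - u1 * (p 0 - q 0))^2 * hε
    rw [e1, ← this]
    obtain ⟨W, hW⟩ : ∃ W, W = (Q 0 - P 0)*(T 1 - P 1) - (Q 1 - P 1)*(T 0 - P 0) := ⟨_, rfl⟩
    have e2 : (u0 * (Q 0 - I 0) + u1 * (Q 1 - I 1) - (u0 * (P 0 - I 0) + u1 * (P 1 - I 1))) *
        (ε * (u0 * (T 1 - B 1) - u1 * (T 0 - B 0)) - ε * (u0 * (P 1 - B 1) - u1 * (P 0 - B 0))) -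
        (ε * (u0 * (Q 1 - B 1) - u1 * (Q 0 - B 0)) - ε * (u0 * (P 1 - B 1) - u1 * (P 0 - B 0))) *
        (u0 * (T 0 - I 0) + u1 * (T 1 - I 1) - (u0 * (P 0 - I 0) + u1 * (P 1 - I 1))) = ε * W := by
      rw [hW]
      linear_combination ε * ((Q 0 - P 0)*(T 1 - P 1) - (Q 1 - P 1)*(T 0 - P 0)) * hu
    rw [e2, ← hW, mul_pow, hε, one_mul]
  · intro a b k hA hB hC p hp
    have := cl_hull A B C (a*u0 - b*ε*u1) (a*u1+b*ε*u0)
      (k - a*(u0*I 0+u1*I 1) - b*ε*(u0*B 1 - u1*B 0)) (by linarith) (by linarith) (by linarith) p hp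
    linarith
  · intro P Q s
    simp only [cl_line]
    constructor <;> ring
  · intro a b
    refine ⟨!₂[I 0 + u0*(a - u0*(B 0 - I 0) - u1 *(B 1 - I 1)) - u1*(ε*b) + (u0 * (B 0 - I 0) + u1 * (B 1 - I 1))*u0 + (u0 * (B 1 - I 1) - u1 * (B 0 - I 0))*(-u1),
      I 1 + u1*(a - u0*(B 0 - I 0) - u1 *(B 1 - I 1)) + u0*(ε*b) + (u0 * (B 0 - I 0) + u1 * (B 1 - I 1))*u1 + (u0 * (B 1 - I 1) - u1 * (B 0 - I 0))*u0], ?_, ?_⟩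
    · simp; linear_combination a * hu
    · simp; linear_combination (b * ε^2 + ε * (u0 * (B 1 - I 1) - u1 * (B 0 - I 0)))*hu + b*hε
  · simp
  · simp only [k0, k1]; ring
  · simp
  · have : S * (u0^2+u1^2) = u0 * (C 0 - B 0) + u1 * (C 1 - B 1) := by rw [k0, k1]; ring
    rw [hu] at this
    simp only; linarith

/-- **The Catalytic Lemma.** In the Ajima-circle configuration, let `E` be the point
where `γ` touches line `AC`.  Then `E`, `T`, `I`, `C` are concyclic. -/
theorem catalytic_lemma
    (A B C I Oω D T : Plane) (r Rω ρ : ℝ)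
    (hABC : AffineIndependent ℝ ![A, B, C])
    (hr : 0 < r)
    (hIin : I ∈ interior (convexHull ℝ ({A, B, C} : Set Plane)))
    (hIab : Metric.infDist I (affineSpan ℝ ({A, B} : Set Plane) : Set Plane) = r)
    (hIbc : Metric.infDist I (affineSpan ℝ ({B, C} : Set Plane) : Set Plane) = r)
    (hIca : Metric.infDist I (affineSpan ℝ ({C, A} : Set Plane) : Set Plane) = r)
    (hRω : 0 < Rω) (hρ : 0 < ρ)
    (hBω : dist B Oω = Rω) (hCω : dist C Oω = Rω)
    (hγin : Metric.sphere D ρ ⊆ convexHull ℝ ({A, B, C} : Set Plane))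
    (hγAB : Metric.infDist D (affineSpan ℝ ({A, B} : Set Plane) : Set Plane) = ρ)
    (hγAC : Metric.infDist D (affineSpan ℝ ({A, C} : Set Plane) : Set Plane) = ρ)
    (hext : dist Oω D = Rω + ρ)
    (hTω : dist T Oω = Rω) (hTγ : dist T D = ρ)
    (hTseg : Wbtw ℝ Oω T D)
    (hTin : T ∈ interior (convexHull ℝ ({A, B, C} : Set Plane)))
    (E : Plane)
    (hE : E ∈ affineSpan ℝ ({A, C} : Set Plane)) (hEγ : dist D E = ρ) :
    EuclideanGeometry.Concyclic ({E, T, I, C} : Set Plane) := by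
  obtain ⟨X, Y, hdist, hcross, hhull, hline, hsurj, hYA, hYB, hYC, hXI, hBC⟩ :=
    cl_coords A B C I hABC
  have hab : ∀ p ∈ convexHull ℝ ({A, B, C} : Set Plane),
      0 ≤ Y A * (X p - X B) - (X A - X B) * Y p := by
    intro p hp
    have := hhull (Y A) (-(X A - X B)) (-(Y A * X B)) (by linarith) (by rw [hYB]; linarith)
      (by rw [hYC]; nlinarith) p hp
    linarith
  have hac : ∀ p ∈ convexHull ℝ ({A, B, C} : Set Plane),
      0 ≤ Y A * (X C - X p) - (X C - X A) * Y p := by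
    intro p hp
    have := hhull (-Y A) (-(X C - X A)) (Y A * X C) (by linarith) (by rw [hYB]; nlinarith)
      (by rw [hYC]; linarith) p hp
    linarith
  have hbc : ∀ p ∈ convexHull ℝ ({A, B, C} : Set Plane), 0 ≤ Y p := by
    intro p hp
    have := hhull 0 1 0 (by linarith) (by rw [hYB]; simp) (by rw [hYC]; simp) p hp
    linarith
  have hI := interior_subset hIin
  have hYI : Y I = r := by
    have h1 := hcross I B C r hIbc
    rw [hYB, hYC, hXI] at h1
    have h2 : (X C - X B)^2 * ((Y I)^2 - r^2) = 0 := by linear_combination h1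
    have h3 : (X C - X B)^2 ≠ 0 := pow_ne_zero 2 (by linarith)
    have h4 : (Y I)^2 = r^2 := by
      rcases mul_eq_zero.1 h2 with h | h
      · exact absurd h h3
      · linarith
    exact (pow_left_inj₀ (hbc I hI) hr.le two_ne_zero).1 h4
  have hsph : ∀ a b, (a - X D)^2 + (b - Y D)^2 = ρ^2 → ∃ p, X p = a ∧ Y p = b ∧
      p ∈ convexHull ℝ ({A, B, C} : Set Plane) := by
    intro a b h
    obtain ⟨p, h1, h2⟩ := hsurj a b
    refine ⟨p, h1, h2, hγin ?_⟩
    rw [Metric.mem_sphere]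
    apply (pow_left_inj₀ dist_nonneg hρ.le two_ne_zero).1
    rw [hdist, h1, h2, h]
  obtain ⟨p1, p1X, p1Y, hp1⟩ := hsph (X D + ρ) (Y D) (by ring)
  obtain ⟨p2, p2X, p2Y, hp2⟩ := hsph (X D - ρ) (Y D) (by ring)
  obtain ⟨p3, p3X, p3Y, hp3⟩ := hsph (X D) (Y D - ρ) (by ring)
  have hD0 := hbc p3 hp3
  rw [p3Y] at hD0
  have q1 := hab p1 hp1
  have q2 := hab p2 hp2
  have q3 := hac p1 hp1
  have q4 := hac p2 hp2
  rw [p1X, p1Y] at q1 q3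
  rw [p2X, p2Y] at q2 q4
  have i1 := hab I hI
  have i2 := hac I hI
  have c1 := hcross I A B r hIab
  have c2 := hcross I C A r hIca
  have c3 := hcross D A B ρ hγAB
  have c4 := hcross D A C ρ hγAC
  rw [hXI, hYI] at i1 i2 c1 c2
  rw [hYB] at c1 c3
  rw [hYC] at c2 c4
  have b1 := hdist B Oω
  have b2 := hdist C Oω
  have b3 := hdist Oω D
  rw [hBω, hYB] at b1
  rw [hCω, hYC] at b2
  rw [hext] at b3
  obtain ⟨s, ⟨hs0, -⟩, rfl⟩ := hTseg
  have hs : s * (Rω + ρ) = Rω := by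
    have h1 : dist (AffineMap.lineMap Oω D s) D = ‖1 - s‖ * dist Oω D :=
      dist_lineMap_right Oω D s
    have h2 : dist (AffineMap.lineMap Oω D s) Oω = ‖s‖ * dist Oω D :=
      dist_lineMap_left Oω D s
    rw [hTγ, hext] at h1
    rw [hTω, hext, Real.norm_eq_abs, abs_of_nonneg hs0] at h2
    linarith
  obtain ⟨τ, rfl⟩ := mem_affineSpan_pair_iff_exists_lineMap_eq.1 hE
  have e1 := hdist D (AffineMap.lineMap A C τ)
  rw [hEγ] at e1
  obtain ⟨t1, t2⟩ := hline Oω D s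
  obtain ⟨l1, l2⟩ := hline A C τ
  obtain ⟨x, y, k, k1, k2, k3, k4⟩ := cl_core (-X B) (X C) r (X A) (Y A) ρ (X D) (Y D) (Y Oω) Rω
    _ _ _ _ (X Oω) (1 - τ) (by linarith) hYA hr hρ hRω (by linarith) (by linarith)
    (by linear_combination c1) (by linear_combination c2) (by linarith) (by linarith) (by linarith)
    (by linear_combination c3) (by linear_combination c4) (by linear_combination -b1)
    (by linear_combination -b2) (by linear_combination -b3)
    (show _ * X (AffineMap.lineMap Oω D s) = _ by rw [t1]; linear_combination (X D - X Oω) * hs)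
    (show _ * Y (AffineMap.lineMap Oω D s) = _ by rw [t2]; linear_combination (Y D - Y Oω) * hs)
    (show X (AffineMap.lineMap A C τ) = _ by rw [l1]; ring)
    (show Y (AffineMap.lineMap A C τ) = _ by rw [l2, hYC]; ring)
    (by linear_combination -e1)
  obtain ⟨O, hO1, hO2⟩ := hsurj x y
  refine ⟨⟨O, Real.sqrt k, ?_⟩, coplanar_of_finrank_eq_two _ (by simp)⟩
  have fin : ∀ p, (X p - x)^2 + (Y p - y)^2 = k → dist p O = Real.sqrt k := by
    intro p h
    rw [← h, ← hO1, ← hO2, ← hdist, Real.sqrt_sq dist_nonneg]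
  rintro p (rfl | rfl | rfl | rfl)
  · exact fin _ k1
  · exact fin _ k2
  · exact fin _ (by rw [hXI, hYI]; exact k3)
  · exact fin _ (by rw [hYC]; exact k4)
end

section
/- We have ∠BTC = 2·∠IEC. -/
open EuclideanGeometry Real RealInnerProductSpace Affine

set_option maxHeartbeats 1000000 in
lemma core_alg (a b c p q r ρ ix dx dy ox oy R : ℝ) (ha : 0 < a) (hq : 0 < q)
    (hb : 0 < b) (hc : 0 < c) (hb2 : b^2 = (a-p)^2+q^2) (hc2 : c^2 = p^2+q^2)
    (hr : 0 < r) (hρ : 0 < ρ)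
    (hI1 : q*ix - p*r = r*c) (hI2 : q*(a-ix) - (a-p)*r = r*b)
    (hD1 : q*dx - p*dy = ρ*c) (hD2 : q*(a-dx) - (a-p)*dy = ρ*b) (hdy : ρ ≤ dy)
    (hR : 0 < R) (hO1 : ox^2+oy^2 = R^2) (hO2 : (a-ox)^2+oy^2 = R^2)
    (hOD : (ox-dx)^2+(oy-dy)^2 = (R+ρ)^2) :
    ∃ k u v w : ℝ, 0 < k ∧ k < 1 ∧ 0 < u ∧ 0 < v ∧ 0 < w ∧ a = v + w ∧ b = u + w ∧ c = u + v ∧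
      ix = v ∧ dx = p + k*(v-p) ∧ dy = q + k*(r-q) ∧ ρ = k * r ∧ a*p = v*a - u*(w-v) ∧
      p*v+q*r = v*(u+v) ∧
      ox = a/2 ∧ (R-oy)*(2*((1-k)*u)) = r*a := by
  have hcp : |p| < c := abs_lt_of_sq_lt_sq (by linarith [show 0 < q^2 by positivity]) hc.le
  have hbp : |a-p| < b := abs_lt_of_sq_lt_sq (by linarith [show 0 < q^2 by positivity]) hb.le
  obtain ⟨hcp1, hcp2⟩ := abs_lt.1 hcp
  obtain ⟨hbp1, hbp2⟩ := abs_lt.1 hbp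
  obtain ⟨u, hu⟩ : ∃ u, u = (b+c-a)/2 := ⟨_, rfl⟩
  obtain ⟨v, hv⟩ : ∃ v, v = (a+c-b)/2 := ⟨_, rfl⟩
  obtain ⟨w, hw⟩ : ∃ w, w = (a+b-c)/2 := ⟨_, rfl⟩
  obtain ⟨k, hk⟩ : ∃ k, k = ρ/r := ⟨_, rfl⟩
  have hkr : ρ = k*r := by rw [hk]; field_simp
  have hk0 : 0 < k := by rw [hk]; positivity
  have hav : a = v + w := by linarith
  have hbu : b = u + w := by linarith
  have hcu : c = u + v := by linarith
  have hup : 0 < u := by linarith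
  have hqa : a*q = r*(a+b+c) := by linarith
  have hap : a*p = v*a - u*(w-v) := by
    subst hu hv hw; linear_combination (hb2 - hc2)/2
  have hixv : ix = v := by
    have h : (a*q) * (ix - v) = 0 := by
      subst hv
      linear_combination a * hI1 - (a+c-b)/2 * hqa + r*(hc2-hb2)/(-2)
    rcases mul_eq_zero.1 h with h | h
    · exact absurd h (by positivity)
    · linarith
  subst hixv
  have hvp : 0 < ix := by
    have : 0 < q*ix := by
      have e : q*ix = r*(c+p) := by linarith
      rw [e]; exact mul_pos hr (by linarith)
    exact (pos_iff_pos_of_mul_pos this).1 hq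
  have hwp : 0 < w := by
    have : 0 < q*w := by
      have : q*w = q*(a-ix) := by rw [hav]; ring
      have e : q*(a-ix) = r*(b+(a-p)) := by linarith
      rw [this, e]; exact mul_pos hr (by linarith)
    exact (pos_iff_pos_of_mul_pos this).1 hq
  have hdy' : dy = q + k*(r-q) := by
    have h : a * (dy - (q + k*(r-q))) = 0 := by
      linear_combination (-1)*hD1 - hD2 + k*(hI1+hI2) - (b+c)*hkr
    rcases mul_eq_zero.1 h with h | h
    · exact absurd h (by positivity)
    · linarith
  have hdx' : dx = p + k*(ix-p) := by
    have h : q * (dx - (p + k*(ix-p))) = 0 := by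
      linear_combination hD1 - k*hI1 + p*hdy' + c*hkr
    rcases mul_eq_zero.1 h with h | h
    · exact absurd h (by positivity)
    · linarith
  have haq : a*q = 2*r*(u+ix+w) := by rw [hqa, hav, hbu, hcu]; ring
  have hS : 0 < u+ix+w := by positivity
  have hH : r^2*(u+ix+w) = u*ix*w := by
    have h : (4*(u+ix+w)) * (r^2*(u+ix+w) - u*ix*w) = 0 := by
      have h1 : (a*q)^2 = a^2*c^2 - (a*p)^2 := by rw [hc2]; ring
      rw [haq, hap, hcu, hav] at h1
      linear_combination h1
    rcases mul_eq_zero.1 h with h | h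
    · exact absurd h (by positivity)
    · linarith
  have hdot : p*ix+q*r = ix*(u+ix) := by
    have h : a * (p*ix+q*r - ix*(u+ix)) = 0 := by
      linear_combination ix*hap + r*haq + 2*hH + u*ix*(-1)*hav
    rcases mul_eq_zero.1 h with h | h
    · exact absurd h (by positivity)
    · linarith
  have hk1 : 0 ≤ 1-k := by
    have : 0 ≤ (1-k)*q := by rw [hdy', hkr] at hdy; linarith
    exact nonneg_of_mul_nonneg_left this hq
  have hox : ox = a/2 := by
    have h : a*(2*ox-a) = 0 := by linear_combination hO1-hO2
    rcases mul_eq_zero.1 h with h | h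
    · exact absurd h (by positivity)
    · linarith
  have hRo : oy^2 = R^2 - a^2/4 := by rw [hox] at hO1; linarith
  have hm : 0 < R - oy := by
    have : |oy| < R := abs_lt_of_sq_lt_sq (by linarith [show 0 < a^2 by positivity]) hR.le
    have := (abs_lt.1 this).2
    linarith
  have hK : (dx-a/2)^2+dy^2-a^2/4-ρ^2 = u*(1-k)*((1-k)*(u+ix+w)+a*k) - ix*w := by
    rw [hcu] at hc2
    rw [hdx', hdy', hkr]
    linear_combination (-(1-k)^2)*hc2 + 2*k*(1-k)*hdot - (1-k)*hap - (ix*1 + u*(1-k)*k )*hav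
  have hT : (dx-a/2)^2+dy^2-a^2/4-ρ^2 = 2*(dy*oy + R*ρ) := by
    rw [hox] at hOD
    linear_combination hOD - hRo
  have hquad : (dy-ρ)*(R-oy)^2 + ((dx-a/2)^2+dy^2-a^2/4-ρ^2)*(R-oy) - a^2/4*(dy+ρ) = 0 := by
    rw [hT]
    linear_combination (-dy-ρ)*hRo
  have hprod : ((R-oy)*(2*((1-k)*u)) - r*a) * (2*r*(u+ix+w)*(R-oy) + u*a*((1-k)*(u+ix+w)+a*k)) = 0 := by
    rw [hK, hdy', hkr] at hquad
    linear_combination 2*a*u*hquad - 2*u*(1-k)*(R-oy)^2*haq - 2*a*(R-oy)*hH + a^2*u*(1-k)/2*haq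
  have hfin : (R-oy)*(2*((1-k)*u)) = r*a := by
    rcases mul_eq_zero.1 hprod with h | h
    · linarith
    · exact absurd h (by positivity)
  have hk1' : k < 1 := by
    rcases hk1.eq_or_lt with h | h
    · rw [← h] at hfin
      have : 0 < r*a := by positivity
      linarith
    · linarith
  exact ⟨k, u, ix, w, hk0, hk1', hup, hvp, hwp, hav, hbu, hcu, rfl, hdx', hdy', hkr, hap, hdot, hox, hfin⟩

lemma core_E (a b p q r ρ k u v w dx dy ex ey t: ℝ) (hb : 0 < b)
    (hb2 : b^2 = (a-p)^2+q^2) (hc2 : (u+v)^2 = p^2+q^2)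
    (hav : a = v + w) (hbu : b = u + w) (hdx : dx = p + k*(v-p)) (hdy : dy = q + k*(r-q))
    (hp : a*p = v*a - u*(w-v)) (hdot : p*v+q*r = v*(u+v))
    (hD2 : q*(a-dx) - (a-p)*dy = ρ*b)
    (hex : ex = p + t*(a-p)) (hey : ey = q - t*q) (hE : (dx-ex)^2+(dy-ey)^2 = ρ^2) :
    (v-ex)*(a-ex) + (r-ey)*(0-ey) = ((1-k)*u) * (b-k*u) ∧
    (v-ex)^2+(r-ey)^2 = ((1-k)*u)^2 + r^2 ∧ (a-ex)^2+(0-ey)^2 = (b-k*u)^2 := by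
  have hδ : (a-p)*(dx-ex) - q*(dy-ey) = 0 := by
    have h : ((a-p)*(dx-ex) - q*(dy-ey))^2 = 0 := by
      have h1 : q*(dx-ex) + (a-p)*(dy-ey) = -(ρ*b) := by
        rw [← hD2, hex, hey]; ring
      have h2 : ((a-p)*(dx-ex) - q*(dy-ey))^2 + (q*(dx-ex) + (a-p)*(dy-ey))^2 = b^2*((dx-ex)^2+(dy-ey)^2) := by
        rw [hb2]; ring
      rw [h1, hE] at h2
      linarith
    exact pow_eq_zero_iff (two_ne_zero) |>.1 h
  have hIA : (a-p)*(v-p) - q*(r-q) = u*b := by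
    rw [hbu]
    linear_combination (-1)*hp - hdot - hc2
  have htb : t*b = k*u := by
    have h : b*(t*b - k*u) = 0 := by
      rw [hdx, hdy, hex, hey] at hδ
      linear_combination t*hb2 - hδ + k*hIA
    rcases mul_eq_zero.1 h with h | h
    · exact absurd h hb.ne'
    · linarith
  have hI2 : (v-p)^2+(r-q)^2 = u^2+r^2 := by
    linear_combination (-2)*hdot - hc2
  rw [← htb, hex, hey]
  refine ⟨?_, ?_, ?_⟩
  · linear_combination (1-t)*hIA - t*(t-1)*(-1)*hb2*(-1) + (b-t*b)*(-1)*htb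
  · linear_combination hI2 - 2*t*hIA - t^2*hb2 + (2*u-t*b-k*u)*(-1)*htb
  · linear_combination -(1-t)^2*hb2

structure IsFrame (X Y : Plane → ℝ) (N : Plane) : Prop where
  dist_sq : ∀ P Q, dist P Q ^ 2 = (X P - X Q)^2 + (Y P - Y Q)^2
  inner_eq : ∀ P Q R : Plane, inner ℝ (P - Q) (R - Q) = (X P - X Q)*(X R - X Q) + (Y P - Y Q)*(Y R - Y Q)
  affX : ∀ (P Q : Plane) (s t : ℝ), s + t = 1 → X (s • P + t • Q) = s * X P + t * X Q
  affY : ∀ (P Q : Plane) (s t : ℝ), s + t = 1 → Y (s • P + t • Q) = s * Y P + t * Y Q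
  NX : ∀ (P : Plane) (t : ℝ), X (P + t • N) = X P
  NY : ∀ (P : Plane) (t : ℝ), Y (P + t • N) = Y P + t

lemma exists_frame (A B C : Plane) (h : AffineIndependent ℝ ![A, B, C]) :
    ∃ X Y N, IsFrame X Y N ∧ X B = 0 ∧ Y B = 0 ∧ X C = dist B C ∧ Y C = 0 ∧ 0 < Y A := by
  have hBC : B ≠ C := fun hh => by
    have := h.injective.ne (show (1 : Fin 3) ≠ 2 by decide)
    exact this hh
  have ha : 0 < dist B C := dist_pos.2 hBC
  have ha2 : dist B C ^ 2 = (B 0 - C 0)^2 + (B 1 - C 1)^2 := by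
    rw [EuclideanSpace.dist_eq, Real.sq_sqrt (by positivity)]
    simp [Fin.sum_univ_two, Real.dist_eq, sq_abs]
  have hcr : (C 0 - B 0)*(A 1 - B 1) - (C 1 - B 1)*(A 0 - B 0) ≠ 0 := by
    intro h0
    rw [affineIndependent_iff_not_collinear_set] at h
    apply h
    rw [Set.insert_comm, collinear_iff_of_mem (p₀ := B) (by simp)]
    refine ⟨C - B, ?_⟩
    intro p hp
    simp only [Set.mem_insert_iff, Set.mem_singleton_iff] at hp
    rcases hp with rfl | rfl | rfl
    · exact ⟨0, by simp⟩
    · refine ⟨((C 0 - B 0)*(p 0 - B 0) + (C 1 - B 1)*(p 1 - B 1))/dist B C^2, ?_⟩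
      ext i
      fin_cases i
      · simp
        field_simp
        rw [ha2]
        linear_combination (-(C 1 - B 1)) * h0
      · simp
        field_simp
        rw [ha2]
        linear_combination ((C 0 - B 0)) * h0
    · exact ⟨1, by simp⟩
  obtain ⟨σ, hσ, hσp⟩ : ∃ σ : ℝ, σ^2 = 1 ∧ 0 < σ*((C 0 - B 0)*(A 1 - B 1) - (C 1 - B 1)*(A 0 - B 0)) := by
    rcases lt_or_gt_of_ne hcr with h | h
    · exact ⟨-1, by norm_num, by linarith⟩
    · exact ⟨1, by norm_num, by linarith⟩
  obtain ⟨a, haa⟩ : ∃ a, a = dist B C := ⟨_, rfl⟩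
  rw [← haa] at ha ha2 ⊢
  obtain ⟨e, he⟩ : ∃ e, e = (C 0 - B 0)/a := ⟨_, rfl⟩
  obtain ⟨f, hf⟩ : ∃ f, f = (C 1 - B 1)/a := ⟨_, rfl⟩
  have he' : C 0 - B 0 = e*a := by rw [he]; field_simp
  have hf' : C 1 - B 1 = f*a := by rw [hf]; field_simp
  have hef : e^2+f^2 = 1 := by
    rw [he, hf]; field_simp; linarith
  refine ⟨fun P => (P 0 - B 0)*e + (P 1 - B 1)*f, fun P => σ*(e*(P 1 - B 1) - f*(P 0 - B 0)), !₂[-(σ*f), σ*e], ?_, ?_, ?_, ?_, ?_, ?_⟩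
  · constructor
    · intro P Q
      rw [EuclideanSpace.dist_eq, Real.sq_sqrt (by positivity)]
      simp only [Fin.sum_univ_two, Real.dist_eq, sq_abs]
      linear_combination (-((P 0 - Q 0)^2 + (P 1 - Q 1)^2))*hef - (e*(P 1 - Q 1) - f*(P 0 - Q 0))^2*hσ
    · intro P Q R
      simp [PiLp.inner_apply, Fin.sum_univ_two]
      linear_combination (-((P 0 - Q 0)*(R 0 - Q 0) + (P 1 - Q 1)*(R 1 - Q 1)))*hef - (e*(P 1 - Q 1) - f*(P 0 - Q 0))*(e*(R 1 - Q 1) - f*(R 0 - Q 0))*hσ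
    · intro P Q s t hst
      simp
      linear_combination (-B 0*e-B 1*f)*(-1)*hst
    · intro P Q s t hst
      simp
      linear_combination σ*(-B 0*f+B 1*e)*hst
    · intro P t
      simp
      ring
    · intro P t
      simp
      linear_combination t*σ^2*hef + t*hσ
  · simp
  · simp
  · simp only [he', hf']; linear_combination a*hef
  · simp only [he', hf']; ring
  · rw [he', hf'] at hσp
    have : 0 < a * (σ*(e*(A 1 - B 1) - f*(A 0 - B 0))) := by linarith
    exact (pos_iff_pos_of_mul_pos this).1 ha

section
variable {X Y : Plane → ℝ} {N : Plane}

lemma IsFrame.lineX (F : IsFrame X Y N) (P Q : Plane) (t : ℝ) :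
    X (AffineMap.lineMap P Q t) = X P + t * (X Q - X P) := by
  rw [AffineMap.lineMap_apply_module, F.affX _ _ _ _ (by ring)]; ring

lemma IsFrame.lineY (F : IsFrame X Y N) (P Q : Plane) (t : ℝ) :
    Y (AffineMap.lineMap P Q t) = Y P + t * (Y Q - Y P) := by
  rw [AffineMap.lineMap_apply_module, F.affY _ _ _ _ (by ring)]; ring

lemma IsFrame.infDist_line (F : IsFrame X Y N) (U V P : Plane) (hUV : U ≠ V) :
    Metric.infDist P (affineSpan ℝ ({U, V} : Set Plane) : Set Plane) * dist U V =
      |(X V - X U)*(Y P - Y U) - (Y V - Y U)*(X P - X U)| := by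
  have hd : 0 < dist U V := dist_pos.2 hUV
  have hd2 := F.dist_sq U V
  set cr := (X V - X U)*(Y P - Y U) - (Y V - Y U)*(X P - X U) with hcr
  have key : ∀ t : ℝ, (dist P (AffineMap.lineMap U V t) * dist U V)^2 =
      cr^2 + ((X P - X U)*(X V - X U) + (Y P - Y U)*(Y V - Y U) - t*dist U V^2)^2 := by
    intro t
    rw [mul_pow, F.dist_sq P, F.lineX, F.lineY, hd2, hcr]; ring
  have hne : ((affineSpan ℝ ({U, V} : Set Plane) : Set Plane)).Nonempty :=
    ⟨U, left_mem_affineSpan_pair ℝ U V⟩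
  apply le_antisymm
  · have h := key (((X P - X U)*(X V - X U) + (Y P - Y U)*(Y V - Y U))/dist U V^2)
    rw [div_mul_cancel₀ _ (by positivity), sub_self] at h
    have h2 := Metric.infDist_le_dist_of_mem (x := P) (AffineMap.lineMap_mem_affineSpan_pair (((X P - X U)*(X V - X U) + (Y P - Y U)*(Y V - Y U))/dist U V^2) U V)
    refine (mul_le_mul_of_nonneg_right h2 hd.le).trans ?_
    apply abs_le_of_sq_le_sq' _ (abs_nonneg _) |>.2
    rw [h, sq_abs]; simp
  · rw [← div_le_iff₀ hd, Metric.le_infDist hne]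
    intro Q hQ
    obtain ⟨t, rfl⟩ := (mem_affineSpan_pair_iff_exists_lineMap_eq).1 hQ
    rw [div_le_iff₀ hd]
    apply abs_le_of_sq_le_sq _ (by positivity)
    rw [key]
    nlinarith [sq_nonneg ((X P - X U)*(X V - X U) + (Y P - Y U)*(Y V - Y U) - t*dist U V^2)]

lemma IsFrame.hull (F : IsFrame X Y N) (A B C P : Plane) (α β δ : ℝ)
    (hA : 0 ≤ α * X A + β * Y A + δ) (hB : 0 ≤ α * X B + β * Y B + δ)
    (hC : 0 ≤ α * X C + β * Y C + δ) (hP : P ∈ convexHull ℝ ({A, B, C} : Set Plane)) :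
    0 ≤ α * X P + β * Y P + δ := by
  have : convexHull ℝ ({A, B, C} : Set Plane) ⊆ {Q | 0 ≤ α * X Q + β * Y Q + δ} := by
    apply convexHull_min
    · intro Q hQ
      simp only [Set.mem_insert_iff, Set.mem_singleton_iff] at hQ
      rcases hQ with rfl | rfl | rfl <;> assumption
    · intro Q hQ R hR s t hs ht hst
      simp only [Set.mem_ofPred_eq] at *
      rw [F.affX _ _ _ _ hst, F.affY _ _ _ _ hst]
      have : α * (s * X Q + t * X R) + β * (s * Y Q + t * Y R) + δ = s*(α * X Q + β * Y Q + δ) + t*(α * X R + β * Y R + δ) := by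
        linear_combination (-δ)*hst
      rw [this]; positivity
  exact this hP

lemma IsFrame.dist_N (F : IsFrame X Y N) (P : Plane) (t : ℝ) : dist (P + t • N) P = |t| := by
  have h := F.dist_sq (P + t • N) P
  rw [F.NX, F.NY] at h
  rw [← abs_of_nonneg (dist_nonneg (x := P + t • N) (y := P)), ← sq_eq_sq_iff_abs_eq_abs, h]; ring

end

set_option maxHeartbeats 1000000 in
/-- In the Ajima-circle configuration, let `E` be the point where `γ` touches line
`AC`.  Then `∠ B T C = 2 · ∠ I E C`. -/
theorem angle_BTC_eq_two_angle_IEC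
    (A B C I Oω D T : Plane) (r Rω ρ : ℝ)
    (hABC : AffineIndependent ℝ ![A, B, C])
    (hr : 0 < r)
    (hIin : I ∈ interior (convexHull ℝ ({A, B, C} : Set Plane)))
    (hIab : Metric.infDist I (affineSpan ℝ ({A, B} : Set Plane) : Set Plane) = r)
    (hIbc : Metric.infDist I (affineSpan ℝ ({B, C} : Set Plane) : Set Plane) = r)
    (hIca : Metric.infDist I (affineSpan ℝ ({C, A} : Set Plane) : Set Plane) = r)
    (hRω : 0 < Rω) (hρ : 0 < ρ)
    (hBω : dist B Oω = Rω) (hCω : dist C Oω = Rω)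
    (hγin : Metric.sphere D ρ ⊆ convexHull ℝ ({A, B, C} : Set Plane))
    (hγAB : Metric.infDist D (affineSpan ℝ ({A, B} : Set Plane) : Set Plane) = ρ)
    (hγAC : Metric.infDist D (affineSpan ℝ ({A, C} : Set Plane) : Set Plane) = ρ)
    (hext : dist Oω D = Rω + ρ)
    (hTω : dist T Oω = Rω) (hTγ : dist T D = ρ)
    (hTseg : Wbtw ℝ Oω T D)
    (hTin : T ∈ interior (convexHull ℝ ({A, B, C} : Set Plane)))
    (E : Plane)
    (hE : E ∈ affineSpan ℝ ({A, C} : Set Plane)) (hEγ : dist D E = ρ) :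
    ∠ B T C = 2 * ∠ I E C := by
  obtain ⟨X, Y, N, F, hXB, hYB, hXC, hYC, hYA⟩ := exists_frame A B C hABC
  have hBC : B ≠ C := fun hh => hABC.injective.ne (show (1 : Fin 3) ≠ 2 by decide) hh
  have hAB : A ≠ B := fun hh => hABC.injective.ne (show (0 : Fin 3) ≠ 1 by decide) hh
  have hAC : A ≠ C := fun hh => hABC.injective.ne (show (0 : Fin 3) ≠ 2 by decide) hh
  have ha : 0 < dist B C := dist_pos.2 hBC
  have hc : 0 < dist A B := dist_pos.2 hAB
  have hb : 0 < dist A C := dist_pos.2 hAC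
  have hb2 := F.dist_sq A C
  have hc2 := F.dist_sq A B
  have hI1 := F.infDist_line A B I hAB
  have hI2 := F.infDist_line B C I hBC
  have hI3 := F.infDist_line C A I hAC.symm
  have hD1 := F.infDist_line A B D hAB
  have hD2 := F.infDist_line A C D hAC
  rw [hIab] at hI1
  rw [hIbc] at hI2
  rw [hIca, dist_comm] at hI3
  rw [hγAB] at hD1
  rw [hγAC] at hD2
  have hO1 := F.dist_sq B Oω
  have hO2 := F.dist_sq C Oω
  have hOD := F.dist_sq Oω D
  have hTO := F.dist_sq T Oω
  have hDE := F.dist_sq D E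
  have hTB := F.dist_sq B T
  have hTC := F.dist_sq C T
  have hIE := F.dist_sq I E
  have hCE := F.dist_sq C E
  have hin1 := F.inner_eq B T C
  have hin2 := F.inner_eq I E C
  obtain ⟨t, rfl⟩ := (mem_affineSpan_pair_iff_exists_lineMap_eq).1 hE
  have hex := F.lineX A C t
  have hey := F.lineY A C t
  set E := AffineMap.lineMap A C t with hEdef
  obtain ⟨a, hadef⟩ : ∃ a, a = dist B C := ⟨_, rfl⟩
  rw [hBω] at hO1
  rw [hCω] at hO2
  rw [hext] at hOD
  rw [hTω] at hTO
  rw [hEγ] at hDE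
  rw [← hadef] at hXC ha hI2
  simp only [hXB, hYB, hXC, hYC] at hb2 hc2 hI1 hI2 hI3 hD1 hD2 hO1 hO2 hOD hTB hTC hCE hin1 hin2 hex hey
  -- half-plane facts
  have hull1 : ∀ P ∈ convexHull ℝ ({A, B, C} : Set Plane), 0 ≤ Y P := by
    intro P hP
    have := F.hull A B C P 0 1 0 (by linarith) (by rw [hYB]; simp) (by rw [hYC]; simp) hP
    linarith
  have hull2 : ∀ P ∈ convexHull ℝ ({A, B, C} : Set Plane), 0 ≤ Y A * X P - X A * Y P := by
    intro P hP
    have := F.hull A B C P (Y A) (-X A) 0 (by linarith) (by rw [hYB, hXB]; simp)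
      (by rw [hYC, hXC]; simp; positivity) hP
    linarith
  have hull3 : ∀ P ∈ convexHull ℝ ({A, B, C} : Set Plane), 0 ≤ Y A * (a - X P) - (a - X A) * Y P := by
    intro P hP
    have := F.hull A B C P (-Y A) (-(a - X A)) (Y A * a) (by linarith)
      (by rw [hYB, hXB]; simp; positivity) (by rw [hYC, hXC]; linarith) hP
    linarith
  have hIh := interior_subset hIin
  have hN1 : D + ρ • N ∈ convexHull ℝ ({A, B, C} : Set Plane) := hγin (by
    rw [Metric.mem_sphere, F.dist_N, abs_of_pos hρ])
  have hN2 : D + (-ρ) • N ∈ convexHull ℝ ({A, B, C} : Set Plane) := hγin (by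
    rw [Metric.mem_sphere, F.dist_N, abs_neg, abs_of_pos hρ])
  have hdy := hull1 _ hN2
  have hd1 := hull2 _ hN1
  have hd2 := hull2 _ hN2
  have hd3 := hull3 _ hN1
  have hd4 := hull3 _ hN2
  rw [F.NY] at hdy
  rw [F.NX, F.NY] at hd1 hd2 hd3 hd4
  have hty : 0 < Y T := by
    obtain ⟨ε, hε, hball⟩ := Metric.mem_nhds_iff.1 (mem_interior_iff_mem_nhds.1 hTin)
    have h : T + (-(ε/2)) • N ∈ Metric.ball T ε := by
      rw [Metric.mem_ball, F.dist_N, abs_neg, abs_of_pos (by positivity)]; linarith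
    have h := hull1 _ (hball h)
    rw [F.NY] at h
    linarith
  have hiy : Y I = r := by
    have h0 := hull1 I hIh
    have h1 : (a - 0)*(Y I - 0) - (0-0)*(X I - 0) = a * Y I := by ring
    rw [h1, abs_of_nonneg (by positivity)] at hI2
    have h2 : a * (Y I - r) = 0 := by linarith
    rcases mul_eq_zero.1 h2 with h | h
    · exact absurd h ha.ne'
    · linarith
  have hI1' : Y A * X I - X A * r = r * dist A B := by
    have h0 := hull2 I hIh
    have h1 : (0 - X A)*(Y I - Y A) - (0 - Y A)*(X I - X A) = Y A * X I - X A * Y I := by ring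
    rw [h1, abs_of_nonneg h0, hiy] at hI1
    linarith
  have hI3' : Y A * (a - X I) - (a - X A) * r = r * dist A C := by
    have h0 := hull3 I hIh
    have h1 : (X A - a)*(Y I - 0) - (Y A - 0)*(X I - a) = Y A * (a - X I) - (a - X A) * Y I := by ring
    rw [h1, abs_of_nonneg h0, hiy] at hI3
    linarith
  have hD1' : Y A * X D - X A * Y D = ρ * dist A B := by
    have h0 : 0 ≤ Y A * X D - X A * Y D := by linarith
    have h1 : (0 - X A)*(Y D - Y A) - (0 - Y A)*(X D - X A) = Y A * X D - X A * Y D := by ring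
    rw [h1, abs_of_nonneg h0] at hD1
    linarith
  have hD2' : Y A * (a - X D) - (a - X A) * Y D = ρ * dist A C := by
    have h0 : 0 ≤ Y A * (a - X D) - (a - X A) * Y D := by linarith
    have h1 : (a - X A)*(Y D - Y A) - (0 - Y A)*(X D - X A) = -(Y A * (a - X D) - (a - X A) * Y D) := by ring
    rw [h1, abs_neg, abs_of_nonneg h0] at hD2
    linarith
  obtain ⟨k, u, v, w, hk0, hk1, hu, hv, hw, hav, hbu, hcu, hixv, hdx', hdy', hkr, hap, hdot, hox, hfin⟩ :=
    core_alg a (dist A C) (dist A B) (X A) (Y A) r ρ (X I) (X D) (Y D) (X Oω) (Y Oω) Rω ha hYA hb hc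
      (by rw [hb2]; ring) (by rw [hc2]; ring) hr hρ hI1' hI3' hD1' hD2' (by linarith) hRω
      (by rw [hO1]; ring) (by rw [hO2]; ring) (by rw [hOD])
  obtain ⟨g1, g2, g3⟩ := core_E a (dist A C) (X A) (Y A) r ρ k u v w (X D) (Y D) (X E) (Y E) t hb
    (by rw [hb2]; ring) (by rw [← hcu, hc2]; ring) hav hbu hdx' hdy' hap hdot hD2' hex (by rw [hey]; ring) hDE.symm
  rw [hixv, hiy] at hin2 hIE
  rw [g1] at hin2
  rw [g2] at hIE
  rw [g3] at hCE
  obtain ⟨g, hg⟩ : ∃ g, g = (1-k)*u := ⟨_, rfl⟩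
  have hgp : 0 < g := by rw [hg]; have : 0 < 1-k := by linarith
                         positivity
  rw [← hg] at hin2 hIE hfin
  have hm : 0 < dist A C - k*u := by
    have e : dist A C - k*u = (1-k)*u + w := by rw [hbu]; ring
    rw [e, ← hg]; positivity
  have hCE' : dist C E = dist A C - k*u := by
    have := abs_eq_abs.2 (sq_eq_sq_iff_eq_or_eq_neg.1 hCE)
    rwa [abs_of_nonneg dist_nonneg, abs_of_pos hm] at this
  have hIEp : 0 < dist I E := by
    rcases (dist_nonneg (x := I) (y := E)).eq_or_lt with h | h
    · rw [← h] at hIE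
      have : 0 < g^2 + r^2 := by positivity
      linarith
    · exact h
  have hcosE : Real.cos (∠ I E C) = g / dist I E := by
    rw [EuclideanGeometry.angle, InnerProductGeometry.cos_angle]
    simp only [vsub_eq_sub]
    rw [hin2, ← dist_eq_norm, ← dist_eq_norm, hCE']
    field_simp
  have hRo : Y Oω^2 = Rω^2 - a^2/4 := by rw [hox] at hO1; linarith
  have hTcirc : X T^2 + Y T^2 = a * X T + 2 * Y T * Y Oω := by
    rw [hox] at hTO; linarith
  have hBTC : dist B T * dist C T = 2 * Rω * Y T := by
    have h : (dist B T * dist C T)^2 = (2 * Rω * Y T)^2 := by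
      rw [mul_pow, hTB, hTC]
      have e1 : (0 - X T)^2+(0-Y T)^2 = a * X T + 2 * Y T * Y Oω := by linarith
      have e2 : (a - X T)^2+(0-Y T)^2 = a*(a - X T) + 2 * Y T * Y Oω := by linarith
      rw [e1, e2]
      linear_combination 4*Y T^2*hRo - a^2*hTcirc
    have := abs_eq_abs.2 (sq_eq_sq_iff_eq_or_eq_neg.1 h)
    rwa [abs_of_nonneg (by positivity), abs_of_nonneg (by positivity)] at this
  have hcosT : Real.cos (∠ B T C) = Y Oω / Rω := by
    rw [EuclideanGeometry.angle, InnerProductGeometry.cos_angle]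
    simp only [vsub_eq_sub]
    rw [hin1, ← dist_eq_norm, ← dist_eq_norm, hBTC]
    field_simp
    linarith
  have hoyR : Y Oω < Rω := (abs_lt.1 (abs_lt_of_sq_lt_sq (by linarith [show 0 < a^2 by positivity]) hRω.le)).2
  have hkey : r^2*(Rω + Y Oω) = g^2*(Rω - Y Oω) := by
    have h : (4*(Rω - Y Oω)) * (r^2*(Rω + Y Oω) - g^2*(Rω - Y Oω)) = 0 := by
      linear_combination (-(r*a + (Rω - Y Oω)*(2*g)))*hfin - 4*r^2*hRo
    rcases mul_eq_zero.1 h with h | h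
    · linarith
    · linarith
  have hle : ∠ I E C ≤ π/2 := by
    by_contra hcon
    push Not at hcon
    have h1 := Real.cos_neg_of_pi_div_two_lt_of_lt hcon
      (by linarith [EuclideanGeometry.angle_le_pi I E C, Real.pi_pos])
    rw [hcosE] at h1
    have : 0 < g / dist I E := by positivity
    linarith
  apply Real.injOn_cos ⟨EuclideanGeometry.angle_nonneg _ _ _, EuclideanGeometry.angle_le_pi _ _ _⟩
    ⟨by linarith [EuclideanGeometry.angle_nonneg I E C], by linarith⟩
  rw [Real.cos_two_mul, hcosE, hcosT, div_pow, hIE]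
  have : g^2+r^2 ≠ 0 := by positivity
  field_simp
  linarith
end

section
/- The points T, I and N are collinear. -/
open EuclideanGeometry Real RealInnerProductSpace Affine

theorem ajima_core (a p q u r x y ρ L1 L2 : ℝ) (m n : ℝ) (ha : 0 < a) (hq : 0 < q) (hr : 0 < r)
    (hρ : 0 < ρ) (hL1 : 0 < L1) (hL2 : 0 < L2)
    (h1 : L1 ^ 2 = q ^ 2 + (p + a) ^ 2) (h2 : L2 ^ 2 = q ^ 2 + (p - a) ^ 2)
    (hI1 : q * (u + a) - (p + a) * r = r * L1) (hI2 : q * (a - u) - (a - p) * r = r * L2)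
    (hD1 : q * (x + a) - (p + a) * y = ρ * L1) (hD2 : q * (a - x) - (a - p) * y = ρ * L2)
    (hy : 0 ≤ y) (hm : 0 < m) (hn : 0 < n) (hmn : m * n = a ^ 2)
    (hE : x ^ 2 + y ^ 2 - a ^ 2 - ρ ^ 2 - m * (y + ρ) + n * (y - ρ) = 0) :
    x * (r + n) = u * (y + ρ + n) := by
  obtain ⟨s, hs⟩ : ∃ s, s = u + a := ⟨_, rfl⟩
  obtain ⟨t, ht⟩ : ∃ t, t = a - u := ⟨_, rfl⟩
  rw [← hs] at hI1
  rw [← ht] at hI2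
  have hL1' : p + a < L1 ∧ -(p + a) < L1 := by constructor <;> nlinarith
  have hL2' : a - p < L2 ∧ -(a - p) < L2 := by constructor <;> nlinarith
  have hs0 : 0 < s := by
    have : 0 < q * s := by nlinarith
    exact pos_of_mul_pos_right this hq.le
  have ht0 : 0 < t := by
    have : 0 < q * t := by nlinarith
    exact pos_of_mul_pos_right this hq.le
  have e1 : 2 * s * r * (p + a) = q * (s ^ 2 - r ^ 2) := by
    apply mul_left_cancel₀ hq.ne'
    linear_combination (-(q * s - (p + a) * r) - r * L1) * hI1 - r ^ 2 * h1
  have e2 : 2 * t * r * (a - p) = q * (t ^ 2 - r ^ 2) := by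
    apply mul_left_cancel₀ hq.ne'
    linear_combination (-(q * t - (a - p) * r) - r * L2) * hI2 - r ^ 2 * h2
  have hst : s + t = 2 * a := by linarith
  have e3 : q * (s * t - r ^ 2) = 2 * s * t * r := by
    have : s + t ≠ 0 := by positivity
    apply mul_left_cancel₀ this
    linear_combination -t * e1 - s * e2 + 2 * s * t * r * (-hst)
  have hw : 0 < s * t - r ^ 2 := by
    have : 0 < q * (s * t - r ^ 2) := by rw [e3]; positivity
    exact pos_of_mul_pos_right this hq.le
  obtain ⟨w, hwd⟩ : ∃ w, w = s * t - r ^ 2 := ⟨_, rfl⟩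
  rw [← hwd] at hw e3
  obtain ⟨e, he⟩ : ∃ e, e = (r - ρ) / w := ⟨_, rfl⟩
  have he' : e * w = r - ρ := by rw [he]; field_simp
  have hq' : q = 2 * s * t * r / w := by field_simp; linarith
  have hp1 : p + a = t * (s ^ 2 - r ^ 2) / w := by
    have : p + a = q * (s ^ 2 - r ^ 2) / (2 * s * r) := by field_simp; linarith
    rw [this, hq']; field_simp
  have hp2 : a - p = s * (t ^ 2 - r ^ 2) / w := by
    have : a - p = q * (t ^ 2 - r ^ 2) / (2 * t * r) := by field_simp; linarith
    rw [this, hq']; field_simp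
  have l1 : L1 = t * (s ^ 2 + r ^ 2) / w := by
    have : L1 = q * s / r - (p + a) := by field_simp; linarith
    rw [this, hp1, hq']; field_simp; ring
  have l2 : L2 = s * (t ^ 2 + r ^ 2) / w := by
    have : L2 = q * t / r - (a - p) := by field_simp; linarith
    rw [this, hp2, hq']; field_simp; ring
  have d1 : 2 * s * r * (x + a) - (s ^ 2 - r ^ 2) * y = ρ * (s ^ 2 + r ^ 2) := by
    rw [hq', hp1, l1] at hD1
    field_simp at hD1
    linarith
  have d2 : 2 * t * r * (a - x) - (t ^ 2 - r ^ 2) * y = ρ * (t ^ 2 + r ^ 2) := by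
    rw [hq', hp2, l2] at hD2
    field_simp at hD2
    linarith
  have d3 : ρ * (s * t + r ^ 2) + y * w = 2 * s * t * r := by
    have : s + t ≠ 0 := by positivity
    apply mul_left_cancel₀ this
    rw [hwd]
    linear_combination -t * d1 - s * d2 + 2 * s * t * r * (-hst)
  have hρe : ρ = r - e * w := by linarith
  have hyv : y = r - e * w + 2 * s * t * e := by
    apply mul_right_cancel₀ hw.ne'
    rw [hρe] at d3
    have hw2 : s * t = w + r ^ 2 := by linarith
    linear_combination d3 + (e*w - r - 2 * e * w + 2 * r) * hw2
  have hu : s - t = 2 * u := by linarith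
  have hxv : x = u * (1 + 2 * r * e) := by
    have : 2 * s * r ≠ 0 := by positivity
    apply mul_left_cancel₀ this
    have ha' : a = (s + t) / 2 := by linarith
    have hu' : u = (s - t) / 2 := by linarith
    rw [hyv, hρe, ha', hwd] at d1
    rw [hu']
    linear_combination d1
  have y1 : y - ρ = 2 * s * t * e := by rw [hyv, hρe]; ring
  have y2 : y + ρ = 2 * r * (1 + r * e) := by rw [hyv, hρe, hwd]; ring
  have hst2 : s * t = a ^ 2 - u ^ 2 := by rw [hs, ht]; ring
  have hF : (m - 2 * a ^ 2 * e) * (m * (y + ρ) + s * t) = 0 := by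
    have : m * (x ^ 2 - a ^ 2 + (y - ρ) * (y + ρ) - m * (y + ρ)) + a ^ 2 * (y - ρ) = 0 := by
      linear_combination m * hE - (y - ρ) * hmn
    rw [y1, y2, hxv] at this
    rw [y2]
    have hs2 : u ^ 2 = a ^ 2 - s * t := by linarith
    linear_combination -this + m * (1 + 2 * r * e) ^ 2 * hs2
  have hm2 : m = 2 * a ^ 2 * e := by
    rcases mul_eq_zero.mp hF with h | h
    · linarith
    · have : 0 < m * (y + ρ) + s * t := by positivity
      linarith
  have hne : 2 * e * n = 1 := by
    have : a ^ 2 ≠ 0 := by positivity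
    apply mul_left_cancel₀ this
    rw [hm2] at hmn
    linarith
  rw [y2, hxv]
  linear_combination u * r * hne

theorem infDist_line (X Y : Plane → ℝ)
    (hd : ∀ P Q, dist P Q ^ 2 = (X P - X Q) ^ 2 + (Y P - Y Q) ^ 2)
    (hX : ∀ P Q t, X (AffineMap.lineMap P Q t) = X P + t * (X Q - X P))
    (hY : ∀ P Q t, Y (AffineMap.lineMap P Q t) = Y P + t * (Y Q - Y P))
    (A B P : Plane) (hAB : A ≠ B) (d : ℝ)
    (h : Metric.infDist P (affineSpan ℝ ({A, B} : Set Plane) : Set Plane) = d) :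
    |(X B - X A) * (Y P - Y A) - (Y B - Y A) * (X P - X A)| = d * dist A B := by
  have hL : 0 < dist A B := dist_pos.mpr hAB
  have hL2 := hd A B
  set L := dist A B
  set K := (X B - X A) * (Y P - Y A) - (Y B - Y A) * (X P - X A) with hK
  rw [← h, ← div_eq_iff hL.ne']
  apply le_antisymm
  · rw [Metric.le_infDist ⟨A, left_mem_affineSpan_pair ℝ A B⟩]
    intro Z hZ
    obtain ⟨t, rfl⟩ := (mem_affineSpan_pair_iff_exists_lineMap_eq).1 hZ
    rw [div_le_iff₀ hL]
    refine abs_le_of_sq_le_sq ?_ (by positivity)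
    rw [mul_pow, hd, hL2, hX, hY, hK]
    nlinarith [sq_nonneg ((X P - (X A + t * (X B - X A))) * (X A - X B) + (Y P - (Y A + t * (Y B - Y A))) * (Y A - Y B))]
  · set t := ((X P - X A) * (X B - X A) + (Y P - Y A) * (Y B - Y A)) / L ^ 2 with ht
    have ht' : t * L ^ 2 = (X P - X A) * (X B - X A) + (Y P - Y A) * (Y B - Y A) := by
      rw [ht]; field_simp
    refine (Metric.infDist_le_dist_of_mem (AffineMap.lineMap_mem_affineSpan_pair t A B)).trans ?_
    rw [le_div_iff₀ hL]
    apply le_of_sq_le_sq _ (abs_nonneg _)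
    rw [sq_abs, mul_pow, hd, hX, hY, hK]
    apply le_of_eq
    rw [hL2] at ht' ⊢
    linear_combination (t * ((X A - X B) ^ 2 + (Y A - Y B) ^ 2) - ((X P - X A) * (X B - X A) + (Y P - Y A) * (Y B - Y A))) * ht'

theorem exists_frame_s5 (A B C : Plane) (hABC : AffineIndependent ℝ ![A, B, C]) :
    ∃ X Y : Plane → ℝ, ∃ a : ℝ, 0 < a ∧
    (∀ P Q, dist P Q ^ 2 = (X P - X Q) ^ 2 + (Y P - Y Q) ^ 2) ∧
    (∀ P Q t, X (AffineMap.lineMap P Q t) = X P + t * (X Q - X P)) ∧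
    (∀ P Q t, Y (AffineMap.lineMap P Q t) = Y P + t * (Y Q - Y P)) ∧
    X B = -a ∧ X C = a ∧ Y B = 0 ∧ Y C = 0 ∧ 0 < Y A := by
  have hBC : B ≠ C := by
    intro h
    have := hABC.injective.ne (show (1 : Fin 3) ≠ 2 by decide)
    simp [h] at this
  have hL : 0 < dist B C := dist_pos.mpr hBC
  set L := dist B C with hLd
  have hL2 : L ^ 2 = (B 0 - C 0) ^ 2 + (B 1 - C 1) ^ 2 := by
    rw [hLd, EuclideanSpace.dist_eq, Real.sq_sqrt (by positivity)]
    simp [Fin.sum_univ_two, Real.dist_eq, sq_abs]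
  have hA : (C 0 - B 0) * (A 1 - B 1) - (C 1 - B 1) * (A 0 - B 0) ≠ 0 := by
    intro h0
    rw [affineIndependent_iff_not_collinear_set] at hABC
    apply hABC
    apply collinear_insert_of_mem_affineSpan_pair
    rw [mem_affineSpan_pair_iff_exists_lineMap_eq]
    refine ⟨((A 0 - B 0) * (C 0 - B 0) + (A 1 - B 1) * (C 1 - B 1)) / L ^ 2, ?_⟩
    ext i
    fin_cases i
    · simp [AffineMap.lineMap_apply]
      field_simp
      rw [hL2]
      linear_combination (C 1 - B 1) * h0
    · simp [AffineMap.lineMap_apply]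
      field_simp
      rw [hL2]
      linear_combination -(C 0 - B 0) * h0
  obtain ⟨ε, hε, hεA⟩ : ∃ ε : ℝ, ε ^ 2 = 1 ∧
      0 < ε * ((C 0 - B 0) * (A 1 - B 1) - (C 1 - B 1) * (A 0 - B 0)) := by
    rcases lt_or_gt_of_ne hA with h | h
    · exact ⟨-1, by norm_num, by linarith⟩
    · exact ⟨1, by norm_num, by linarith⟩
  refine ⟨fun P => ((C 0 - B 0) * (P 0 - B 0) + (C 1 - B 1) * (P 1 - B 1)) / L - L / 2,
    fun P => ε * ((C 0 - B 0) * (P 1 - B 1) - (C 1 - B 1) * (P 0 - B 0)) / L, L / 2,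
    by positivity, ?_, ?_, ?_, ?_, ?_, ?_, ?_, ?_⟩
  · intro P Q
    rw [EuclideanSpace.dist_eq, Real.sq_sqrt (by positivity)]
    simp [Fin.sum_univ_two, Real.dist_eq, sq_abs]
    field_simp
    ring_nf
    rw [hε, hL2]
    ring
  · intro P Q t
    simp [AffineMap.lineMap_apply]
    field_simp
    ring
  · intro P Q t
    simp [AffineMap.lineMap_apply]
    field_simp
    ring
  · simp
  · simp only
    field_simp
    rw [hL2]
    ring
  · simp
  · simp only
    field_simp
    ring
  · simp only
    positivity

theorem hull_coords (X Y : Plane → ℝ)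
    (hX : ∀ P Q t, X (AffineMap.lineMap P Q t) = X P + t * (X Q - X P))
    (hY : ∀ P Q t, Y (AffineMap.lineMap P Q t) = Y P + t * (Y Q - Y P))
    (A B C P : Plane) (h : P ∈ convexHull ℝ ({A, B, C} : Set Plane)) :
    ∃ α β γ : ℝ, 0 ≤ α ∧ 0 ≤ β ∧ 0 ≤ γ ∧ α + β + γ = 1 ∧
      X P = α * X A + β * X B + γ * X C ∧ Y P = α * Y A + β * Y B + γ * Y C := by
  rw [convexHull_insert (by simp), convexHull_pair] at h
  simp only [convexJoin_singleton_left, Set.mem_iUnion] at h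
  obtain ⟨Q, hQ, hP⟩ := h
  rw [segment_eq_image_lineMap] at hQ hP
  obtain ⟨t, ht, rfl⟩ := hQ
  obtain ⟨v, hv, rfl⟩ := hP
  refine ⟨1 - v, v * (1 - t), v * t, by linarith [hv.2], mul_nonneg hv.1 (by linarith [ht.2]),
    mul_nonneg hv.1 ht.1, by ring, ?_, ?_⟩
  · rw [hX, hX]; ring
  · rw [hY, hY]; ring

set_option maxHeartbeats 1000000 in
/-- In the Ajima-circle configuration, let `N` be the point of `ω` on the
perpendicular bisector of `BC`, on the opposite side of line `BC` from `T`.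
Then `T`, `I`, `N` are collinear. -/
theorem T_I_N_collinear
    (A B C I Oω D T : Plane) (r Rω ρ : ℝ)
    (hABC : AffineIndependent ℝ ![A, B, C])
    (hr : 0 < r)
    (hIin : I ∈ interior (convexHull ℝ ({A, B, C} : Set Plane)))
    (hIab : Metric.infDist I (affineSpan ℝ ({A, B} : Set Plane) : Set Plane) = r)
    (hIbc : Metric.infDist I (affineSpan ℝ ({B, C} : Set Plane) : Set Plane) = r)
    (hIca : Metric.infDist I (affineSpan ℝ ({C, A} : Set Plane) : Set Plane) = r)
    (hRω : 0 < Rω) (hρ : 0 < ρ)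
    (hBω : dist B Oω = Rω) (hCω : dist C Oω = Rω)
    (hγin : Metric.sphere D ρ ⊆ convexHull ℝ ({A, B, C} : Set Plane))
    (hγAB : Metric.infDist D (affineSpan ℝ ({A, B} : Set Plane) : Set Plane) = ρ)
    (hγAC : Metric.infDist D (affineSpan ℝ ({A, C} : Set Plane) : Set Plane) = ρ)
    (hext : dist Oω D = Rω + ρ)
    (hTω : dist T Oω = Rω) (hTγ : dist T D = ρ)
    (hTseg : Wbtw ℝ Oω T D)
    (hTin : T ∈ interior (convexHull ℝ ({A, B, C} : Set Plane)))
    (N : Plane)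
    (hNω : dist N Oω = Rω)
    (hNperp : dist N B = dist N C)
    (hNside : (affineSpan ℝ ({B, C} : Set Plane)).SOppSide N T) :
    Collinear ℝ ({T, I, N} : Set Plane) := by
  obtain ⟨X, Y, a, ha, hd, hX, hY, hXB, hXC, hYB, hYC, hYA⟩ := exists_frame_s5 A B C hABC
  have hAB : A ≠ B := by rintro rfl; linarith
  have hAC : A ≠ C := by rintro rfl; linarith
  have hBC : B ≠ C := by rintro rfl; linarith
  have hext' : ∀ P Q, X P = X Q → Y P = Y Q → P = Q := by
    intro P Q h1 h2
    have := hd P Q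
    rw [h1, h2] at this
    have : dist P Q = 0 := by
      apply pow_eq_zero_iff (two_ne_zero) |>.1
      rw [this]; ring
    exact dist_eq_zero.1 this
  have hDin : D ∈ convexHull ℝ ({A, B, C} : Set Plane) := by
    let v : Plane := EuclideanSpace.single 0 ρ
    have hv : ‖v‖ = ρ := by simp [v, abs_of_pos hρ]
    have h1 : D + v ∈ convexHull ℝ ({A, B, C} : Set Plane) := hγin (by simp [hv])
    have h2 : D - v ∈ convexHull ℝ ({A, B, C} : Set Plane) := hγin (by simp [hv])
    have := (convex_convexHull ℝ ({A, B, C} : Set Plane)) h1 h2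
      (show (0 : ℝ) ≤ 1 / 2 by norm_num) (show (0 : ℝ) ≤ 1 / 2 by norm_num) (by norm_num)
    convert this using 1
    module
  have hTin' := interior_subset hTin
  have hIin' := interior_subset hIin
  obtain ⟨αI, βI, γI, hαI, hβI, hγI, hsI, hXI, hYI⟩ := hull_coords X Y hX hY A B C I hIin'
  obtain ⟨αD, βD, γD, hαD, hβD, hγD, hsD, hXD, hYD⟩ := hull_coords X Y hX hY A B C D hDin
  obtain ⟨αT, βT, γT, hαT, hβT, hγT, hsT, hXT, hYT⟩ := hull_coords X Y hX hY A B C T hTin'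
  have fI1 := infDist_line X Y hd hX hY A B I hAB r hIab
  have fI2 := infDist_line X Y hd hX hY B C I hBC r hIbc
  have fI3 := infDist_line X Y hd hX hY C A I hAC.symm r hIca
  have fD1 := infDist_line X Y hd hX hY A B D hAB ρ hγAB
  have fD2 := infDist_line X Y hd hX hY A C D hAC ρ hγAC
  have q1 := hd A B
  have q2 := hd A C
  have q3 := hd B C
  have pL1 : 0 < dist A B := dist_pos.mpr hAB
  have pL2 : 0 < dist A C := dist_pos.mpr hAC
  rw [dist_comm C A] at fI3
  have hLBC : dist B C = 2 * a := by
    have : dist B C ^ 2 = (2 * a) ^ 2 := by rw [q3, hXB, hXC, hYB, hYC]; ring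
    exact (pow_left_inj₀ dist_nonneg (by positivity) two_ne_zero).1 this
  generalize dist A B = L1 at fI1 fD1 q1 pL1
  generalize dist A C = L2 at fI3 fD2 q2 pL2
  rw [hLBC] at fI2
  simp only [hXB, hXC, hYB, hYC] at fI1 fI2 fI3 fD1 fD2 q1 q2 hXI hYI hXD hYD hXT hYT
  have hβI' : βI = 1 - αI - γI := by linarith
  have hβD' : βD = 1 - αD - γD := by linarith
  have hYI0 : 0 ≤ Y I := by rw [hYI]; simp; positivity
  have hYD0 : 0 ≤ Y D := by rw [hYD]; simp; positivity
  have hYT0 : 0 ≤ Y T := by rw [hYT]; simp; positivity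
  have gI2 : Y I = r := by
    have hp : 0 ≤ 2 * a * Y I := by positivity
    rw [show (a - -a) * (Y I - 0) - (0 - 0) * (X I - -a) = 2 * a * Y I by ring, abs_of_nonneg hp] at fI2
    apply mul_left_cancel₀ (show 2 * a ≠ 0 by positivity)
    linarith
  have gI1 : Y A * (X I + a) - (X A + a) * r = r * L1 := by
    rw [← fI1, ← gI2, abs_of_nonneg]
    · ring
    · have : 0 ≤ 2 * a * Y A * γI := by positivity
      rw [hXI, hYI, hβI']; linarith
  have gI3 : Y A * (a - X I) - (a - X A) * r = r * L2 := by
    rw [← fI3, ← gI2, abs_of_nonneg]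
    · ring
    · have : 0 ≤ 2 * a * Y A * βI := by positivity
      have h : αI = 1 - βI - γI := by linarith
      rw [hXI, hYI, h]; linarith
  have gD1 : Y A * (X D + a) - (X A + a) * Y D = ρ * L1 := by
    rw [← fD1, abs_of_nonneg]
    · ring
    · have : 0 ≤ 2 * a * Y A * γD := by positivity
      rw [hXD, hYD, hβD']; linarith
  have gD2 : Y A * (a - X D) - (a - X A) * Y D = ρ * L2 := by
    rw [← fD2, abs_of_nonpos]
    · ring
    · have : 0 ≤ 2 * a * Y A * βD := by positivity
      have h : αD = 1 - βD - γD := by linarith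
      rw [hXD, hYD, h]; linarith
  -- circle omega
  have hO1 := hd B Oω
  have hO2 := hd C Oω
  have hN1 := hd N Oω
  have hN2 := hd N B
  have hN3 := hd N C
  have hOD := hd Oω D
  have hTO := hd T Oω
  rw [hBω, hXB, hYB] at hO1
  rw [hCω, hXC, hYC] at hO2
  rw [hNω] at hN1
  rw [hXB, hYB] at hN2
  rw [← hNperp, hXC, hYC] at hN3
  rw [hext] at hOD
  rw [hTω] at hTO
  have hXO : X Oω = 0 := by
    apply mul_left_cancel₀ (show 4 * a ≠ 0 by positivity)
    linarith
  have hXN : X N = 0 := by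
    apply mul_left_cancel₀ (show 4 * a ≠ 0 by positivity)
    linarith
  have mem_line : ∀ P, Y P = 0 → P ∈ affineSpan ℝ ({B, C} : Set Plane) := by
    intro P hP
    rw [mem_affineSpan_pair_iff_exists_lineMap_eq]
    refine ⟨(X P + a) / (2 * a), hext' _ _ ?_ ?_⟩
    · rw [hX, hXB, hXC]; field_simp; ring
    · rw [hY, hYB, hYC, hP]; ring
  have hYTpos : 0 < Y T := lt_of_le_of_ne hYT0 fun h => hNside.2.2 (mem_line T h.symm)
  have hYNne : Y N ≠ 0 := fun h => hNside.2.1 (mem_line N h)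
  have hYN : Y N < 0 := by
    obtain ⟨Z, hZ, t, ht, rfl⟩ := (AffineSubspace.wOppSide_iff_exists_wbtw).1 hNside.1
    obtain ⟨v, hv⟩ := (mem_affineSpan_pair_iff_exists_lineMap_eq).1 hZ
    have h0 : Y (AffineMap.lineMap N T t) = 0 := by rw [← hv, hY, hYB, hYC]; ring
    rw [hY] at h0
    rcases lt_or_gt_of_ne hYNne with h | h
    · exact h
    · exfalso
      have h1 := ht.1
      have h2 := ht.2
      rcases h1.eq_or_lt with h3 | h3
      · rw [← h3] at h0; linarith
      · linarith only [h0, mul_pos h3 hYTpos, mul_nonneg (sub_nonneg.2 h2) h.le]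
  rw [hXO] at hO1 hN1 hOD hTO
  rw [hXN] at hN1
  have hRabs : -Rω < Y Oω ∧ Y Oω < Rω := by
    apply abs_lt_of_sq_lt_sq' _ hRω.le
    have : 0 < a ^ 2 := by positivity
    linarith
  have hRk : 0 < Y Oω + Rω := by linarith [hRabs.1]
  have hRk' : 0 < Rω - Y Oω := by linarith [hRabs.2]
  have hYNv : Y N = Y Oω - Rω := by
    have : (Y N - (Y Oω - Rω)) * (Y N - (Y Oω + Rω)) = 0 := by linear_combination -hN1
    rcases mul_eq_zero.1 this with h | h <;> linarith
  have key := ajima_core a (X A) (Y A) (X I) r (X D) (Y D) ρ L1 L2 (Y Oω + Rω) (Rω - Y Oω)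
    ha hYA hr hρ pL1 pL2 (by rw [q1]; ring) (by rw [q2]; ring) gI1 gI3 gD1 gD2 hYD0 hRk hRk'
    (by linear_combination hO1) (by linear_combination hO1 - hOD)
  obtain ⟨t, ht, hTt⟩ := hTseg
  have hXT' : X T = t * X D := by rw [← hTt, hX, hXO]; ring
  have hYT' : Y T = Y Oω + t * (Y D - Y Oω) := by rw [← hTt, hY]
  have htR : t * (Rω + ρ) = Rω := by
    have h1 := ht.1
    have : (t * (Rω + ρ)) ^ 2 = Rω ^ 2 := by
      rw [hTO, hXT', hYT', mul_pow, hOD]; ring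
    exact (pow_left_inj₀ (by positivity) hRω.le two_ne_zero).1 this
  have ht0 : 0 < t := by
    have : 0 < t * (Rω + ρ) := by rw [htR]; exact hRω
    exact pos_of_mul_pos_left this (by positivity)
  have hG : 0 < Y D + ρ + (Rω - Y Oω) := by positivity
  have hmem : I ∈ affineSpan ℝ ({N, T} : Set Plane) := by
    rw [mem_affineSpan_pair_iff_exists_lineMap_eq]
    refine ⟨(r + (Rω - Y Oω)) / (t * (Y D + ρ + (Rω - Y Oω))), hext' _ _ ?_ ?_⟩
    · rw [hX, hXN, hXT']
      field_simp
      linear_combination t * key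
    · rw [hY, hYNv, hYT', gI2]
      have : Y Oω + t * (Y D - Y Oω) - (Y Oω - Rω) = t * (Y D + ρ + (Rω - Y Oω)) := by
        linear_combination -htR
      rw [this]
      field_simp
      ring
  have := collinear_insert_of_mem_affineSpan_pair hmem
  have hset : ({T, I, N} : Set Plane) = {I, N, T} := by
    ext z; simp only [Set.mem_insert_iff, Set.mem_singleton_iff]; tauto
  rw [hset]
  exact this
end

section
/- Line IE is parallel to line NJ. -/
open EuclideanGeometry Real RealInnerProductSpace Affine

lemma core1_s6 (x z r κ v o1 o2 R e j ρ : ℝ) (hx : 0 < x) (hz : 0 < z) (hr : 0 < r) (hv : 0 < v)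
    (hκ : 0 < κ) (hk : 2*κ*(x*z-r^2) = x)
    (ho1 : 2*v*o1 = 2*v*(x+z-κ*(z^2-r^2)) + (v^2-κ^2)*(2*z*r))
    (ho2 : 2*v*o2 = 2*v*(2*κ*z*r) + (v^2-κ^2)*(z^2-r^2))
    (hR : 2*v*R = (v^2+κ^2)*(z^2+r^2))
    (hj : j + (x+z) = 2*o1) (hjl : j < x+z) (he0 : 0 < e) (hej : e ≤ j)
    (her : e*r = x*ρ)
    (hCO : (x+z-o1)^2+o2^2 = R^2)
    (ht : (o1-e)^2+(o2-ρ)^2 = (R+ρ)^2) : v*e = v*x - r*κ := by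
  have hq : x*e^2 - 2*e*(o1*x+(o2+R)*r) + j*(x+z)*x = 0 := by
    have hj' : j = 2*o1-(x+z) := by linarith
    subst hj'
    linear_combination x*ht - x*hCO - 2*(o2+R)*her
  have hs : ∃ s, s*v = κ := ⟨κ/v, by field_simp⟩
  obtain ⟨s, rfl⟩ := hs
  have hs0 : 0 < s := by
    by_contra h
    nlinarith
  have ho1' : 2*o1 = 2*(x+z-s*v*(z^2-r^2)) + v*(1-s^2)*(2*z*r) := by
    apply mul_left_cancel₀ hv.ne'; linear_combination ho1
  have ho2' : 2*o2 = 2*(2*(s*v)*z*r) + v*(1-s^2)*(z^2-r^2) := by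
    apply mul_left_cancel₀ hv.ne'; linear_combination ho2
  have hR' : 2*R = v*(1+s^2)*(z^2+r^2) := by
    apply mul_left_cancel₀ hv.ne'; linear_combination hR
  have hq1 : x*(x-r*s)^2 - 2*(x-r*s)*(o1*x+(o2+R)*r) + j*(x+z)*x = 0 := by
    have hj' : j = 2*o1-(x+z) := by linarith
    have e1 : o1 = (x+z-s*v*(z^2-r^2)) + v*(1-s^2)*(z*r) := by linarith
    have e2 : o2 = (2*(s*v)*z*r) + v*(1-s^2)*(z^2-r^2)/2 := by linarith
    have e3 : R = v*(1+s^2)*(z^2+r^2)/2 := by linarith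
    have hne : s*(x*z-r^2) ≠ 0 := by
      intro h
      have : 2*(s*v)*(x*z-r^2) = 0 := by linear_combination 2*v*h
      linarith
    have e4 : v = x/(2*(s*(x*z-r^2))) := by
      rw [eq_div_iff (by simpa using hne)]; linear_combination hk
    have h1 : s ≠ 0 := hs0.ne'
    have h2 : x*z-r^2 ≠ 0 := fun h => hne (by rw [h]; ring)
    rw [hj', e1, e2, e3, e4]
    field_simp
    ring
  have hfac : (e-(x-r*s))*(e*(x-r*s) - j*(x+z)) = 0 := by
    apply mul_left_cancel₀ hx.ne'
    linear_combination (x-r*s)*hq - e*hq1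
  rcases mul_eq_zero.mp hfac with h | h
  · linear_combination v*h
  · exfalso
    have h1 : x - r*s < x+z := by have := mul_pos hr hs0; linarith
    have h2 := mul_lt_mul_of_pos_left h1 he0
    have h3 := mul_le_mul_of_nonneg_right hej (by linarith : 0 ≤ x+z)
    linarith

lemma aux_pos (c b d : ℝ) (hc : 0 < c) (hd : 0 < d) (h : c^2 = b^2+d^2) : 0 < c + b := by
  have h1 : |b| < c := by
    apply abs_lt_of_sq_lt_sq _ hc.le
    have := pow_pos hd 2
    linarith
  have := neg_abs_le b
  linarith

set_option maxHeartbeats 1000000 in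
lemma core2_s6 (l b1 b2 p i2 d1 d2 o1 o2 n1 n2 e j r R ρ α β γ α' β' γ' : ℝ)
    (hl : 0 < l) (hb2 : 0 < b2) (hr : 0 < r) (hR : 0 < R) (hρ : 0 < ρ)
    (hα : 0 ≤ α) (hβ : 0 ≤ β) (hγ : 0 ≤ γ) (hs : α+β+γ = 1)
    (hI1 : p = β*b1+γ*l) (hI2 : i2 = β*b2)
    (hα' : 0 ≤ α') (hβ' : 0 ≤ β') (hγ' : 0 ≤ γ') (hs' : α'+β'+γ' = 1)
    (hD1 : d1 = β'*b1+γ'*l) (hD2 : d2 = β'*b2)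
    (hIab : (p*b2-i2*b1)^2 = r^2*(b1^2+b2^2))
    (hIac : (i2*l)^2 = r^2*l^2)
    (hIbc : ((p-l)*b2-i2*(b1-l))^2 = r^2*((b1-l)^2+b2^2))
    (hDab : (d1*b2-d2*b1)^2 = ρ^2*(b1^2+b2^2))
    (hDac : (d2*l)^2 = ρ^2*l^2)
    (hEd : (d1-e)^2+d2^2 = ρ^2) (hel : e < l)
    (hB : (b1-o1)^2+(b2-o2)^2 = R^2) (hC : (l-o1)^2+o2^2 = R^2)
    (ht : (o1-d1)^2+(o2-d2)^2 = (R+ρ)^2)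
    (hEO : R^2 ≤ (e-o1)^2+o2^2)
    (hN : (n1-o1)^2+(n2-o2)^2 = R^2)
    (hNp : (n1-b1)^2+(n2-b2)^2 = (n1-l)^2+n2^2)
    (hNs : 0 < (n1-l)*b2 - n2*(b1-l))
    (hj0 : 0 < j) (hjl : j < l) (hJ : (j-o1)^2+o2^2 = R^2) :
    (n1-j)*i2 = n2*(p-e) := by
  have h1 : i2 = r := by
    have : (i2-r)*(i2+r) = 0 := by
      apply mul_left_cancel₀ (pow_pos hl 2).ne'; linear_combination hIac
    have : 0 ≤ i2 := by rw [hI2]; positivity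
    rcases mul_eq_zero.mp ‹(i2-r)*(i2+r) = 0› with h | h <;> linarith
  have h2 : d2 = ρ := by
    have : (d2-ρ)*(d2+ρ) = 0 := by
      apply mul_left_cancel₀ (pow_pos hl 2).ne'; linear_combination hDac
    have : 0 ≤ d2 := by rw [hD2]; positivity
    rcases mul_eq_zero.mp ‹(d2-ρ)*(d2+ρ) = 0› with h | h <;> linarith
  have h3 : d1 = e := by
    rw [h2] at hEd
    have : (d1-e)^2 = 0 := by linarith
    have := pow_eq_zero_iff (two_ne_zero) |>.mp this
    linarith
  have p1 : 0 ≤ p*b2-i2*b1 := by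
    have : p*b2-i2*b1 = γ*l*b2 := by rw [hI1, hI2]; ring
    rw [this]; positivity
  have p2 : 0 ≤ d1*b2-d2*b1 := by
    have : d1*b2-d2*b1 = γ'*l*b2 := by rw [hD1, hD2]; ring
    rw [this]; positivity
  have p3 : 0 ≤ (l-p)*b2-i2*(l-b1) := by
    have : (l-p)*b2-i2*(l-b1) = α*l*b2 := by rw [hI1, hI2, ← eq_sub_iff_add_eq.mpr (by linarith : α + (β+γ) = 1) |>.symm]; ring
    rw [this]; positivity
  clear hI1 hI2 hD1 hD2 hIac hDac hEd
  subst h1 h2 h3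
  obtain ⟨c, hc0, hc⟩ : ∃ c : ℝ, 0 < c ∧ c^2 = b1^2+b2^2 :=
    ⟨√(b1^2+b2^2), by positivity, Real.sq_sqrt (by positivity)⟩
  obtain ⟨a, ha0, ha⟩ : ∃ c : ℝ, 0 < c ∧ c^2 = (b1-l)^2+b2^2 :=
    ⟨√((b1-l)^2+b2^2), by positivity, Real.sq_sqrt (by positivity)⟩
  have q1 : p*b2-i2*b1 = i2*c := by
    rw [← sq_eq_sq₀ p1 (by positivity)]; rw [hIab, ← hc]; ring
  have q2 : d1*b2-d2*b1 = d2*c := by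
    rw [← sq_eq_sq₀ p2 (by positivity)]; rw [hDab, ← hc]; ring
  have q3 : (l-p)*b2-i2*(l-b1) = i2*a := by
    rw [← sq_eq_sq₀ p3 (by positivity)]; rw [mul_pow i2 a, ha]; linear_combination hIbc
  have cb : 0 < c + b1 := aux_pos c b1 b2 hc0 hb2 hc
  have ab : 0 < a + (l-b1) := aux_pos a (l-b1) b2 ha0 hb2 (by rw [ha]; ring)
  have hp : 0 < p := by
    have : 0 < p*b2 := by have := mul_pos hr cb; linarith
    exact pos_of_mul_pos_left this hb2.le
  have hd : 0 < d1 := by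
    have : 0 < d1*b2 := by have := mul_pos hρ cb; linarith
    exact pos_of_mul_pos_left this hb2.le
  have hz : 0 < l-p := by
    have : 0 < (l-p)*b2 := by have := mul_pos hr ab; linarith
    exact pos_of_mul_pos_left this hb2.le
  have her : d1*i2 = p*d2 := by
    apply mul_left_cancel₀ hb2.ne'; linear_combination i2*q2 - d2*q1
  have k1 : b2*(p^2-i2^2) = 2*b1*p*i2 := by
    apply mul_left_cancel₀ hb2.ne'; linear_combination hIab
  have k2 : b2*((l-p)^2-i2^2) = 2*(l-b1)*(l-p)*i2 := by
    apply mul_left_cancel₀ hb2.ne'; linear_combination hIbc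
  obtain ⟨z, rfl⟩ : ∃ z, l = p+z := ⟨l-p, by ring⟩
  simp only [add_sub_cancel_left] at *
  obtain ⟨κ, hκ⟩ : ∃ κ, b2 = 4*κ*z*i2 := ⟨b2/(4*z*i2), by field_simp⟩
  have hκ0 : 0 < κ := by
    rw [hκ] at hb2
    by_contra h
    have := mul_nonneg (neg_nonneg.mpr (not_lt.mp h)) (mul_pos hz hr).le
    linarith
  have hb1 : b1 = p+z - 2*κ*(z^2-i2^2) := by
    have : (2*z*i2) ≠ 0 := by positivity
    apply mul_left_cancel₀ this
    rw [hκ] at k2; linear_combination k2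
  have hk : 2*κ*(p*z-i2^2) = p := by
    have : (2*z*i2*(p+z)) ≠ 0 := by positivity
    apply mul_left_cancel₀ this
    rw [hκ, hb1] at k1
    linear_combination z * k1
  have hw : 0 < z^2+i2^2 := by positivity
  -- perpendicular bisector parametrization
  have par : ∀ m1 m2 : ℝ, (m1-b1)^2+(m2-b2)^2 = (m1-(p+z))^2+m2^2 →
      ∃ v, m1 = p+z-κ*(z^2-i2^2)+v*(2*z*i2) ∧ m2 = 2*κ*z*i2+v*(z^2-i2^2) ∧
        v*(z^2+i2^2)^2 = (m1-(p+z-κ*(z^2-i2^2)))*(2*z*i2)+(m2-2*κ*z*i2)*(z^2-i2^2) := by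
    intro m1 m2 h
    have hh : -(m1-(p+z-κ*(z^2-i2^2)))*(z^2-i2^2)+(m2-2*κ*z*i2)*(2*z*i2) = 0 := by
      have : 4*κ ≠ 0 := by positivity
      apply mul_left_cancel₀ this
      rw [hb1, hκ] at h
      linear_combination -h
    refine ⟨((m1-(p+z-κ*(z^2-i2^2)))*(2*z*i2)+(m2-2*κ*z*i2)*(z^2-i2^2))/(z^2+i2^2)^2, ?_, ?_, ?_⟩
    · field_simp
      linear_combination -(z^2-i2^2)*hh
    · field_simp
      linear_combination (2*z*i2)*hh
    · field_simp
  obtain ⟨v, hn1, hn2, hv⟩ := par n1 n2 hNp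
  obtain ⟨w, ho1, ho2, -⟩ := par o1 o2 (by linear_combination hB - hC)
  have hv0 : 0 < v := by
    have : (n1-(p+z))*b2 - n2*(b1-(p+z)) = v*(2*κ*(z^2+i2^2)^2) := by
      rw [hn1, hn2, hb1, hκ]; ring
    rw [this] at hNs
    exact pos_of_mul_pos_left hNs (by positivity)
  have g1 : (v-w)^2*(z^2+i2^2)^2 = R^2 := by rw [← hN, hn1, hn2, ho1, ho2]; ring
  have g2 : (κ^2+w^2)*(z^2+i2^2)^2 = R^2 := by rw [← hC, ho1, ho2]; ring
  have g3 : 2*v*w = v^2-κ^2 := by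
    apply mul_left_cancel₀ (pow_pos hw 2).ne'; linear_combination g2-g1
  have g4 : 2*v*R = (v^2+κ^2)*(z^2+i2^2) := by
    rw [← sq_eq_sq₀ (by positivity) (by positivity)]
    rw [mul_pow, ← g1]
    have : 2*v*(v-w) = v^2+κ^2 := by linear_combination -g3
    rw [← this]; ring
  have hjj : j + (p+z) = 2*o1 := by
    have : j-(p+z) ≠ 0 := (sub_neg.mpr hjl).ne
    apply mul_left_cancel₀ this; linear_combination hJ - hC
  have hej : d1 ≤ j := by
    by_contra h
    push Not at h
    have : 0 ≤ (d1-j)*(d1-(p+z)) := by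
      have e1 : (d1-j)*(d1-(p+z)) = (d1-o1)^2+o2^2 - R^2 := by
        rw [← hC]
        have : j = 2*o1-(p+z) := by linarith
        rw [this]; ring
      rw [e1]; linarith
    have := mul_pos (sub_pos.mpr h) (sub_pos.mpr hel)
    linarith
  have key := core1_s6 p z i2 κ v o1 o2 R d1 j d2 hp hz hr hv0 hκ0 hk
    (by rw [ho1]; linear_combination (2*z*i2)*g3) (by rw [ho2]; linear_combination (z^2-i2^2)*g3) g4 hjj hjl hd hej her hC ht
  have hj' : j = 2*o1-(p+z) := by linarith
  apply mul_left_cancel₀ hv0.ne'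
  have f1 : v*(n1-j) = κ*n2 := by
    rw [hj', ho1, hn1, hn2]; linear_combination (-2*z*i2)*g3
  linear_combination i2*f1 + n2*key

lemma pl_sq (P Q : Plane) (k : ℝ) (h : dist P Q = k) : (P 0 - Q 0)^2+(P 1 - Q 1)^2 = k^2 := by
  rw [← h, EuclideanSpace.dist_eq, Real.sq_sqrt (by positivity)]
  simp [Fin.sum_univ_two, Real.dist_eq, sq_abs]

lemma pl_line (P A B : Plane) (h : P ∈ affineSpan ℝ ({A, B} : Set Plane)) :
    ∃ t : ℝ, ∀ i, P i = A i + t * (B i - A i) := by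
  obtain ⟨t, rfl⟩ := (mem_affineSpan_pair_iff_exists_lineMap_eq).mp h
  refine ⟨t, fun i => ?_⟩
  simp [AffineMap.lineMap_apply]
  ring

lemma pl_inf (P A B : Plane) (r : ℝ)
    (h : Metric.infDist P (affineSpan ℝ ({A, B} : Set Plane) : Set Plane) = r) :
    ((P 0 - A 0)*(B 1 - A 1) - (P 1 - A 1)*(B 0 - A 0))^2
      = r^2*((B 0 - A 0)^2+(B 1 - A 1)^2) := by
  have hA : A ∈ affineSpan ℝ ({A, B} : Set Plane) := left_mem_affineSpan_pair ℝ A B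
  have hB : B ∈ affineSpan ℝ ({A, B} : Set Plane) := right_mem_affineSpan_pair ℝ A B
  have : Nonempty (affineSpan ℝ ({A, B} : Set Plane)) := ⟨⟨A, hA⟩⟩
  rw [← dist_orthogonalProjection_eq_infDist] at h
  have h1 := pl_sq _ _ _ h
  have h2 := EuclideanGeometry.orthogonalProjection_mem (s := affineSpan ℝ ({A, B} : Set Plane)) P
  have h3 := EuclideanGeometry.vsub_orthogonalProjection_mem_direction_orthogonal
    (affineSpan ℝ ({A, B} : Set Plane)) P
  generalize ((EuclideanGeometry.orthogonalProjection (affineSpan ℝ ({A, B} : Set Plane)) P :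
    affineSpan ℝ ({A, B} : Set Plane)) : Plane) = Q at *
  have h4 := (Submodule.mem_orthogonal _ _).mp h3 (B -ᵥ A) (AffineSubspace.vsub_mem_direction hB hA)
  simp [PiLp.inner_apply, Fin.sum_univ_two] at h4
  obtain ⟨t, ht⟩ := pl_line _ _ _ h2
  have t0 := ht 0
  have t1 := ht 1
  rw [← h1]
  have e0 : P 0 = (P 0 - Q 0) + A 0 + t*(B 0 - A 0) := by rw [t0]; ring
  have e1 : P 1 = (P 1 - Q 1) + A 1 + t*(B 1 - A 1) := by rw [t1]; ring
  have : (P 0 - A 0)*(B 1 - A 1) - (P 1 - A 1)*(B 0 - A 0)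
    = (P 0 - Q 0)*(B 1 - A 1) - (P 1 - Q 1)*(B 0 - A 0) := by rw [t0, t1]; ring
  rw [this]
  generalize P 0 - Q 0 = u at *
  generalize P 1 - Q 1 = w at *
  linear_combination -(u*(B 0 - A 0)+w*(B 1 - A 1)) * h4

lemma pl_hull (P A B C : Plane) (h : P ∈ convexHull ℝ ({A, B, C} : Set Plane)) :
    ∃ α β γ : ℝ, 0 ≤ α ∧ 0 ≤ β ∧ 0 ≤ γ ∧ α+β+γ = 1 ∧ ∀ i, P i = α*A i + β*B i+γ*C i := by
  rw [convexHull_insert (by simp), convexHull_pair, mem_convexJoin] at h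
  obtain ⟨a, ha, b, hb, hP⟩ := h
  rw [Set.mem_singleton_iff] at ha
  subst ha
  obtain ⟨s, t, hs, ht, hst, rfl⟩ := hb
  obtain ⟨s', t', hs', ht', hst', rfl⟩ := hP
  refine ⟨s', t'*s, t'*t, hs', by positivity, by positivity, ?_, fun i => ?_⟩
  · linear_combination hst' + t'*hst
  · simp; ring

lemma pl_opp (N T B C : Plane) (h : (affineSpan ℝ ({B, C} : Set Plane)).SOppSide N T) :
    ((N 0 - C 0)*(B 1 - C 1) - (N 1 - C 1)*(B 0 - C 0)) *
    ((T 0 - C 0)*(B 1 - C 1) - (T 1 - C 1)*(B 0 - C 0)) ≤ 0 := by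
  obtain ⟨⟨p, hp, q, hq, hr⟩, -, -⟩ := h
  obtain ⟨s, hs⟩ := pl_line _ _ _ hp
  obtain ⟨t, ht⟩ := pl_line _ _ _ hq
  have s0 := hs 0
  have s1 := hs 1
  have t0 := ht 0
  have t1 := ht 1
  obtain ⟨u, a, b, ha, hb, -, h1, h2⟩ := hr.exists_eq_smul
  have f (i) : N i - p i = a * u i := by simpa using congrArg (fun v : Plane => v i) h1
  have g (i) : q i - T i = b * u i := by simpa using congrArg (fun v : Plane => v i) h2
  have N0 : N 0 = a*u 0 + p 0 := by linarith [f 0]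
  have N1 : N 1 = a*u 1 + p 1 := by linarith [f 1]
  have T0 : T 0 = q 0 - b*u 0 := by linarith [g 0]
  have T1 : T 1 = q 1 - b*u 1 := by linarith [g 1]
  have : ((N 0 - C 0)*(B 1 - C 1) - (N 1 - C 1)*(B 0 - C 0)) *
    ((T 0 - C 0)*(B 1 - C 1) - (T 1 - C 1)*(B 0 - C 0)) =
     - (a*b*(u 0*(B 1 - C 1) - u 1*(B 0 - C 0))^2) := by
    rw [N0, N1, T0, T1, s0, s1, t0, t1]; ring
  rw [this]
  have : 0 ≤ a*b*(u 0*(B 1 - C 1) - u 1*(B 0 - C 0))^2 := by positivity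
  linarith

lemma pl_mem (N B C : Plane) (hBC : B ≠ C)
    (h : (N 0 - C 0)*(B 1 - C 1) - (N 1 - C 1)*(B 0 - C 0) = 0) :
    N ∈ affineSpan ℝ ({B, C} : Set Plane) := by
  rw [mem_affineSpan_pair_iff_exists_lineMap_eq]
  have h0 : (C 0 - B 0)^2 + (C 1 - B 1)^2 ≠ 0 := by
    intro h0
    apply hBC
    have a0 : C 0 - B 0 = 0 := by nlinarith [sq_nonneg (C 0 - B 0), sq_nonneg (C 1 - B 1)]
    have a1 : C 1 - B 1 = 0 := by nlinarith [sq_nonneg (C 0 - B 0), sq_nonneg (C 1 - B 1)]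
    ext i; fin_cases i
    · simp; linarith
    · simp; linarith
  refine ⟨((N 0 - B 0)*(C 0 - B 0) + (N 1 - B 1)*(C 1 - B 1))/((C 0 - B 0)^2 + (C 1 - B 1)^2), ?_⟩
  ext i; fin_cases i
  · simp [AffineMap.lineMap_apply]; field_simp; linear_combination (C 1 - B 1)*h
  · simp [AffineMap.lineMap_apply]; field_simp; linear_combination -(C 0 - B 0)*h

/-- the tangency point is unique -/
lemma pl_tan (O D T X : Plane) (R ρ : ℝ) (hR : 0 < R) (hρ : 0 < ρ) (h : dist O D = R+ρ)
    (h1 : dist T O = R) (h2 : dist T D = ρ) (h3 : dist X O = R) (h4 : dist X D = ρ) : X = T := by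
  have key : ∀ Y : Plane, dist Y O = R → dist Y D = ρ →
      (R+ρ)*(Y 0 - O 0) = R*(D 0 - O 0) ∧ (R+ρ)*(Y 1 - O 1) = R*(D 1 - O 1) := by
    intro Y a b
    have a' := pl_sq _ _ _ a
    have b' := pl_sq _ _ _ b
    have h' := pl_sq _ _ _ h
    have : ((R+ρ)*(Y 0 - O 0) - R*(D 0 - O 0))^2 + ((R+ρ)*(Y 1 - O 1) - R*(D 1 - O 1))^2 = 0 := by
      linear_combination ((R+ρ)^2 - R*(R+ρ))*a' + (R^2 - R*(R+ρ))*h' + R*(R+ρ)*b'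
    have e0 := sq_nonneg ((R+ρ)*(Y 0 - O 0) - R*(D 0 - O 0))
    have e1 := sq_nonneg ((R+ρ)*(Y 1 - O 1) - R*(D 1 - O 1))
    constructor
    · have := pow_eq_zero_iff two_ne_zero |>.mp (le_antisymm (by linarith) e0); linarith
    · have := pow_eq_zero_iff two_ne_zero |>.mp (le_antisymm (by linarith) e1); linarith
  obtain ⟨a, b⟩ := key T h1 h2
  obtain ⟨c, d⟩ := key X h3 h4
  have hp : R+ρ ≠ 0 := by positivity
  ext i; fin_cases i
  · have : (R+ρ)*X 0 = (R+ρ)*T 0 := by linarith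
    exact mul_left_cancel₀ hp this
  · have : (R+ρ)*X 1 = (R+ρ)*T 1 := by linarith
    exact mul_left_cancel₀ hp this

lemma pl_frame (A B C : Plane) (hAC : A ≠ C)
    (hd : (B 0 - A 0)*(C 1 - A 1) - (B 1 - A 1)*(C 0 - A 0) ≠ 0) :
    ∃ c s σ l : ℝ, c^2+s^2 = 1 ∧ σ^2 = 1 ∧ 0 < l ∧ C 0 - A 0 = l*c ∧ C 1 - A 1 = l*s ∧
      0 < σ*(c*(B 1 - A 1) - s*(B 0 - A 0)) := by
  have h := pl_sq C A _ rfl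
  have hl : 0 < dist C A := dist_pos.mpr hAC.symm
  set l := dist C A
  have h0 : C 0 - A 0 = l*((C 0 - A 0)/l) := by field_simp
  have h1 : C 1 - A 1 = l*((C 1 - A 1)/l) := by field_simp
  have hcs : ((C 0 - A 0)/l)^2+((C 1 - A 1)/l)^2 = 1 := by field_simp; linarith
  generalize (C 0 - A 0)/l = c at *
  generalize (C 1 - A 1)/l = s at *
  rw [h0, h1] at hd
  have hne : c*(B 1 - A 1) - s*(B 0 - A 0) ≠ 0 := by
    intro h; apply hd; linear_combination -l*h
  rcases lt_or_gt_of_ne hne with h' | h'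
  · exact ⟨c, s, -1, l, hcs, by norm_num, hl, h0, h1, by linarith⟩
  · exact ⟨c, s, 1, l, hcs, by norm_num, hl, h0, h1, by linarith⟩

/-- In the Ajima-circle configuration, let `N` be the point of `ω` on the
perpendicular bisector of `BC` opposite `T`, let `J` be a point where `ω` meets the
open segment `AC`, and let `E` be the touch point of `γ` with `AC`.
Then `IE ∥ NJ`. -/
theorem IE_parallel_NJ
    (A B C I Oω D T : Plane) (r Rω ρ : ℝ)
    (hABC : AffineIndependent ℝ ![A, B, C])
    (hr : 0 < r)
    (hIin : I ∈ interior (convexHull ℝ ({A, B, C} : Set Plane)))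
    (hIab : Metric.infDist I (affineSpan ℝ ({A, B} : Set Plane) : Set Plane) = r)
    (hIbc : Metric.infDist I (affineSpan ℝ ({B, C} : Set Plane) : Set Plane) = r)
    (hIca : Metric.infDist I (affineSpan ℝ ({C, A} : Set Plane) : Set Plane) = r)
    (hRω : 0 < Rω) (hρ : 0 < ρ)
    (hBω : dist B Oω = Rω) (hCω : dist C Oω = Rω)
    (hγin : Metric.sphere D ρ ⊆ convexHull ℝ ({A, B, C} : Set Plane))
    (hγAB : Metric.infDist D (affineSpan ℝ ({A, B} : Set Plane) : Set Plane) = ρ)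
    (hγAC : Metric.infDist D (affineSpan ℝ ({A, C} : Set Plane) : Set Plane) = ρ)
    (hext : dist Oω D = Rω + ρ)
    (hTω : dist T Oω = Rω) (hTγ : dist T D = ρ)
    (hTseg : Wbtw ℝ Oω T D)
    (hTin : T ∈ interior (convexHull ℝ ({A, B, C} : Set Plane)))
    (N J E : Plane)
    (hNω : dist N Oω = Rω)
    (hNperp : dist N B = dist N C)
    (hNside : (affineSpan ℝ ({B, C} : Set Plane)).SOppSide N T)
    (hJseg : J ∈ openSegment ℝ A C) (hJω : dist J Oω = Rω)
    (hE : E ∈ affineSpan ℝ ({A, C} : Set Plane)) (hEγ : dist D E = ρ) :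
    affineSpan ℝ ({I, E} : Set Plane) ∥ affineSpan ℝ ({N, J} : Set Plane) := by
  have hAB : A ≠ B := fun h => by
    have := hABC.injective.ne (show (0 : Fin 3) ≠ 1 by decide)
    exact this h
  have hAC : A ≠ C := fun h => by
    have := hABC.injective.ne (show (0 : Fin 3) ≠ 2 by decide)
    exact this h
  have hBC : B ≠ C := fun h => by
    have := hABC.injective.ne (show (1 : Fin 3) ≠ 2 by decide)
    exact this h
  obtain ⟨α, β, γ, hα, hβ, hγ, hs, hI⟩ := pl_hull _ _ _ _ (interior_subset hIin)
  obtain ⟨αT, βT, γT, hαT, hβT, hγT, hsT, hT⟩ := pl_hull _ _ _ _ (interior_subset hTin)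
  have hDh : D ∈ convexHull ℝ ({A, B, C} : Set Plane) := by
    obtain ⟨v, hv⟩ : ∃ v : Plane, ‖v‖ = ρ := by
      obtain ⟨v, hv⟩ := exists_norm_eq Plane hρ.le
      exact ⟨v, hv⟩
    have m1 : D + v ∈ convexHull ℝ ({A, B, C} : Set Plane) := hγin (by simp [hv])
    have m2 : D - v ∈ convexHull ℝ ({A, B, C} : Set Plane) := hγin (by simp [dist_eq_norm, hv])
    have := (convex_convexHull ℝ ({A, B, C} : Set Plane)) m1 m2
      (by norm_num : (0:ℝ) ≤ 1/2) (by norm_num : (0:ℝ) ≤ 1/2) (by norm_num)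
    convert this using 1
    ext i; simp; ring
  have hEh : E ∈ convexHull ℝ ({A, B, C} : Set Plane) :=
    hγin (by rw [Metric.mem_sphere, dist_comm]; exact hEγ)
  obtain ⟨αD, βD, γD, hαD, hβD, hγD, hsD, hD⟩ := pl_hull _ _ _ _ hDh
  obtain ⟨αE, βE, γE, hαE, hβE, hγE, hsE, hEb⟩ := pl_hull _ _ _ _ hEh
  have iab := pl_inf _ _ _ _ hIab
  have ibc := pl_inf _ _ _ _ hIbc
  have ica := pl_inf _ _ _ _ hIca
  have dab := pl_inf _ _ _ _ hγAB
  have dac := pl_inf _ _ _ _ hγAC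
  have hTn : T ∉ affineSpan ℝ ({B, C} : Set Plane) := hNside.2.2
  have hNn : N ∉ affineSpan ℝ ({B, C} : Set Plane) := hNside.2.1
  have hEC : E ≠ C := by
    rintro rfl
    have := pl_tan Oω D T E Rω ρ hRω hρ hext hTω hTγ hCω (by rw [dist_comm]; exact hEγ)
    apply hTn
    rw [← this]
    exact right_mem_affineSpan_pair ℝ B E
  have hEO : Rω ≤ dist E Oω := by
    have := dist_triangle Oω E D
    rw [dist_comm Oω E, dist_comm E D] at this
    linarith
  have hEO' : Rω^2 ≤ (E 0 - Oω 0)^2+(E 1 - Oω 1)^2 := by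
    rw [pl_sq E Oω _ rfl]; exact pow_le_pow_left₀ hRω.le hEO 2
  have sB := pl_sq _ _ _ hBω
  have sC := pl_sq _ _ _ hCω
  have sD := pl_sq _ _ _ hext
  have sN := pl_sq _ _ _ hNω
  have sJ := pl_sq _ _ _ hJω
  have sE := pl_sq _ _ _ hEγ
  have sNp : (N 0 - B 0)^2+(N 1 - B 1)^2 = (N 0 - C 0)^2+(N 1 - C 1)^2 := by
    rw [pl_sq N B _ hNperp, pl_sq N C _ rfl]
  have hopp := pl_opp _ _ _ _ hNside
  obtain ⟨tE, htE⟩ := pl_line _ _ _ hE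
  obtain ⟨sj, tj, hsj, htj, hstj, rfl⟩ := hJseg
  have hI0 := hI 0
  have hI1 := hI 1
  have hT0 := hT 0
  have hT1 := hT 1
  have hD0 := hD 0
  have hD1 := hD 1
  have hE0 := hEb 0
  have hE1 := hEb 1
  have hd : (B 0 - A 0)*(C 1 - A 1) - (B 1 - A 1)*(C 0 - A 0) ≠ 0 := by
    intro h
    have e : (I 0 - A 0)*(B 1 - A 1) - (I 1 - A 1)*(B 0 - A 0) = 0 := by
      have : α = 1-β-γ := by linarith
      rw [hI0, hI1, this]; linear_combination -γ*h
    rw [e] at iab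
    have := pl_sq B A _ rfl
    rw [this] at iab
    have : 0 < r^2*(dist B A)^2 := by
      have := dist_pos.mpr hAB.symm
      positivity
    linarith
  have hNne : (N 0 - C 0)*(B 1 - C 1) - (N 1 - C 1)*(B 0 - C 0) ≠ 0 := fun h =>
    hNn (pl_mem _ _ _ hBC h)
  have hTne : (T 0 - C 0)*(B 1 - C 1) - (T 1 - C 1)*(B 0 - C 0) ≠ 0 := fun h =>
    hTn (pl_mem _ _ _ hBC h)
  obtain ⟨c, s, σ, l, hcs, hσ, hl, hc0, hc1, hb⟩ := pl_frame A B C hAC hd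
  have hC0 : C 0 = A 0 + l*c := by linarith
  have hC1 : C 1 = A 1 + l*s := by linarith
  -- frame coordinates
  obtain ⟨f, hf⟩ : ∃ f : Plane → ℝ, ∀ P, f P = c*(P 0 - A 0)+s*(P 1 - A 1) := ⟨_, fun _ => rfl⟩
  obtain ⟨g, hg⟩ : ∃ g : Plane → ℝ, ∀ P, g P = σ*(c*(P 1 - A 1)-s*(P 0 - A 0)) := ⟨_, fun _ => rfl⟩
  have x0 (P : Plane) : P 0 = A 0 + c*f P - s*σ*g P := by
    rw [hf, hg]; linear_combination (A 0 - P 0)*hcs + (s*(c*(P 1 - A 1)-s*(P 0 - A 0)))*hσ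
  have x1 (P : Plane) : P 1 = A 1 + s*f P + c*σ*g P := by
    rw [hf, hg]; linear_combination (A 1 - P 1)*hcs - (c*(c*(P 1 - A 1)-s*(P 0 - A 0)))*hσ
  have dd (P Q : Plane) : (P 0 - Q 0)^2+(P 1 - Q 1)^2 = (f P - f Q)^2+(g P - g Q)^2 := by
    rw [x0 P, x0 Q, x1 P, x1 Q]
    linear_combination ((f P - f Q)^2+σ^2*(g P - g Q)^2)*hcs + (g P - g Q)^2*hσ
  have cc (P Q S U : Plane) : (P 0 - Q 0)*(S 1 - U 1)-(P 1 - Q 1)*(S 0 - U 0)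
      = σ*((f P - f Q)*(g S - g U) - (g P - g Q)*(f S - f U)) := by
    rw [x0 P, x0 Q, x1 P, x1 Q, x0 S, x0 U, x1 S, x1 U]
    linear_combination (σ*((f P - f Q)*(g S - g U) - (g P - g Q)*(f S - f U)))*hcs
  have fA : f A = 0 := by rw [hf]; ring
  have gA : g A = 0 := by rw [hg]; ring
  have fC : f C = l := by rw [hf, hC0, hC1]; linear_combination l*hcs
  have gC : g C = 0 := by rw [hg, hC0, hC1]; ring
  have gB : 0 < g B := by rw [hg]; exact hb
  have bary (P : Plane) (a b k : ℝ) (hk : a+b+k = 1) (h0 : P 0 = a*A 0+b*B 0+k*C 0)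
      (h1 : P 1 = a*A 1+b*B 1+k*C 1) : f P = b*f B + k*l ∧ g P = b*g B := by
    have ha : a = 1-b-k := by linarith
    constructor
    · rw [← fC, hf, hf, hf, h0, h1, ha]; ring
    · have : g P = b*g B + k*g C := by rw [hg, hg, hg, h0, h1, ha]; ring
      rw [this, gC]; ring
  obtain ⟨fI, gI⟩ := bary I α β γ hs hI0 hI1
  obtain ⟨fD, gD⟩ := bary D αD βD γD hsD hD0 hD1
  obtain ⟨fT, gT⟩ := bary T αT βT γT hsT hT0 hT1
  obtain ⟨fE, gE⟩ := bary E αE βE γE hsE hE0 hE1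
  have gE0 : g E = 0 := by
    rw [hg, htE 0, htE 1, hC0, hC1]; ring
  have hβE0 : βE = 0 := by
    rcases mul_eq_zero.mp (gE.symm.trans gE0) with h | h
    · exact h
    · linarith
  have hel : f E < l := by
    have h1 : f E ≤ l := by
      rw [fE, hβE0]
      have := mul_le_mul_of_nonneg_right (by linarith : γE ≤ 1) hl.le
      linarith
    refine lt_of_le_of_ne h1 (fun h => hEC ?_)
    ext i; fin_cases i
    · change E 0 = C 0
      rw [x0 E, x0 C, h, fC, gE0, gC]
    · change E 1 = C 1
      rw [x1 E, x1 C, h, fC, gE0, gC]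
  generalize hJd : sj • A + tj • C = J at *
  have hJ0 : J 0 = sj*A 0 + 0*B 0+tj*C 0 := by rw [← hJd]; simp
  have hJ1 : J 1 = sj*A 1 + 0*B 1+tj*C 1 := by rw [← hJd]; simp
  obtain ⟨fJ, gJ⟩ := bary J sj 0 tj (by linarith) hJ0 hJ1
  rw [zero_mul] at gJ
  rw [zero_mul, zero_add] at fJ
  rw [dd] at sB sC sD sN sJ sE hEO'
  rw [dd, dd] at sNp
  rw [cc, dd] at iab ibc ica dab dac
  rw [cc, cc] at hopp
  rw [cc] at hNne hTne
  simp only [fA, gA, fC, gC, gE0, gJ, sub_zero, zero_sub] at sB sC sD sN sJ sE hEO' sNp iab ibc ica dab dac hopp hNne hTne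
  have hNs : 0 < (f N - l)*g B - g N*(f B - l) := by
    have e1 : (f T - l)*g B - g T*(f B - l) = -(αT*l*g B) := by
      rw [fT, gT]; have : αT = 1-βT-γT := by linarith
      rw [this]; ring
    have e2 : αT*l*g B ≥ 0 := by positivity
    have e3 : 0 < αT*l*g B := by
      refine lt_of_le_of_ne e2 (fun h => hTne ?_)
      rw [e1, ← h]; ring
    rw [e1] at hopp
    have e4 : 0 ≤ ((f N - l)*g B - g N*(f B - l))*(αT*l*g B) := by
      have : σ*((f N - l)*g B - g N*(f B - l)) * (σ*(-(αT*l*g B))) =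
        -(((f N - l)*g B - g N*(f B - l))*(αT*l*g B)) := by
        linear_combination (-(((f N - l)*g B - g N*(f B - l))*(αT*l*g B)))*hσ
      linarith
    have e5 := nonneg_of_mul_nonneg_left e4 e3
    refine lt_of_le_of_ne e5 (fun h => hNne ?_)
    rw [← h]; ring
  have hjl : f J < l := by
    rw [fJ]
    have := mul_lt_mul_of_pos_right (by linarith : tj < 1) hl
    linarith
  have hj0 : 0 < f J := by rw [fJ]; positivity
  have key := core2_s6 l (f B) (g B) (f I) (g I) (f D) (g D) (f Oω) (g Oω) (f N) (g N) (f E) (f J)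
    r Rω ρ α β γ αD βD γD hl gB hr hRω hρ hα hβ hγ hs fI gI hαD hβD hγD hsD fD gD
    (by linear_combination iab - (f I*g B - g I*f B)^2*hσ)
    (by linear_combination ica - (g I * l)^2*hσ)
    (by linear_combination ibc - ((f I-l)*g B-g I*(f B-l))^2*hσ)
    (by linear_combination dab - (f D*g B - g D*f B)^2*hσ)
    (by linear_combination dac - (g D * l)^2*hσ)
    (by linear_combination sE) hel (by linear_combination sB) (by linear_combination sC)
    (by linear_combination sD) (by linarith)
    (by linear_combination sN) (by linear_combination sNp) hNs hj0 hjl (by linear_combination sJ)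
  have gIne : g I ≠ 0 := by
    intro h
    rw [h] at ica
    have : 0 < r^2*l^2 := by positivity
    apply this.ne
    linear_combination ica
  have gNne : g N ≠ 0 := by
    intro h
    rw [h] at key hNs
    have : f N = f J := by
      have := mul_eq_zero.mp (key.trans (zero_mul _))
      rcases this with h | h
      · linarith
      · exact absurd h gIne
    rw [this] at hNs
    have := mul_pos (sub_pos.mpr hjl) gB
    linarith
  rw [AffineSubspace.affineSpan_pair_parallel_iff_exists_unit_smul']
  refine ⟨Units.mk0 (g N / g I) (div_ne_zero gNne gIne), ?_⟩
  ext i; fin_cases i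
  · change g N / g I * (E 0 - I 0) = J 0 - N 0
    rw [x0 E, x0 I, x0 J, x0 N, gE0, gJ]
    field_simp
    linear_combination c*key
  · change g N / g I * (E 1 - I 1) = J 1 - N 1
    rw [x1 E, x1 I, x1 J, x1 N, gE0, gJ]
    field_simp
    linear_combination s*key
end
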